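/- arXiv:1708.05040 — 2 statements merged into one kernel-verified Lean document; each statement's English description precedes it below -/
import Mathlib

section
/- Let n > m ≥ 7, let W ∈ C¹((−∞,1],ℝ) satisfy W(0)=0, W(t)>0 for all t ∈ (−∞,1]\{0}, and W strictly convex, and let B^m be the open unit ball in ℝ^m. Let the boundary data be u_bd(x) = (x, 0_{ℝ^{n−m}}) for x ∈ ∂B^m, and let h_ε be the increasing positive solution of −h'' − ((m−1)/r) h' + ((m−1)/r²) h = (1/ε²) h W'(1 − h²) on (0,1) with h(0)=0, h(1)=1. Then for every ε > 0, the map u_ε(x) = (h_ε(|x|) x/|x|, 0_{ℝ^{n−m}}) is the unique minimiser of E_ε over 𝒜. -/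
open MeasureTheory Set Bornology

noncomputable section

/-- Euclidean dot product on `Fin n → ℝ`. -/
def dotR {n : ℕ} (a b : Fin n → ℝ) : ℝ := ∑ j, a j * b j

/-- Squared Euclidean norm on `Fin n → ℝ`. -/
def normSq {n : ℕ} (a : Fin n → ℝ) : ℝ := ∑ j, a j ^ 2

/-- Pointwise (Frobenius) inner product of gradients `∇u · ∇v`. -/
def gradDot {m n : ℕ} (u v : (Fin m → ℝ) → Fin n → ℝ) (x : Fin m → ℝ) : ℝ :=
  ∑ i, ∑ j, fderiv ℝ u x (Pi.single i (1:ℝ)) j * fderiv ℝ v x (Pi.single i (1:ℝ)) j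

/-- `|∇u|²`. -/
def gradSq {m n : ℕ} (u : (Fin m → ℝ) → Fin n → ℝ) (x : Fin m → ℝ) : ℝ := gradDot u u x

/-- Scalar version of `gradDot`. -/
def gradDotS {m : ℕ} (φ ψ : (Fin m → ℝ) → ℝ) (x : Fin m → ℝ) : ℝ :=
  ∑ i, fderiv ℝ φ x (Pi.single i (1:ℝ)) * fderiv ℝ ψ x (Pi.single i (1:ℝ))

/-- `|∇φ|²` for scalar `φ`. -/
def gradSqS {m : ℕ} (φ : (Fin m → ℝ) → ℝ) (x : Fin m → ℝ) : ℝ := gradDotS φ φ x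

/-- `W'`, the (one-sided) derivative of the potential on `(-∞, 1]`. -/
def Wd (W : ℝ → ℝ) : ℝ → ℝ := derivWithin W (Iic (1:ℝ))

/-- The Ginzburg–Landau energy `E_ε`. -/
def GLenergy {m n : ℕ} (W : ℝ → ℝ) (ε : ℝ) (Ω : Set (Fin m → ℝ))
    (u : (Fin m → ℝ) → Fin n → ℝ) : ℝ :=
  ∫ x in Ω, (gradSq u x / 2 + W (1 - normSq (u x)) / (2 * ε ^ 2))

/-- The admissible class `𝒜`: `H¹` maps attaining the boundary data `ubd` on `∂Ω`. -/
def Admissible {m n : ℕ} (Ω : Set (Fin m → ℝ)) (ubd u : (Fin m → ℝ) → Fin n → ℝ) : Prop :=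
  ContDiffOn ℝ 1 u Ω ∧ ContinuousOn u (closure Ω) ∧
  IntegrableOn (gradSq u) Ω ∧ IntegrableOn (fun x => normSq (u x)) Ω ∧
  EqOn u ubd (frontier Ω)

/-- `H¹₀(Ω; ℝⁿ)`. -/
def H10 {m n : ℕ} (Ω : Set (Fin m → ℝ)) (v : (Fin m → ℝ) → Fin n → ℝ) : Prop :=
  ContDiffOn ℝ 1 v Ω ∧ ContinuousOn v (closure Ω) ∧
  IntegrableOn (gradSq v) Ω ∧ IntegrableOn (fun x => normSq (v x)) Ω ∧
  EqOn v 0 (frontier Ω)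

/-- `H¹₀(Ω; ℝ)`. -/
def H10S {m : ℕ} (Ω : Set (Fin m → ℝ)) (φ : (Fin m → ℝ) → ℝ) : Prop :=
  ContDiffOn ℝ 1 φ Ω ∧ ContinuousOn φ (closure Ω) ∧
  IntegrableOn (gradSqS φ) Ω ∧ IntegrableOn (fun x => φ x ^ 2) Ω ∧
  EqOn φ 0 (frontier Ω)

/-- Critical point of `E_ε`: weak solution of `-Δu = ε⁻² u W'(1-|u|²)` in `Ω`. -/
def IsCritical {m n : ℕ} (W : ℝ → ℝ) (ε : ℝ) (Ω : Set (Fin m → ℝ))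
    (u : (Fin m → ℝ) → Fin n → ℝ) : Prop :=
  ∀ v, H10 Ω v →
    (∫ x in Ω, (gradDot u v x - 1 / ε ^ 2 * Wd W (1 - normSq (u x)) * dotR (u x) (v x))) = 0

/-- Minimiser of `E_ε` over `𝒜`. -/
def IsMinimiser {m n : ℕ} (W : ℝ → ℝ) (ε : ℝ) (Ω : Set (Fin m → ℝ))
    (ubd u : (Fin m → ℝ) → Fin n → ℝ) : Prop :=
  Admissible Ω ubd u ∧ ∀ v, Admissible Ω ubd v → GLenergy W ε Ω u ≤ GLenergy W ε Ω v

/-- Orthogonal transformation of `ℝⁿ` (element of `O(n)`). -/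
def IsOrth {n : ℕ} (R : (Fin n → ℝ) →ₗ[ℝ] (Fin n → ℝ)) : Prop :=
  Function.Bijective R ∧ ∀ a b, dotR (R a) (R b) = dotR a b

/-- A solution of the radial equation satisfies `-K r² ≤ r h1 - h ≤ 0`, since `rᵏ (r h1 - h)` is
nonincreasing and `rᵏ (r h1 - h) + K rᵏ⁺²` is nondecreasing for `k = m - 1`. -/
theorem radial_ode_bounds {m : ℕ} (hm : 3 ≤ m) {h h1 h2 κ : ℝ → ℝ} {K : ℝ} (hK : 0 ≤ K)
    (hd : ∀ r ∈ Ioo (0:ℝ) 1, HasDerivAt h (h1 r) r)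
    (hd1 : ∀ r ∈ Ioo (0:ℝ) 1, HasDerivAt h1 (h2 r) r)
    (hpos : ∀ r ∈ Ioo (0:ℝ) 1, 0 < h r) (hle : ∀ r ∈ Ioo (0:ℝ) 1, h r ≤ 1)
    (hκ : ∀ r ∈ Ioo (0:ℝ) 1, 0 ≤ κ r ∧ κ r ≤ K)
    (hode : ∀ r ∈ Ioo (0:ℝ) 1,
      -h2 r - ((m : ℝ) - 1) / r * h1 r + ((m : ℝ) - 1) / r ^ 2 * h r = κ r * h r) :
    ∀ r ∈ Ioo (0:ℝ) 1, -K * r ^ 2 ≤ r * h1 r - h r ∧ r * h1 r - h r ≤ 0 := by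
  obtain ⟨k, rfl⟩ : ∃ k, m = k + 1 := ⟨m - 1, by omega⟩
  have hk : 2 ≤ k := by omega
  have hP : ∀ r ∈ Ioo (0:ℝ) 1,
      HasDerivAt (fun r => r ^ k * (r * h1 r - h r)) (-(r ^ (k + 1) * (κ r * h r))) r := by
    intro r hr
    have h0 := hr.1
    have := (hasDerivAt_pow k r).mul (((hasDerivAt_id r).mul (hd1 r hr)).sub (hd r hr))
    refine HasDerivAt.congr_deriv this ?_
    rw [← hode r hr]
    obtain ⟨l, rfl⟩ : ∃ l, k = l + 1 := ⟨k - 1, by omega⟩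
    push_cast
    simp only [add_tsub_cancel_right, id, pow_succ, Pi.mul_apply, Pi.sub_apply]
    field_simp
    ring
  have hQ : ∀ r ∈ Ioo (0:ℝ) 1,
      HasDerivAt (fun r => r ^ k * (r * h1 r - h r) + K * r ^ (k + 2))
        (-(r ^ (k + 1) * (κ r * h r)) + K * (((k + 2 : ℕ) : ℝ) * r ^ (k + 1))) r := by
    intro r hr
    exact (hP r hr).add ((hasDerivAt_pow (k + 2) r).const_mul K)
  have hg : ∀ r ∈ Ioo (0:ℝ) 1,
      HasDerivAt (fun r => h r / r) ((r * h1 r - h r) / r ^ 2) r := by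
    intro r hr
    have := (hd r hr).div (hasDerivAt_id r) hr.1.ne'
    refine HasDerivAt.congr_deriv this ?_
    simp; ring
  have hPanti : AntitoneOn (fun r => r ^ k * (r * h1 r - h r)) (Ioo 0 1) := by
    refine antitoneOn_of_hasDerivWithinAt_nonpos (convex_Ioo 0 1)
      (fun r hr => (hP r hr).continuousAt.continuousWithinAt)
      (fun r hr => (hP r (by simpa using hr)).hasDerivWithinAt) ?_
    intro r hr
    rw [interior_Ioo] at hr
    have := (hκ r hr).1
    have := hpos r hr
    have := hr.1
    rw [neg_nonpos]; positivity
  have hQmono : MonotoneOn (fun r => r ^ k * (r * h1 r - h r) + K * r ^ (k + 2)) (Ioo 0 1) := by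
    refine monotoneOn_of_hasDerivWithinAt_nonneg (convex_Ioo 0 1)
      (fun r hr => (hQ r hr).continuousAt.continuousWithinAt)
      (fun r hr => (hQ r (by simpa using hr)).hasDerivWithinAt) ?_
    intro r hr
    rw [interior_Ioo] at hr
    obtain ⟨ha, hb⟩ := hκ r hr
    have hc := hpos r hr
    have hc' := hle r hr
    have := hr.1
    have h3 : κ r * h r ≤ K := by nlinarith
    have h4 : K ≤ K * ((k + 2 : ℕ) : ℝ) := by
      have : (1:ℝ) ≤ ((k + 2 : ℕ) : ℝ) := by push_cast; linarith [k.cast_nonneg (α := ℝ)]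
      nlinarith
    have h5 : 0 < r ^ (k + 1) := by positivity
    nlinarith
  intro r₀ hr₀
  have hr₀0 := hr₀.1
  constructor
  · by_contra! hcon
    set c := -(r₀ ^ k * (r₀ * h1 r₀ - h r₀) + K * r₀ ^ (k + 2)) with hc
    have hcpos : 0 < c := by
      have : 0 < r₀ ^ k := by positivity
      have e : c = r₀ ^ k * (-K * r₀ ^ 2 - (r₀ * h1 r₀ - h r₀)) := by rw [hc]; ring
      rw [e]; apply mul_pos this; linarith
    have hsub : Ioc 0 r₀ ⊆ Ioo (0:ℝ) 1 := fun r hr => ⟨hr.1, hr.2.trans_lt hr₀.2⟩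
    have hP' : ∀ r ∈ Ioc 0 r₀, r ^ k * (r * h1 r - h r) ≤ -c := by
      intro r hr
      have := hQmono (hsub hr) hr₀ hr.2
      have h3 : 0 ≤ K * r ^ (k + 2) := by have := hr.1; positivity
      simp only at this
      linarith
    have hd' : ∀ r ∈ Ioc 0 r₀, HasDerivAt (fun r => h r / r - c / (2 * r ^ 2))
        ((r * h1 r - h r) / r ^ 2 + c / r ^ 3) r := by
      intro r hr
      have h0 := hr.1
      have := ((hasDerivAt_pow 2 r).const_mul 2).inv (by positivity)
      have := (hg r (hsub hr)).sub (this.const_mul c)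
      refine HasDerivAt.congr_deriv this ?_
      field_simp
      push_cast
      ring
    have hanti : AntitoneOn (fun r => h r / r - c / (2 * r ^ 2)) (Ioc 0 r₀) := by
      refine antitoneOn_of_hasDerivWithinAt_nonpos (convex_Ioc 0 r₀)
        (fun r hr => (hd' r hr).continuousAt.continuousWithinAt)
        (fun r hr => (hd' r (interior_subset hr)).hasDerivWithinAt) ?_
      intro r hr
      have hr := interior_subset hr
      have h0 := hr.1
      have h1' : r ≤ 1 := (hsub hr).2.le
      have h3 := hP' r hr
      obtain ⟨l, rfl⟩ : ∃ l, k = l + 2 := ⟨k - 2, by omega⟩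
      have h4 : r * (r * h1 r - h r) ≤ -c := by
        by_contra! h5
        have hD : r * h1 r - h r < 0 := by
          by_contra! h6
          have : 0 ≤ r ^ (l + 2) * (r * h1 r - h r) := by positivity
          linarith
        have h7 : r ^ (l + 1) ≤ 1 := pow_le_one₀ h0.le h1'
        have e : r ^ (l + 2) * (r * h1 r - h r) = r ^ (l + 1) * (r * (r * h1 r - h r)) := by ring
        rw [e] at h3
        have h8 := mul_neg_of_pos_of_neg h0 hD
        nlinarith
      have e : (r * h1 r - h r) / r ^ 2 + c / r ^ 3 = (r * (r * h1 r - h r) + c) / r ^ 3 := by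
        field_simp
      rw [e]
      exact div_nonpos_of_nonpos_of_nonneg (by linarith) (by positivity)
    set B := h r₀ / r₀ - c / (2 * r₀ ^ 2) with hB
    have hall : ∀ r ∈ Ioc 0 r₀, B * (2 * r ^ 2) + c ≤ 2 * r := by
      intro r hr
      have h0 := hr.1
      have h3 := hanti hr (right_mem_Ioc.2 hr₀0) hr.2
      have h4 : h r / r ≤ 1 / r := by
        have := hle r (hsub hr); gcongr
      have h5 : B ≤ 1 / r - c / (2 * r ^ 2) := by simp only at h3; linarith
      have h6 : (1 / r - c / (2 * r ^ 2)) * (2 * r ^ 2) = 2 * r - c := by field_simp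
      nlinarith [mul_le_mul_of_nonneg_right h5 (by positivity : 0 ≤ 2 * r ^ 2)]
    have hev : ∀ᶠ r in nhdsWithin (0:ℝ) (Ioi 0), B * (2 * r ^ 2) + c ≤ 2 * r :=
      (Ioc_mem_nhdsGT hr₀0 : Ioc 0 r₀ ∈ nhdsWithin (0:ℝ) (Ioi 0)) |>
        Filter.eventually_of_mem <| hall
    have t1 : Filter.Tendsto (fun r : ℝ => B * (2 * r ^ 2) + c) (nhdsWithin (0:ℝ) (Ioi 0))
        (nhds (B * (2 * 0 ^ 2) + c)) :=
      ((by fun_prop : Continuous fun r : ℝ => B * (2 * r ^ 2) + c).tendsto 0).mono_left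
        nhdsWithin_le_nhds
    have t2 : Filter.Tendsto (fun r : ℝ => 2 * r) (nhdsWithin (0:ℝ) (Ioi 0)) (nhds (2 * 0)) :=
      ((by fun_prop : Continuous fun r : ℝ => 2 * r).tendsto 0).mono_left nhdsWithin_le_nhds
    have := le_of_tendsto_of_tendsto t1 t2 hev
    norm_num at this
    linarith
  · by_contra! hcon
    set c := r₀ ^ k * (r₀ * h1 r₀ - h r₀) with hc
    have hcpos : 0 < c := by positivity
    have hsub : Ioc 0 r₀ ⊆ Ioo (0:ℝ) 1 := fun r hr => ⟨hr.1, hr.2.trans_lt hr₀.2⟩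
    have hP' : ∀ r ∈ Ioc 0 r₀, c ≤ r ^ k * (r * h1 r - h r) := fun r hr =>
      hPanti (hsub hr) hr₀ hr.2
    have hd' : ∀ r ∈ Ioc 0 r₀, HasDerivAt (fun r => h r / r + c / r)
        ((r * h1 r - h r - c) / r ^ 2) r := by
      intro r hr
      have h0 := hr.1
      have := (hg r (hsub hr)).add ((hasDerivAt_inv h0.ne').const_mul c)
      refine HasDerivAt.congr_deriv this ?_
      field_simp
      ring
    have hmono : MonotoneOn (fun r => h r / r + c / r) (Ioc 0 r₀) := by
      refine monotoneOn_of_hasDerivWithinAt_nonneg (convex_Ioc 0 r₀)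
        (fun r hr => (hd' r hr).continuousAt.continuousWithinAt)
        (fun r hr => (hd' r (interior_subset hr)).hasDerivWithinAt) ?_
      intro r hr
      have hr := interior_subset hr
      have h0 := hr.1
      have h1' : r ≤ 1 := (hsub hr).2.le
      have h3 := hP' r hr
      have h7 : r ^ k ≤ 1 := pow_le_one₀ h0.le h1'
      have h8 : 0 < r ^ k := by positivity
      have h9 : 0 < r * h1 r - h r := by
        by_contra! h6
        nlinarith
      apply div_nonneg _ (by positivity)
      nlinarith
    set B := h r₀ / r₀ + c / r₀ with hB
    have hall : ∀ r ∈ Ioc 0 r₀, c ≤ B * r := by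
      intro r hr
      have h0 := hr.1
      have h3 := hmono hr (right_mem_Ioc.2 hr₀0) hr.2
      have h4 : 0 < h r / r := div_pos (hpos r (hsub hr)) h0
      have h5 : c / r ≤ B := by simp only at h3; linarith
      rwa [div_le_iff₀ h0] at h5
    have hev : ∀ᶠ r in nhdsWithin (0:ℝ) (Ioi 0), c ≤ B * r :=
      Filter.eventually_of_mem (Ioc_mem_nhdsGT hr₀0) hall
    have t2 : Filter.Tendsto (fun r : ℝ => B * r) (nhdsWithin (0:ℝ) (Ioi 0)) (nhds (B * 0)) :=
      ((by fun_prop : Continuous fun r : ℝ => B * r).tendsto 0).mono_left nhdsWithin_le_nhds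
    have := ge_of_tendsto t2 hev
    linarith

/-- The profile `G` of a radial map `x ↦ G (|x|²) x` solving `-Δu = κ u` on the punctured unit ball,
with first and second derivatives `G1` and `G2`, together with its a priori bounds. -/
structure IsRadialProfile (m : ℕ) (κ G G1 G2 : ℝ → ℝ) (K : ℝ) : Prop where
  hasDerivAt : ∀ s ∈ Ioo (0:ℝ) 1, HasDerivAt G (G1 s) s
  hasDerivAt_deriv : ∀ s ∈ Ioo (0:ℝ) 1, HasDerivAt G1 (G2 s) s
  continuousOn : ContinuousOn G2 (Ioo 0 1)
  ode : ∀ s ∈ Ioo (0:ℝ) 1, 4 * s * G2 s + (2 * m + 4) * G1 s = -(κ s * G s)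
  one_le : ∀ s ∈ Ioo (0:ℝ) 1, 1 ≤ G s
  le_bound : ∀ s ∈ Ioo (0:ℝ) 1, G s ≤ K
  deriv_bound : ∀ s ∈ Ioo (0:ℝ) 1, √s * |G1 s| ≤ K
  logDeriv_nonneg : ∀ s ∈ Ioo (0:ℝ) 1, 0 ≤ G1 s / G s + 1 / (2 * s)
  exists_logDeriv_pos : ∀ a b : ℝ, 0 < a → a < b → b < 1 →
    ∃ s ∈ Ioo a b, 0 < G1 s / G s + 1 / (2 * s)
  exists_tendsto_zero : ∃ G0, Filter.Tendsto G (nhdsWithin 0 (Ioi 0)) (nhds G0)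

theorem sqrt_mem_Ioo {s : ℝ} (hs : s ∈ Ioo (0:ℝ) 1) : √s ∈ Ioo (0:ℝ) 1 :=
  ⟨Real.sqrt_pos.2 hs.1, by rw [Real.sqrt_lt' one_pos]; simpa using hs.2⟩

theorem isRadialProfile_of_ode {m : ℕ} (hm : 3 ≤ m) {h h1 h2 κ : ℝ → ℝ} {K : ℝ} (hK : 0 ≤ K)
    (hcont : ContinuousOn h (Icc 0 1))
    (hd : ∀ r ∈ Ioo (0:ℝ) 1, HasDerivAt h (h1 r) r)
    (hd1 : ∀ r ∈ Ioo (0:ℝ) 1, HasDerivAt h1 (h2 r) r)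
    (hc2 : ContinuousOn h2 (Ioo 0 1))
    (hpos : ∀ r ∈ Ioo (0:ℝ) 1, 0 < h r) (hone : h 1 = 1)
    (hmono : StrictMonoOn h (Icc 0 1))
    (hκ : ∀ r ∈ Ioo (0:ℝ) 1, 0 ≤ κ r ∧ κ r ≤ K)
    (hode : ∀ r ∈ Ioo (0:ℝ) 1,
      -h2 r - ((m : ℝ) - 1) / r * h1 r + ((m : ℝ) - 1) / r ^ 2 * h r = κ r * h r) :
    IsRadialProfile m (fun s => κ √s) (fun s => h √s / √s)
      (fun s => (√s * h1 √s - h √s) / (2 * √s ^ 3))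
      (fun s => h2 √s / (4 * √s ^ 3) - 3 * (√s * h1 √s - h √s) / (4 * √s ^ 5)) (1 + K) := by
  have hle : ∀ r ∈ Ioo (0:ℝ) 1, h r ≤ 1 := fun r hr =>
    hone ▸ (hmono.monotoneOn (Ioo_subset_Icc_self hr) (right_mem_Icc.2 zero_le_one) hr.2.le)
  have hb := radial_ode_bounds hm hK hd hd1 hpos hle hκ hode
  have hg : ∀ r ∈ Ioo (0:ℝ) 1,
      HasDerivAt (fun r => h r / r) ((r * h1 r - h r) / r ^ 2) r := by
    intro r hr
    have := (hd r hr).div (hasDerivAt_id r) hr.1.ne'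
    refine HasDerivAt.congr_deriv this ?_
    simp; ring
  have hgc : ContinuousOn (fun r => h r / r) (Ioc 0 1) :=
    (hcont.mono Ioc_subset_Icc_self).div continuousOn_id fun r hr => hr.1.ne'
  have hanti : AntitoneOn (fun r => h r / r) (Ioc 0 1) := by
    refine antitoneOn_of_hasDerivWithinAt_nonpos (convex_Ioc 0 1) hgc
      (fun r hr => (hg r (by simpa using hr)).hasDerivWithinAt) fun r hr => ?_
    rw [interior_Ioc] at hr
    exact div_nonpos_of_nonpos_of_nonneg (hb r hr).2 (by positivity)
  have hmon : MonotoneOn (fun r => h r / r + K * r) (Ioc 0 1) := by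
    refine monotoneOn_of_hasDerivWithinAt_nonneg (convex_Ioc 0 1)
      (hgc.add (by fun_prop))
      (fun r hr => ((hg r (by simpa using hr)).add
        ((hasDerivAt_id r).const_mul K)).hasDerivWithinAt) fun r hr => ?_
    rw [interior_Ioc] at hr
    have h3 := (hb r hr).1
    have : 0 < r ^ 2 := by have := hr.1; positivity
    have : -K ≤ (r * h1 r - h r) / r ^ 2 := by rw [le_div_iff₀ this]; exact h3
    linarith
  have hg1 : ∀ r ∈ Ioo (0:ℝ) 1, 1 ≤ h r / r ∧ h r / r ≤ 1 + K := by
    intro r hr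
    have h3 := hanti (Ioo_subset_Ioc_self hr) (right_mem_Ioc.2 zero_lt_one) hr.2.le
    have h4 := hmon (Ioo_subset_Ioc_self hr) (right_mem_Ioc.2 zero_lt_one) hr.2.le
    simp only [hone, div_one, mul_one] at h3 h4
    have := mul_nonneg hK hr.1.le
    exact ⟨h3, by linarith⟩
  have hlog : ∀ s ∈ Ioo (0:ℝ) 1,
      (√s * h1 √s - h √s) / (2 * √s ^ 3) / (h √s / √s) + 1 / (2 * s)
        = h1 √s / (2 * √s * h √s) := by
    intro s hs
    have hr := sqrt_mem_Ioo hs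
    have h3 := hr.1
    have h4 := hpos _ hr
    have h5 : s = √s ^ 2 := (Real.sq_sqrt hs.1.le).symm
    generalize √s = r at *
    subst h5
    field_simp
    ring
  have hh1 : ∀ r ∈ Ioo (0:ℝ) 1, 0 ≤ h1 r := by
    intro r hr
    have : HasDerivWithinAt h (h1 r) (Ioo 0 1) r := (hd r hr).hasDerivWithinAt
    have hmn : MonotoneOn h (Ioo 0 1) := hmono.monotoneOn.mono Ioo_subset_Icc_self
    rw [← this.derivWithin (isOpen_Ioo.uniqueDiffOn r hr)]
    exact hmn.derivWithin_nonneg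
  refine ⟨?_, ?_, ?_, ?_, ?_, ?_, ?_, ?_, ?_, ?_⟩
  · intro s hs
    have hr := sqrt_mem_Ioo hs
    have h3 := hr.1
    refine HasDerivAt.congr_deriv ((hg _ hr).comp s (Real.hasDerivAt_sqrt hs.1.ne')) ?_
    field_simp
  · intro s hs
    have hr := sqrt_mem_Ioo hs
    have h3 := hr.1
    have hG1 : HasDerivAt (fun r => (r * h1 r - h r) / (2 * r ^ 3))
        (((1 * h1 √s + √s * h2 √s - h1 √s) * (2 * √s ^ 3)
          - (√s * h1 √s - h √s) * (2 * (((3 : ℕ) : ℝ) * √s ^ (3 - 1)))) / (2 * √s ^ 3) ^ 2) √s :=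
      (((hasDerivAt_id √s).mul (hd1 _ hr)).sub (hd _ hr)).div
        ((hasDerivAt_pow 3 √s).const_mul 2) (by positivity)
    refine HasDerivAt.congr_deriv (hG1.comp s (Real.hasDerivAt_sqrt hs.1.ne')) ?_
    push_cast
    field_simp
    ring
  · have hs : ContinuousOn (fun s : ℝ => √s) (Ioo 0 1) := by fun_prop
    have hmaps : MapsTo (fun s : ℝ => √s) (Ioo 0 1) (Ioo 0 1) := fun s hs => sqrt_mem_Ioo hs
    have c1 : ContinuousOn h (Ioo 0 1) := hcont.mono Ioo_subset_Icc_self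
    have c2 : ContinuousOn h1 (Ioo 0 1) :=
      fun r hr => (hd1 r hr).continuousAt.continuousWithinAt
    have d1 := c1.comp hs hmaps
    have d2 := c2.comp hs hmaps
    have d3 := hc2.comp hs hmaps
    simp only [Function.comp_def] at d1 d2 d3
    refine (d3.div (by fun_prop) ?_).sub ((ContinuousOn.mul continuousOn_const
      ((hs.mul d2).sub d1)).div (by fun_prop) ?_) <;>
    · intro s hs
      have := (sqrt_mem_Ioo hs).1
      positivity
  · intro s hs
    have hr := sqrt_mem_Ioo hs
    have h3 := hr.1
    have h5 : s = √s ^ 2 := (Real.sq_sqrt hs.1.le).symm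
    have h6 := hode _ hr
    have h7 : κ √s * (h √s / √s) = (κ √s * h √s) / √s := by ring
    rw [h7, ← h6]
    generalize √s = r at *
    subst h5
    field_simp
    ring
  · exact fun s hs => (hg1 _ (sqrt_mem_Ioo hs)).1
  · exact fun s hs => (hg1 _ (sqrt_mem_Ioo hs)).2
  · intro s hs
    have hr := sqrt_mem_Ioo hs
    have h3 := hr.1
    obtain ⟨h4, h5⟩ := hb _ hr
    rw [abs_div, abs_of_nonpos h5, abs_of_pos (by positivity)]
    rw [← mul_div_assoc, div_le_iff₀ (by positivity)]
    have : 0 < √s ^ 3 := by positivity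
    nlinarith [mul_le_mul_of_nonneg_left h4 h3.le]
  · intro s hs
    rw [hlog s hs]
    have hr := sqrt_mem_Ioo hs
    have := hr.1
    have := hpos _ hr
    have := hh1 _ hr
    positivity
  · intro a b ha hab hb1
    by_contra! hcon
    have hab' : √a < √b := Real.sqrt_lt_sqrt ha.le hab
    have hra := sqrt_mem_Ioo ⟨ha, hab.trans hb1⟩
    have hrb := sqrt_mem_Ioo ⟨ha.trans hab, hb1⟩
    obtain ⟨c, hc, hce⟩ := exists_hasDerivAt_eq_slope h h1 hab'
      (hcont.mono (Icc_subset_Icc hra.1.le hrb.2.le))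
      (fun r hr => hd r ⟨hra.1.trans hr.1, hr.2.trans hrb.2⟩)
    have hc01 : c ∈ Ioo (0:ℝ) 1 := ⟨hra.1.trans hc.1, hc.2.trans hrb.2⟩
    have hcpos : 0 < h1 c := by
      rw [hce]
      exact div_pos (sub_pos.2 (hmono (Ioo_subset_Icc_self hra) (Ioo_subset_Icc_self hrb) hab'))
        (sub_pos.2 hab')
    have hs : √(c ^ 2) = c := Real.sqrt_sq hc01.1.le
    have h3 := hcon (c ^ 2) ⟨(Real.sqrt_lt' hc01.1).1 hc.1,
      (Real.lt_sqrt hc01.1.le).1 hc.2⟩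
    rw [hlog _ ⟨pow_pos hc01.1 2, pow_lt_one₀ hc01.1.le hc01.2 two_ne_zero⟩, hs] at h3
    have := hpos c hc01
    have := hc01.1
    have : 0 < h1 c / (2 * c * h c) := by positivity
    linarith
  · have h3 := AntitoneOn.tendsto_nhdsWithin_Ioo_right (by simp : (Ioo (0:ℝ) 1).Nonempty)
      (hanti.mono Ioo_subset_Ioc_self) ⟨1 + K, by rintro _ ⟨r, hr, rfl⟩; exact (hg1 r hr).2⟩
    refine ⟨_, h3.comp ?_⟩
    refine tendsto_nhdsWithin_iff.2 ⟨?_, ?_⟩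
    · have := (Real.continuous_sqrt.tendsto 0)
      rw [Real.sqrt_zero] at this
      exact this.mono_left nhdsWithin_le_nhds
    · filter_upwards [self_mem_nhdsWithin] with s hs using Real.sqrt_pos.2 hs

theorem Wd_properties {W : ℝ → ℝ} (hW : ContDiffOn ℝ 1 W (Iic (1:ℝ))) (hW0 : W 0 = 0)
    (hWpos : ∀ t ∈ Iic (1:ℝ), t ≠ 0 → 0 < W t) (hWconv : ConvexOn ℝ (Iic (1:ℝ)) W) :
    (∃ K, 0 ≤ K ∧ ∀ a ∈ Ioo (0:ℝ) 1, 0 ≤ Wd W a ∧ Wd W a ≤ K) ∧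
    ∀ a ∈ Ioo (0:ℝ) 1, ∀ b ≤ 1, W a + Wd W a * (b - a) ≤ W b := by
  have hd : ∀ a ∈ Ioo (0:ℝ) 1, HasDerivAt W (Wd W a) a := fun a ha =>
    ((hW.differentiableOn one_ne_zero a ha.2.le).hasDerivWithinAt).hasDerivAt
      (Iic_mem_nhds ha.2)
  have htan : ∀ a ∈ Ioo (0:ℝ) 1, ∀ b ≤ 1, W a + Wd W a * (b - a) ≤ W b := by
    intro a ha b hb
    rcases lt_trichotomy a b with hab | rfl | hab
    · have := hWconv.le_slope_of_hasDerivAt (mem_Iic.2 ha.2.le) (mem_Iic.2 hb) hab (hd a ha)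
      rw [slope_def_field, le_div_iff₀ (sub_pos.2 hab)] at this
      linarith
    · simp
    · have := hWconv.slope_le_of_hasDerivAt (mem_Iic.2 hb) (mem_Iic.2 ha.2.le) hab (hd a ha)
      rw [slope_def_field, div_le_iff₀ (sub_pos.2 hab)] at this
      linarith
  refine ⟨?_, htan⟩
  have hc : ContinuousOn (Wd W) (Iic 1) :=
    hW.continuousOn_derivWithin (uniqueDiffOn_Iic 1) le_rfl
  obtain ⟨K, hK⟩ := isCompact_Icc.exists_bound_of_continuousOn
    (hc.mono (Icc_subset_Iic_self : Icc (0:ℝ) 1 ⊆ Iic 1))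
  refine ⟨K, (norm_nonneg _).trans (hK 0 (by simp)), fun a ha => ⟨?_, ?_⟩⟩
  · have h1 := htan a ha 0 zero_le_one
    have h2 := hWpos a ha.2.le ha.1.ne'
    rw [hW0] at h1
    by_contra! h3
    nlinarith [ha.1]
  · exact (le_abs_self _).trans (hK a (Ioo_subset_Icc_self ha))

/-- Extension of a vector by zero coordinates. -/
def padZero (m n : ℕ) : (Fin m → ℝ) →L[ℝ] (Fin n → ℝ) :=
  LinearMap.toContinuousLinearMap
    { toFun := fun x j => if hj : (j : ℕ) < m then x ⟨j, hj⟩ else 0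
      map_add' := by intro x y; ext j; by_cases hj : (j : ℕ) < m <;> simp [hj]
      map_smul' := by intro c x; ext j; by_cases hj : (j : ℕ) < m <;> simp [hj] }

theorem padZero_apply {m n : ℕ} (x : Fin m → ℝ) (j : Fin n) :
    padZero m n x j = if hj : (j : ℕ) < m then x ⟨j, hj⟩ else 0 := rfl

theorem normSq_padZero {m n : ℕ} (hmn : m ≤ n) (x : Fin m → ℝ) :
    normSq (padZero m n x) = normSq x := by
  obtain ⟨k, rfl⟩ := Nat.exists_eq_add_of_le hmn
  simp [normSq, padZero_apply, Fin.sum_univ_add]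

theorem sum_mul_padZero_single {m n : ℕ} (x : Fin m → ℝ) (j : Fin n) :
    ∑ i, x i * padZero m n (Pi.single i 1) j = padZero m n x j := by
  conv_rhs => rw [pi_eq_sum_univ' x]
  simp [map_sum]

theorem sum_eq_divergence {m n : ℕ} {x : Fin m → ℝ} {y w : Fin n → ℝ}
    {a b p : Fin m → Fin n → ℝ} {s g g1 g2 κ Q Q' : ℝ}
    (hy : ∀ j, ∑ i, x i * b i j = y j) (hs : ∑ i, x i ^ 2 = s)
    (hode : 4 * s * g2 + (2 * m + 4) * g1 = -(κ * g)) :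
    ∑ i, (∑ j, (a i j * p i j + w j * (2 * g1 * x i * b i j + 4 * g2 * x i ^ 2 * y j
        + 2 * g1 * (y j + x i * b i j))) + (∑ j, w j * a i j) * Q * x i
        + 1 / 2 * normSq w * (2 * Q' * x i ^ 2 + Q))
      = ∑ i, ∑ j, a i j * p i j - κ * g * ∑ j, w j * y j
        + Q * ∑ i, ∑ j, a i j * x i * w j + 1 / 2 * normSq w * (2 * s * Q' + m * Q) := by
  simp only [Finset.sum_add_distrib]
  have e1 : ∑ i, ∑ j, w j * (2 * g1 * x i * b i j + 4 * g2 * x i ^ 2 * y j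
        + 2 * g1 * (y j + x i * b i j)) = -(κ * g) * ∑ j, w j * y j := by
    rw [Finset.sum_comm, Finset.mul_sum]
    refine Finset.sum_congr rfl fun j _ => ?_
    rw [← Finset.mul_sum, ← hode]
    have : ∑ i, (2 * g1 * x i * b i j + 4 * g2 * x i ^ 2 * y j + 2 * g1 * (y j + x i * b i j))
        = 4 * g1 * ∑ i, x i * b i j + 4 * g2 * y j * ∑ i, x i ^ 2 + ∑ _i : Fin m, 2 * g1 * y j := by
      simp only [Finset.mul_sum, ← Finset.sum_add_distrib]
      exact Finset.sum_congr rfl fun i _ => by ring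
    rw [this, hy, hs]
    simp
    ring
  have e2 : ∑ i, (∑ j, w j * a i j) * Q * x i = Q * ∑ i, ∑ j, a i j * x i * w j := by
    rw [Finset.mul_sum]
    refine Finset.sum_congr rfl fun i _ => ?_
    rw [mul_assoc, Finset.sum_mul, Finset.mul_sum]
    exact Finset.sum_congr rfl fun j _ => by ring
  have e3 : ∑ i, 1 / 2 * normSq w * (2 * Q' * x i ^ 2 + Q)
      = 1 / 2 * normSq w * (2 * s * Q' + m * Q) := by
    rw [← Finset.mul_sum, Finset.sum_add_distrib, ← Finset.mul_sum, hs]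
    simp only [Finset.sum_const, Finset.card_univ, Fintype.card_fin, nsmul_eq_mul]
    ring
  rw [e1, e2, e3]
  ring

theorem normSq_nonneg {n : ℕ} (a : Fin n → ℝ) : 0 ≤ normSq a :=
  Finset.sum_nonneg fun _ _ => sq_nonneg _

/-- Completing the square with the logarithmic gradient of a positive supersolution. -/
theorem divergence_le {m n : ℕ} (hm : 7 ≤ m) {x : Fin m → ℝ} {y w : Fin n → ℝ}
    {a b p : Fin m → Fin n → ℝ} {s g g1 g2 κ ΔW : ℝ}
    (hy : ∀ j, ∑ i, x i * b i j = y j) (hs : ∑ i, x i ^ 2 = s) (hs0 : 0 < s) (hg : 0 < g)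
    (hode : 4 * s * g2 + (2 * m + 4) * g1 = -(κ * g))
    (hW : -(κ / 2) * (2 * g * ∑ j, w j * y j + normSq w) ≤ ΔW) :
    ∑ i, (∑ j, (a i j * p i j + w j * (2 * g1 * x i * b i j + 4 * g2 * x i ^ 2 * y j
        + 2 * g1 * (y j + x i * b i j))) + (∑ j, w j * a i j) * (2 * g1 / g - 1 / s) * x i
        + 1 / 2 * normSq w * (2 * (2 * (g2 * g - g1 ^ 2) / g ^ 2 + 1 / s ^ 2) * x i ^ 2
          + (2 * g1 / g - 1 / s)))
      ≤ ((∑ i, ∑ j, (p i j + a i j) ^ 2) / 2 - (∑ i, ∑ j, p i j ^ 2) / 2 + ΔW)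
        - 4 * normSq w * (g1 / g + 1 / (2 * s)) := by
  rw [sum_eq_divergence hy hs hode]
  set Q := 2 * g1 / g - 1 / s with hQ
  have hsq : 0 ≤ ∑ i, ∑ j, (a i j - Q * x i * w j) ^ 2 :=
    Finset.sum_nonneg fun i _ => Finset.sum_nonneg fun j _ => sq_nonneg _
  have e1 : ∑ i, ∑ j, (a i j - Q * x i * w j) ^ 2 = ∑ i, ∑ j, a i j ^ 2
      - 2 * (Q * ∑ i, ∑ j, a i j * x i * w j) + Q ^ 2 * s * normSq w := by
    have : Q ^ 2 * s * normSq w = ∑ i, ∑ j, Q ^ 2 * x i ^ 2 * w j ^ 2 := by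
      rw [← hs, normSq, mul_assoc, Finset.sum_mul_sum, Finset.mul_sum]
      refine Finset.sum_congr rfl fun i _ => ?_
      rw [Finset.mul_sum]
      exact Finset.sum_congr rfl fun j _ => by ring
    rw [this]
    simp only [Finset.mul_sum, ← Finset.sum_sub_distrib, ← Finset.sum_add_distrib]
    exact Finset.sum_congr rfl fun i _ => Finset.sum_congr rfl fun j _ => by ring
  have e2 : ∑ i, ∑ j, (p i j + a i j) ^ 2
      = ∑ i, ∑ j, p i j ^ 2 + 2 * ∑ i, ∑ j, a i j * p i j + ∑ i, ∑ j, a i j ^ 2 := by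
    simp only [Finset.mul_sum, ← Finset.sum_add_distrib]
    exact Finset.sum_congr rfl fun i _ => Finset.sum_congr rfl fun j _ => by ring
  have e3 : Q ^ 2 * s + (2 * s * (2 * (g2 * g - g1 ^ 2) / g ^ 2 + 1 / s ^ 2) + m * Q) + κ
      = -(8 * (g1 / g + 1 / (2 * s)) + (m - 7) / s) := by
    have : κ = -(4 * s * g2 + (2 * m + 4) * g1) / g := by rw [hode]; field_simp
    rw [this, hQ]
    field_simp
    ring
  have hm' : (0:ℝ) ≤ (m - 7) / s := by
    have : (7:ℝ) ≤ m := by exact_mod_cast hm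
    exact div_nonneg (by linarith) hs0.le
  have hN := normSq_nonneg w
  have e4 := congrArg (fun t => normSq w * t) e3
  have e5 := mul_nonneg hN hm'
  rw [e2]
  nlinarith

/-- The open Euclidean unit ball. -/
def euclBall (m : ℕ) : Set (Fin m → ℝ) := {x | normSq x < 1}

theorem contDiff_normSq {n : ℕ} {k : WithTop ℕ∞} : ContDiff ℝ k (normSq : (Fin n → ℝ) → ℝ) := by
  unfold normSq
  fun_prop

theorem continuous_normSq {n : ℕ} : Continuous (normSq : (Fin n → ℝ) → ℝ) :=
  (contDiff_normSq (k := 0)).continuous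

theorem normSq_eq_zero {n : ℕ} {a : Fin n → ℝ} : normSq a = 0 ↔ a = 0 := by
  rw [normSq, Finset.sum_eq_zero_iff_of_nonneg fun _ _ => sq_nonneg _]
  simp [funext_iff]

theorem normSq_pos {n : ℕ} {a : Fin n → ℝ} (ha : a ≠ 0) : 0 < normSq a :=
  (normSq_nonneg a).lt_of_ne fun h => ha (normSq_eq_zero.1 h.symm)

theorem normSq_mem_Ioo {m : ℕ} {x : Fin m → ℝ} (hx : x ∈ euclBall m \ {0}) :
    normSq x ∈ Ioo (0:ℝ) 1 := ⟨normSq_pos hx.2, hx.1⟩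

theorem isOpen_euclBall (m : ℕ) : IsOpen (euclBall m) :=
  isOpen_lt continuous_normSq continuous_const

theorem isOpen_euclBall_diff_zero (m : ℕ) : IsOpen (euclBall m \ {0}) :=
  (isOpen_euclBall m).sdiff isClosed_singleton

theorem normSq_le_of_mem_closure {m : ℕ} {x : Fin m → ℝ} (hx : x ∈ closure (euclBall m)) :
    normSq x ≤ 1 :=
  closure_lt_subset_le continuous_normSq continuous_const hx

theorem isCompact_normSq_le (m : ℕ) : IsCompact {x : Fin m → ℝ | normSq x ≤ 1} := by
  refine Metric.isCompact_of_isClosed_isBounded (isClosed_le continuous_normSq continuous_const) ?_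
  refine (Metric.isBounded_closedBall (x := (0 : Fin m → ℝ)) (r := 1)).subset fun x hx => ?_
  rw [mem_closedBall_zero_iff, pi_norm_le_iff_of_nonneg zero_le_one]
  intro i
  have h1 : x i ^ 2 ≤ normSq x :=
    Finset.single_le_sum (f := fun i => x i ^ 2) (fun _ _ => sq_nonneg _) (Finset.mem_univ i)
  rw [Real.norm_eq_abs, ← sq_le_one_iff_abs_le_one]
  exact h1.trans hx

theorem isCompact_closure_euclBall (m : ℕ) : IsCompact (closure (euclBall m)) :=
  (isCompact_normSq_le m).of_isClosed_subset isClosed_closure fun _ => normSq_le_of_mem_closure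

theorem volume_euclBall_ne_top (m : ℕ) : volume (euclBall m) ≠ ⊤ :=
  ((measure_mono subset_closure).trans_lt (isCompact_closure_euclBall m).measure_lt_top).ne

open scoped Pointwise in
theorem volumeReal_normSq_lt {m : ℕ} {ρ : ℝ} (hρ : 0 < ρ) :
    volume.real {x : Fin m → ℝ | normSq x < ρ ^ 2} = ρ ^ m * volume.real (euclBall m) := by
  have : {x : Fin m → ℝ | normSq x < ρ ^ 2} = ρ • euclBall m := by
    ext x
    rw [mem_smul_set_iff_inv_smul_mem₀ hρ.ne']
    have : normSq (ρ⁻¹ • x) = normSq x / ρ ^ 2 := by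
      simp only [normSq, Pi.smul_apply, smul_eq_mul, mul_pow, ← Finset.mul_sum]
      field_simp
    simp only [euclBall, mem_ofPred_eq, this]
    rw [div_lt_one (by positivity)]
  rw [this, Measure.real, Measure.addHaar_smul_of_nonneg _ hρ.le, ENNReal.toReal_mul,
    ENNReal.toReal_ofReal (by positivity)]
  simp [Measure.real]

theorem volumeReal_shell_le {m : ℕ} {δ : ℝ} (hδ : 0 < δ) (hδ1 : δ < 1) :
    volume.real {x : Fin m → ℝ | normSq x < 1 ∧ 1 - δ ≤ normSq x}
      ≤ m * δ * volume.real (euclBall m) := by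
  have hfin := volume_euclBall_ne_top m
  have hδ2 : (1 - δ) ^ 2 ≤ 1 := pow_le_one₀ (by linarith) (by linarith)
  have hsub : {x : Fin m → ℝ | normSq x < (1 - δ) ^ 2} ⊆ euclBall m := fun x hx =>
    lt_of_lt_of_le hx hδ2
  have h1 : {x : Fin m → ℝ | normSq x < 1 ∧ 1 - δ ≤ normSq x}
      ⊆ euclBall m \ {x : Fin m → ℝ | normSq x < (1 - δ) ^ 2} := fun x hx =>
    ⟨hx.1, fun h => by have : normSq x < (1 - δ) ^ 2 := h; nlinarith [hx.2]⟩
  have hmeas : MeasurableSet {x : Fin m → ℝ | normSq x < (1 - δ) ^ 2} :=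
    (isOpen_lt continuous_normSq continuous_const).measurableSet
  have h2 := measureReal_mono (μ := volume) h1
    (ne_top_of_le_ne_top hfin (measure_mono sdiff_subset))
  have hd := measureReal_sdiff (μ := volume) hsub hmeas hfin
  rw [volumeReal_normSq_lt (by linarith)] at hd
  have h3 : 1 - m * δ ≤ (1 - δ) ^ m := by
    have := one_add_mul_le_pow (a := -δ) (by linarith) m
    rw [← sub_eq_add_neg] at this
    linarith
  have := mul_le_mul_of_nonneg_right h3 (measureReal_nonneg (μ := volume) (s := euclBall m))
  linarith

theorem exists_bound_deriv_smoothTransition :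
    ∃ C, 0 ≤ C ∧ ∀ t, |deriv Real.smoothTransition t| ≤ C ∧
      (t ∉ Icc (0:ℝ) 1 → deriv Real.smoothTransition t = 0) := by
  have hc : Continuous (deriv Real.smoothTransition) :=
    (Real.smoothTransition.contDiff (n := 1)).continuous_deriv le_rfl
  have hz : ∀ t ∉ Icc (0:ℝ) 1, deriv Real.smoothTransition t = 0 := by
    intro t ht
    rw [mem_Icc, not_and_or, not_le, not_le] at ht
    rcases ht with ht | ht
    · have : Real.smoothTransition =ᶠ[nhds t] fun _ => 0 := by
        filter_upwards [Iio_mem_nhds ht] with a ha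
        exact Real.smoothTransition.zero_of_nonpos (le_of_lt ha)
      rw [this.deriv_eq, deriv_const]
    · have : Real.smoothTransition =ᶠ[nhds t] fun _ => 1 := by
        filter_upwards [Ioi_mem_nhds ht] with a ha
        exact Real.smoothTransition.one_of_one_le (le_of_lt ha)
      rw [this.deriv_eq, deriv_const]
  obtain ⟨C, hC⟩ := isCompact_Icc.exists_bound_of_continuousOn
    (hc.continuousOn (s := Icc (0:ℝ) 1))
  have hC0 : 0 ≤ C := (norm_nonneg _).trans (hC 0 (by simp))
  refine ⟨C, hC0, fun t => ⟨?_, hz t⟩⟩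
  by_cases ht : t ∈ Icc (0:ℝ) 1
  · exact hC t ht
  · rw [hz t ht]; simpa using hC0

/-- Cutoff, as a function of `|x|²`, supported in `δ² ≤ |x|² ≤ 1 - δ`. -/
def cutoff (δ s : ℝ) : ℝ :=
  Real.smoothTransition (s / δ ^ 2 - 1) * Real.smoothTransition ((1 - s) / δ - 1)

theorem contDiff_cutoff (δ : ℝ) : ContDiff ℝ 1 (cutoff δ) := by
  unfold cutoff
  exact (Real.smoothTransition.contDiff.comp (by fun_prop)).mul
    (Real.smoothTransition.contDiff.comp (by fun_prop))

theorem cutoff_nonneg (δ s : ℝ) : 0 ≤ cutoff δ s :=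
  mul_nonneg (Real.smoothTransition.nonneg _) (Real.smoothTransition.nonneg _)

theorem cutoff_le_one (δ s : ℝ) : cutoff δ s ≤ 1 :=
  mul_le_one₀ (Real.smoothTransition.le_one _) (Real.smoothTransition.nonneg _)
    (Real.smoothTransition.le_one _)

theorem cutoff_eq_zero {δ s : ℝ} (hδ : 0 < δ) (hs : s ∉ Ioo (δ ^ 2) (1 - δ)) : cutoff δ s = 0 := by
  rw [mem_Ioo, not_and_or, not_lt, not_lt] at hs
  rcases hs with hs | hs
  · rw [cutoff, Real.smoothTransition.zero_of_nonpos, zero_mul]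
    rw [sub_nonpos, div_le_one (by positivity)]; exact hs
  · rw [cutoff, mul_comm, Real.smoothTransition.zero_of_nonpos, zero_mul]
    rw [sub_nonpos, div_le_one hδ]; linarith

theorem cutoff_eq_one {δ s : ℝ} (hδ : 0 < δ) (h1 : 2 * δ ^ 2 ≤ s) (h2 : s ≤ 1 - 2 * δ) :
    cutoff δ s = 1 := by
  rw [cutoff, Real.smoothTransition.one_of_one_le, Real.smoothTransition.one_of_one_le, mul_one]
  · rw [le_sub_iff_add_le, le_div_iff₀ hδ]; linarith
  · rw [le_sub_iff_add_le, le_div_iff₀ (by positivity)]; linarith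

theorem exists_bound_deriv_cutoff : ∃ C, 0 ≤ C ∧ ∀ δ, 0 < δ → ∀ s, |deriv (cutoff δ) s| ≤
    C / δ ^ 2 * {s : ℝ | s ≤ 2 * δ ^ 2}.indicator 1 s
      + C / δ * {s : ℝ | 1 - 2 * δ ≤ s}.indicator 1 s := by
  obtain ⟨C, hC0, hC⟩ := exists_bound_deriv_smoothTransition
  refine ⟨C, hC0, fun δ hδ s => ?_⟩
  have hT : Differentiable ℝ Real.smoothTransition :=
    (Real.smoothTransition.contDiff (n := 1)).differentiable one_ne_zero
  have d1 : HasDerivAt (fun s => Real.smoothTransition (s / δ ^ 2 - 1))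
      (deriv Real.smoothTransition (s / δ ^ 2 - 1) * (1 / δ ^ 2)) s :=
    (hT _).hasDerivAt.comp s (((hasDerivAt_id s).div_const _).sub_const 1)
  have d2 : HasDerivAt (fun s => Real.smoothTransition ((1 - s) / δ - 1))
      (deriv Real.smoothTransition ((1 - s) / δ - 1) * (-1 / δ)) s :=
    (hT _).hasDerivAt.comp s ((((hasDerivAt_id s).const_sub 1).div_const _).sub_const 1)
  have hd : deriv (cutoff δ) s = _ := (d1.mul d2).deriv
  rw [hd]
  refine (abs_add_le _ _).trans (add_le_add ?_ ?_)
  · rw [abs_mul, abs_mul, abs_of_nonneg (Real.smoothTransition.nonneg _),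
      abs_of_pos (by positivity : 0 < 1 / δ ^ 2)]
    by_cases hs : s ≤ 2 * δ ^ 2
    · rw [indicator_of_mem (by exact hs), Pi.one_apply, mul_one]
      have := Real.smoothTransition.le_one ((1 - s) / δ - 1)
      have := Real.smoothTransition.nonneg ((1 - s) / δ - 1)
      have h3 := (hC (s / δ ^ 2 - 1)).1
      calc _ ≤ C * (1 / δ ^ 2) * 1 := by gcongr
        _ = _ := by ring
    · rw [indicator_of_notMem (by exact hs), (hC _).2]
      · simp
      · intro h
        have := h.2
        rw [sub_le_iff_le_add, div_le_iff₀ (by positivity)] at this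
        exact hs (by linarith)
  · rw [abs_mul, abs_mul, abs_of_nonneg (Real.smoothTransition.nonneg _), abs_div, abs_neg,
      abs_one, abs_of_pos hδ]
    by_cases hs : 1 - 2 * δ ≤ s
    · rw [indicator_of_mem (by exact hs), Pi.one_apply, mul_one]
      have := Real.smoothTransition.le_one (s / δ ^ 2 - 1)
      have h3 := (hC ((1 - s) / δ - 1)).1
      calc _ ≤ 1 * (C * (1 / δ)) := by gcongr
        _ = _ := by ring
    · rw [indicator_of_notMem (by exact hs), (hC _).2]
      · simp
      · intro h
        have := h.2
        rw [sub_le_iff_le_add, div_le_iff₀ (by positivity)] at this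
        exact hs (by linarith)

theorem contDiff_cutoff_mul {m : ℕ} {k : WithTop ℕ∞} (hk : k ≤ 1) {δ : ℝ} (hδ : 0 < δ)
    {f : (Fin m → ℝ) → ℝ} (hf : ContDiffOn ℝ k f (euclBall m \ {0})) :
    ContDiff ℝ k (fun x => cutoff δ (normSq x) * f x) := by
  rw [contDiff_iff_contDiffAt]
  intro x
  by_cases hx : x ∈ euclBall m \ {0}
  · exact (((contDiff_cutoff δ).of_le hk).comp contDiff_normSq).contDiffAt.mul
      (hf.contDiffAt ((isOpen_euclBall_diff_zero m).mem_nhds hx))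
  · have hx' : normSq x < δ ^ 2 ∨ 1 - δ < normSq x := by
      rw [mem_sdiff, not_and_or, not_not, mem_singleton_iff] at hx
      rcases hx with hx | rfl
      · right
        have : 1 ≤ normSq x := not_lt.1 hx
        linarith
      · left
        rw [normSq_eq_zero.2 rfl]; positivity
    have hev : (fun x => cutoff δ (normSq x) * f x) =ᶠ[nhds x] fun _ => 0 := by
      rcases hx' with hx' | hx'
      · filter_upwards [(isOpen_lt continuous_normSq continuous_const).mem_nhds hx'] with y hy
        rw [cutoff_eq_zero hδ fun h => lt_asymm h.1 hy, zero_mul]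
      · filter_upwards [(isOpen_lt continuous_const continuous_normSq).mem_nhds hx'] with y hy
        rw [cutoff_eq_zero hδ fun h => lt_asymm h.2 hy, zero_mul]
    exact contDiffAt_const.congr_of_eventuallyEq hev

theorem hasCompactSupport_cutoff_mul {m : ℕ} {δ : ℝ} (hδ : 0 < δ) (f : (Fin m → ℝ) → ℝ) :
    HasCompactSupport (fun x => cutoff δ (normSq x) * f x) := by
  refine HasCompactSupport.intro (isCompact_normSq_le m) fun x hx => ?_
  rw [cutoff_eq_zero hδ, zero_mul]
  intro h
  exact hx (show normSq x ≤ 1 by linarith [h.2])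

theorem integral_fderiv_eq_zero {m : ℕ} {f : (Fin m → ℝ) → ℝ} (hf : ContDiff ℝ 1 f)
    (hs : HasCompactSupport f) (v : Fin m → ℝ) : ∫ x, fderiv ℝ f x v = 0 := by
  have hi : Integrable (fun x => fderiv ℝ f x v) :=
    ((hf.continuous_fderiv one_ne_zero).clm_apply continuous_const).integrable_of_hasCompactSupport
      (hs.fderiv_apply ℝ v)
  have := integral_mul_fderiv_eq_neg_fderiv_mul_of_integrable (𝕜 := ℝ) (μ := volume)
    (f := fun _ : Fin m → ℝ => (1:ℝ)) (g := f) (v := v) (by simp) (by simpa using hi)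
    (by simpa using hf.continuous.integrable_of_hasCompactSupport hs)
    (by fun_prop) (fun x _ => hf.differentiable one_ne_zero x)
  simpa using this

theorem ae_mem_euclBall_diff_zero {m : ℕ} (hm : m ≠ 0) :
    ∀ᵐ x ∂(volume.restrict (euclBall m)), x ∈ euclBall m \ {0} := by
  have : Nonempty (Fin m) := ⟨⟨0, Nat.pos_of_ne_zero hm⟩⟩
  filter_upwards [ae_restrict_of_ae (Measure.ae_ne volume 0),
    ae_restrict_mem (isOpen_euclBall m).measurableSet] with x h1 h2 using ⟨h2, h1⟩

theorem hasFDerivAt_normSq_apply {m : ℕ} (x : Fin m → ℝ) (i : Fin m) :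
    ∃ L : (Fin m → ℝ) →L[ℝ] ℝ, HasFDerivAt normSq L x ∧ L (Pi.single i 1) = 2 * x i := by
  refine ⟨_, HasFDerivAt.fun_sum fun j _ => (hasFDerivAt_apply j x).pow 2, ?_⟩
  simp [Pi.single_apply]

theorem integral_cutoff_mul_le {m : ℕ} {X : Fin m → (Fin m → ℝ) → ℝ} {D F ω : (Fin m → ℝ) → ℝ}
    (hX : ∀ i, ContDiffOn ℝ 1 (X i) (euclBall m \ {0}))
    (hD : IntegrableOn D (euclBall m)) (hF : ContinuousOn F (euclBall m \ {0}))
    (hω : ContinuousOn ω (closure (euclBall m)))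
    (hdiv : ∀ x ∈ euclBall m \ {0}, ∑ i, fderiv ℝ (X i) x (Pi.single i 1) ≤ D x - F x)
    (hflux : ∀ x ∈ euclBall m \ {0}, |∑ i, x i * X i x| ≤ ω x) (hm : m ≠ 0)
    {δ : ℝ} (hδ : 0 < δ) :
    ∫ x in euclBall m, cutoff δ (normSq x) * F x ≤
      (∫ x in euclBall m, cutoff δ (normSq x) * D x)
        + ∫ x in euclBall m, 2 * |deriv (cutoff δ) (normSq x)| * ω x := by
  have hYc : ∀ i, ContDiff ℝ 1 (fun x => cutoff δ (normSq x) * X i x) := fun i =>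
    contDiff_cutoff_mul le_rfl hδ (hX i)
  have hYs : ∀ i, HasCompactSupport (fun x => cutoff δ (normSq x) * X i x) := fun i =>
    hasCompactSupport_cutoff_mul hδ _
  have hYi : ∀ i, Integrable
      (fun x => fderiv ℝ (fun x => cutoff δ (normSq x) * X i x) x (Pi.single i 1)) := fun i =>
    (((hYc i).continuous_fderiv one_ne_zero).clm_apply
      continuous_const).integrable_of_hasCompactSupport ((hYs i).fderiv_apply ℝ _)
  have hzero : ∫ x in euclBall m,
      ∑ i, fderiv ℝ (fun x => cutoff δ (normSq x) * X i x) x (Pi.single i 1) = 0 := by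
    rw [setIntegral_eq_integral_of_forall_compl_eq_zero, integral_finsetSum _ fun i _ => hYi i]
    · exact Finset.sum_eq_zero fun i _ => integral_fderiv_eq_zero (hYc i) (hYs i) _
    · intro x hx
      refine Finset.sum_eq_zero fun i _ => ?_
      have hx' : 1 - δ < normSq x := by
        have : 1 ≤ normSq x := not_lt.1 hx
        linarith
      have hev : (fun x => cutoff δ (normSq x) * X i x) =ᶠ[nhds x] fun _ => 0 := by
        filter_upwards [(isOpen_lt continuous_const continuous_normSq).mem_nhds hx'] with y hy
        rw [cutoff_eq_zero hδ fun h => lt_asymm h.2 hy, zero_mul]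
      rw [hev.fderiv_eq]
      simp
  have hFi : IntegrableOn (fun x => cutoff δ (normSq x) * F x) (euclBall m) :=
    ((contDiff_cutoff_mul zero_le_one hδ
      (contDiffOn_zero.2 hF)).continuous.integrable_of_hasCompactSupport
        (hasCompactSupport_cutoff_mul hδ F)).integrableOn
  have hcc : Continuous fun x : Fin m → ℝ => cutoff δ (normSq x) :=
    (contDiff_cutoff δ).continuous.comp continuous_normSq
  have hDi : IntegrableOn (fun x => cutoff δ (normSq x) * D x) (euclBall m) := by
    refine Integrable.bdd_mul (c := 1) hD hcc.aestronglyMeasurable ?_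
    filter_upwards with x
    rw [Real.norm_of_nonneg (cutoff_nonneg _ _)]
    exact cutoff_le_one _ _
  have hωi : IntegrableOn (fun x => 2 * |deriv (cutoff δ) (normSq x)| * ω x) (euclBall m) := by
    refine (ContinuousOn.integrableOn_compact (isCompact_closure_euclBall m) ?_).mono_set
      subset_closure
    have : Continuous fun x : Fin m → ℝ => 2 * |deriv (cutoff δ) (normSq x)| :=
      continuous_const.mul (((contDiff_cutoff δ).continuous_deriv le_rfl).comp
        continuous_normSq).abs
    exact this.continuousOn.mul hω
  have hSi : IntegrableOn (fun x =>
      ∑ i, fderiv ℝ (fun x => cutoff δ (normSq x) * X i x) x (Pi.single i 1)) (euclBall m) :=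
    (integrable_finsetSum _ fun i _ => hYi i).integrableOn
  have key : ∀ x ∈ euclBall m \ {0},
      (∑ i, fderiv ℝ (fun x => cutoff δ (normSq x) * X i x) x (Pi.single i 1))
        + cutoff δ (normSq x) * F x
      ≤ cutoff δ (normSq x) * D x + 2 * |deriv (cutoff δ) (normSq x)| * ω x := by
    intro x hx
    have e1 : ∀ i, fderiv ℝ (fun x => cutoff δ (normSq x) * X i x) x (Pi.single i 1)
        = cutoff δ (normSq x) * fderiv ℝ (X i) x (Pi.single i 1)
          + 2 * deriv (cutoff δ) (normSq x) * (x i * X i x) := by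
      intro i
      obtain ⟨L, hL, hLi⟩ := hasFDerivAt_normSq_apply x i
      have h1 : HasFDerivAt (fun x => cutoff δ (normSq x)) (deriv (cutoff δ) (normSq x) • L) x :=
        ((contDiff_cutoff δ).differentiable one_ne_zero _).hasDerivAt.comp_hasFDerivAt x hL
      have h2 : HasFDerivAt (X i) (fderiv ℝ (X i) x) x :=
        (((hX i).contDiffAt ((isOpen_euclBall_diff_zero m).mem_nhds hx)).differentiableAt
          one_ne_zero).hasFDerivAt
      rw [(h1.fun_mul h2).fderiv]
      simp [hLi]
      ring
    simp only [e1, Finset.sum_add_distrib, ← Finset.mul_sum]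
    have h1 := mul_le_mul_of_nonneg_left (hdiv x hx) (cutoff_nonneg δ (normSq x))
    have h2 : deriv (cutoff δ) (normSq x) * ∑ i, x i * X i x
        ≤ |deriv (cutoff δ) (normSq x)| * ω x := by
      refine (le_abs_self _).trans ?_
      rw [abs_mul]
      exact mul_le_mul_of_nonneg_left (hflux x hx) (abs_nonneg _)
    linarith
  have := integral_mono_ae (hSi.add hFi) (hDi.add hωi) (by
    filter_upwards [ae_mem_euclBall_diff_zero hm] with x hx using key x hx)
  simp only [Pi.add_apply] at this
  rw [integral_add hSi hFi, integral_add hDi hωi, hzero, zero_add] at this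
  exact this

theorem eventually_integral_flux_le {m : ℕ} (hm : 3 ≤ m) {ω : (Fin m → ℝ) → ℝ}
    (hω : ContinuousOn ω (closure (euclBall m))) (hω0 : ∀ x, 0 ≤ ω x)
    (hωf : ∀ x ∈ frontier (euclBall m), ω x = 0) {e : ℝ} (he : 0 < e) :
    ∀ᶠ δ in nhdsWithin (0:ℝ) (Ioi 0),
      ∫ x in euclBall m, 2 * |deriv (cutoff δ) (normSq x)| * ω x ≤ e := by
  obtain ⟨C, hC0, hC⟩ := exists_bound_deriv_cutoff
  obtain ⟨M, hM⟩ := (isCompact_closure_euclBall m).exists_bound_of_continuousOn hω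
  have hM0 : 0 ≤ M := (norm_nonneg _).trans
    (hM 0 (subset_closure (by simp [euclBall, normSq_eq_zero.2])))
  set V := volume.real (euclBall m) with hV
  have hV0 : 0 ≤ V := measureReal_nonneg
  obtain ⟨e', he'0, he'⟩ : ∃ e', 0 < e' ∧ 4 * C * e' * m * V ≤ e / 2 := by
    refine ⟨e / (8 * C * m * V + 1), by positivity, ?_⟩
    have h1 : 0 < 8 * C * m * V + 1 := by positivity
    rw [mul_div_assoc', div_mul_eq_mul_div, div_mul_eq_mul_div, div_le_iff₀ h1]
    nlinarith
  obtain ⟨ρ, hρ1, hρ⟩ : ∃ ρ < 1, ∀ x ∈ euclBall m, ρ < normSq x → ω x < e' := by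
    have hcl : IsClosed (closure (euclBall m) ∩ ω ⁻¹' Ici e') :=
      hω.preimage_isClosed_of_isClosed isClosed_closure isClosed_Ici
    have hco : IsCompact (closure (euclBall m) ∩ ω ⁻¹' Ici e') :=
      (isCompact_closure_euclBall m).of_isClosed_subset hcl inter_subset_left
    rcases (closure (euclBall m) ∩ ω ⁻¹' Ici e').eq_empty_or_nonempty with hemp | hne
    · refine ⟨0, one_pos.trans_le' le_rfl, fun x hx _ => ?_⟩
      by_contra! h
      exact (hemp ▸ (⟨subset_closure hx, h⟩ : x ∈ closure (euclBall m) ∩ ω ⁻¹' Ici e') :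
        x ∈ (∅ : Set (Fin m → ℝ)))
    · obtain ⟨z, hz, hzmax⟩ := hco.exists_isMaxOn hne continuous_normSq.continuousOn
      refine ⟨normSq z, ?_, fun x hx hlt => ?_⟩
      · by_contra! h1
        have : ω z = 0 := hωf z (by
          rw [(isOpen_euclBall m).frontier_eq]
          exact ⟨hz.1, not_lt.2 h1⟩)
        have h2 : e' ≤ ω z := hz.2
        linarith
      · by_contra! h
        exact absurd (hzmax (⟨subset_closure hx, h⟩ : x ∈ closure (euclBall m) ∩ ω ⁻¹' Ici e'))
          (not_le.2 hlt)
  have hsmall : ∀ᶠ δ in nhdsWithin (0:ℝ) (Ioi 0),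
      2 * C * M * V * 2 ^ m * δ < e / 2 := by
    have : Filter.Tendsto (fun δ : ℝ => 2 * C * M * V * 2 ^ m * δ) (nhdsWithin (0:ℝ) (Ioi 0))
        (nhds (2 * C * M * V * 2 ^ m * 0)) :=
      ((by fun_prop : Continuous fun δ : ℝ => 2 * C * M * V * 2 ^ m * δ).tendsto 0).mono_left
        nhdsWithin_le_nhds
    exact this.eventually (gt_mem_nhds (by simpa using half_pos he))
  filter_upwards [hsmall, self_mem_nhdsWithin,
    Ioo_mem_nhdsGT (show (0:ℝ) < (1 - ρ) / 2 by linarith),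
    Ioo_mem_nhdsGT (show (0:ℝ) < 1 / 2 by norm_num)] with δ h1 hδ0 h3 h4
  have hδ : 0 < δ := hδ0
  set S₁ : Set (Fin m → ℝ) := {x | normSq x < (2 * δ) ^ 2} with hS₁
  set S₂ : Set (Fin m → ℝ) := {x | normSq x < 1 ∧ 1 - 2 * δ ≤ normSq x} with hS₂
  have hS₁m : MeasurableSet S₁ := (isOpen_lt continuous_normSq continuous_const).measurableSet
  have hS₂m : MeasurableSet S₂ :=
    ((isOpen_lt continuous_normSq continuous_const).measurableSet).inter
      (isClosed_le continuous_const continuous_normSq).measurableSet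
  have hfin := volume_euclBall_ne_top m
  have hS₂sub : S₂ ⊆ euclBall m := fun x hx => hx.1
  have hS₁sub : S₁ ⊆ euclBall m := fun x hx => by
    have h5 : normSq x < (2 * δ) ^ 2 := hx
    have h6 : (2 * δ) ^ 2 ≤ 1 := pow_le_one₀ (by linarith) (by linarith [h4.2])
    exact h5.trans_le h6
  have hi : ∀ (S : Set (Fin m → ℝ)) (_ : MeasurableSet S) (c : ℝ),
      IntegrableOn (fun x => c * S.indicator 1 x) (euclBall m) := fun S hS c => by
    have : IsFiniteMeasure (volume.restrict (euclBall m)) := ⟨by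
      rw [Measure.restrict_apply_univ]; exact hfin.lt_top⟩
    exact ((integrable_const (1:ℝ)).indicator hS).const_mul c
  have h_int : ∀ (S : Set (Fin m → ℝ)) (_ : MeasurableSet S) (_ : S ⊆ euclBall m) (c : ℝ),
      ∫ x in euclBall m, c * S.indicator 1 x = c * volume.real S := fun S hS hsub c => by
    rw [integral_const_mul, integral_indicator_one hS, measureReal_restrict_apply hS,
      inter_eq_left.2 hsub]
  have hpt : ∀ x ∈ euclBall m, 2 * |deriv (cutoff δ) (normSq x)| * ω x
      ≤ 2 * C * M / δ ^ 2 * S₁.indicator 1 x + 2 * C * e' / δ * S₂.indicator 1 x := by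
    intro x hx
    have hωM : ω x ≤ M := (le_abs_self _).trans (hM x (subset_closure hx))
    have b1 : {s : ℝ | s ≤ 2 * δ ^ 2}.indicator (1 : ℝ → ℝ) (normSq x) * ω x
        ≤ M * S₁.indicator 1 x := by
      by_cases hs : normSq x ≤ 2 * δ ^ 2
      · have hx1 : x ∈ S₁ := show normSq x < (2 * δ) ^ 2 by nlinarith
        rw [indicator_of_mem (by exact hs), indicator_of_mem hx1]
        simpa using hωM
      · rw [indicator_of_notMem (by exact hs), zero_mul]
        exact mul_nonneg hM0 (indicator_nonneg (fun _ _ => zero_le_one) _)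
    have b2 : {s : ℝ | 1 - 2 * δ ≤ s}.indicator (1 : ℝ → ℝ) (normSq x) * ω x
        ≤ e' * S₂.indicator 1 x := by
      by_cases hs : 1 - 2 * δ ≤ normSq x
      · have hx1 : x ∈ S₂ := ⟨hx, hs⟩
        rw [indicator_of_mem (by exact hs), indicator_of_mem hx1]
        have := (hρ x hx (by linarith [h3.2])).le
        simpa using this
      · rw [indicator_of_notMem (by exact hs), zero_mul]
        exact mul_nonneg he'0.le (indicator_nonneg (fun _ _ => zero_le_one) _)
    calc 2 * |deriv (cutoff δ) (normSq x)| * ω x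
        ≤ 2 * (C / δ ^ 2 * {s : ℝ | s ≤ 2 * δ ^ 2}.indicator 1 (normSq x)
          + C / δ * {s : ℝ | 1 - 2 * δ ≤ s}.indicator 1 (normSq x)) * ω x := by
          have := hω0 x
          gcongr
          exact hC δ hδ _
      _ = 2 * (C / δ ^ 2) * ({s : ℝ | s ≤ 2 * δ ^ 2}.indicator 1 (normSq x) * ω x)
          + 2 * (C / δ) * ({s : ℝ | 1 - 2 * δ ≤ s}.indicator 1 (normSq x) * ω x) := by ring
      _ ≤ 2 * (C / δ ^ 2) * (M * S₁.indicator 1 x) + 2 * (C / δ) * (e' * S₂.indicator 1 x) := by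
          gcongr
      _ = _ := by ring
  have hle : ∫ x in euclBall m, 2 * |deriv (cutoff δ) (normSq x)| * ω x
      ≤ ∫ x in euclBall m, (2 * C * M / δ ^ 2 * S₁.indicator 1 x
        + 2 * C * e' / δ * S₂.indicator 1 x) := by
    refine integral_mono_of_nonneg (.of_forall fun x => ?_)
      ((hi S₁ hS₁m _).add (hi S₂ hS₂m _)) ?_
    · have := hω0 x
      positivity
    · filter_upwards [ae_restrict_mem (isOpen_euclBall m).measurableSet] with x hx using hpt x hx
  rw [integral_add (hi S₁ hS₁m _) (hi S₂ hS₂m _), h_int S₁ hS₁m hS₁sub, h_int S₂ hS₂m hS₂sub,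
    hS₁, volumeReal_normSq_lt (by positivity)] at hle
  have hv2 : volume.real S₂ ≤ m * (2 * δ) * V :=
    volumeReal_shell_le (by positivity) (by linarith [h4.2])
  have g1 : 2 * C * M / δ ^ 2 * ((2 * δ) ^ m * V) ≤ 2 * C * M * V * 2 ^ m * δ := by
    obtain ⟨k, rfl⟩ : ∃ k, m = k + 3 := ⟨m - 3, by omega⟩
    have h5 : δ ^ k ≤ 1 := pow_le_one₀ hδ.le (by linarith [h4.2])
    calc 2 * C * M / δ ^ 2 * ((2 * δ) ^ (k + 3) * V)
        = 2 * C * M * V * 2 ^ (k + 3) * δ * δ ^ k := by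
          rw [mul_pow]; field_simp; ring
      _ ≤ 2 * C * M * V * 2 ^ (k + 3) * δ * 1 := by gcongr
      _ = _ := mul_one _
  have g2 : 2 * C * e' / δ * volume.real S₂ ≤ 4 * C * e' * m * V := by
    calc 2 * C * e' / δ * volume.real S₂ ≤ 2 * C * e' / δ * (m * (2 * δ) * V) := by gcongr
      _ = _ := by field_simp; ring
  linarith

theorem cutoff_anti {δ δ' s : ℝ} (hδ : 0 < δ) (hle : δ ≤ δ') (hs0 : 0 ≤ s) (hs1 : s ≤ 1) :
    cutoff δ' s ≤ cutoff δ s := by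
  have h1 : s / δ' ^ 2 ≤ s / δ ^ 2 := by gcongr
  have h2 : (1 - s) / δ' ≤ (1 - s) / δ := div_le_div_of_nonneg_left (by linarith) hδ hle
  exact mul_le_mul (Real.smoothTransition.monotone (by linarith))
    (Real.smoothTransition.monotone (by linarith)) (Real.smoothTransition.nonneg _)
    (Real.smoothTransition.nonneg _)

theorem eventually_cutoff_eq_one {s : ℝ} (hs : s ∈ Ioo (0:ℝ) 1) :
    ∀ᶠ δ in nhdsWithin (0:ℝ) (Ioi 0), cutoff δ s = 1 := by
  have h1 : ∀ᶠ δ in nhds (0:ℝ), 2 * δ ^ 2 < s :=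
    (by fun_prop : Continuous fun δ : ℝ => 2 * δ ^ 2).continuousAt.eventually_lt
      continuousAt_const (by simpa using hs.1)
  have h2 : ∀ᶠ δ in nhds (0:ℝ), s < 1 - 2 * δ :=
    continuousAt_const.eventually_lt
      (by fun_prop : Continuous fun δ : ℝ => 1 - 2 * δ).continuousAt (by simpa using hs.2)
  filter_upwards [nhdsWithin_le_nhds h1, nhdsWithin_le_nhds h2, self_mem_nhdsWithin]
    with δ a b c using cutoff_eq_one c a.le b.le

/-- If `D - F` dominates the divergence of a vector field whose flux vanishes at the boundary of
the unit ball and is controlled at the origin, then `D` has nonnegative integral, and `F` vanishes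
when this integral does. -/
theorem integral_nonneg_of_divergence_le {m : ℕ} (hm : 3 ≤ m)
    {X : Fin m → (Fin m → ℝ) → ℝ} {D F ω : (Fin m → ℝ) → ℝ}
    (hX : ∀ i, ContDiffOn ℝ 1 (X i) (euclBall m \ {0}))
    (hD : IntegrableOn D (euclBall m)) (hF : ContinuousOn F (euclBall m \ {0}))
    (hF0 : ∀ x ∈ euclBall m \ {0}, 0 ≤ F x)
    (hω : ContinuousOn ω (closure (euclBall m))) (hω0 : ∀ x, 0 ≤ ω x)
    (hωf : ∀ x ∈ frontier (euclBall m), ω x = 0)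
    (hdiv : ∀ x ∈ euclBall m \ {0}, ∑ i, fderiv ℝ (X i) x (Pi.single i 1) ≤ D x - F x)
    (hflux : ∀ x ∈ euclBall m \ {0}, |∑ i, x i * X i x| ≤ ω x) :
    0 ≤ ∫ x in euclBall m, D x ∧
      (∫ x in euclBall m, D x ≤ 0 → ∀ x ∈ euclBall m \ {0}, F x = 0) := by
  have hm0 : m ≠ 0 := by omega
  have hne := ae_mem_euclBall_diff_zero hm0
  have hlim : Filter.Tendsto (fun δ => ∫ x in euclBall m, cutoff δ (normSq x) * D x)
      (nhdsWithin 0 (Ioi 0)) (nhds (∫ x in euclBall m, D x)) := by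
    refine tendsto_integral_filter_of_dominated_convergence (fun x => ‖D x‖) ?_ ?_ hD.norm ?_
    · exact .of_forall fun δ => (((contDiff_cutoff δ).continuous.comp
        continuous_normSq).aestronglyMeasurable).mul hD.aestronglyMeasurable
    · refine .of_forall fun δ => .of_forall fun x => ?_
      rw [norm_mul, Real.norm_of_nonneg (cutoff_nonneg _ _)]
      exact mul_le_of_le_one_left (norm_nonneg _) (cutoff_le_one _ _)
    · filter_upwards [hne] with x hx
      refine tendsto_const_nhds.congr' ?_
      filter_upwards [eventually_cutoff_eq_one (normSq_mem_Ioo hx)] with δ hδ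
      rw [hδ, one_mul]
  have hζF : ∀ δ x, 0 < δ → 0 ≤ cutoff δ (normSq x) * F x := by
    intro δ x hδ
    by_cases hx : x ∈ euclBall m \ {0}
    · exact mul_nonneg (cutoff_nonneg _ _) (hF0 x hx)
    · rw [cutoff_eq_zero hδ, zero_mul]
      intro h
      refine hx ⟨show normSq x < 1 by linarith [h.2], fun h0 => ?_⟩
      rw [mem_singleton_iff] at h0
      rw [h0, normSq_eq_zero.2 rfl] at h
      exact absurd h.1 (not_lt.2 (sq_nonneg δ))
  have hle : ∀ e > 0, ∀ᶠ δ in nhdsWithin (0:ℝ) (Ioi 0),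
      ∫ x in euclBall m, cutoff δ (normSq x) * F x
        ≤ (∫ x in euclBall m, cutoff δ (normSq x) * D x) + e := by
    intro e he
    filter_upwards [eventually_integral_flux_le hm hω hω0 hωf he, self_mem_nhdsWithin] with δ h1 h2
    exact (integral_cutoff_mul_le hX hD hF hω hdiv hflux hm0 h2).trans (by linarith)
  refine ⟨?_, fun hD0 => ?_⟩
  · refine le_of_forall_pos_le_add fun e he => ?_
    refine ge_of_tendsto (hlim.add_const e) ?_
    filter_upwards [hle e he, self_mem_nhdsWithin] with δ h1 h2
    exact (integral_nonneg fun x => hζF δ x h2).trans h1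
  · have hcont : ∀ δ, 0 < δ → Continuous fun x => cutoff δ (normSq x) * F x := fun δ hδ =>
      (contDiff_cutoff_mul zero_le_one hδ (contDiffOn_zero.2 hF)).continuous
    have hzero : ∀ δ₀, 0 < δ₀ → ∫ x in euclBall m, cutoff δ₀ (normSq x) * F x ≤ 0 := by
      intro δ₀ hδ₀
      refine le_of_forall_pos_le_add fun e he => ?_
      have h1 : ∀ᶠ δ in nhdsWithin (0:ℝ) (Ioi 0), ∫ x in euclBall m, cutoff δ₀ (normSq x) * F x
          ≤ (∫ x in euclBall m, cutoff δ (normSq x) * D x) + e := by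
        filter_upwards [hle e he, Ioc_mem_nhdsGT hδ₀] with δ h1 h2
        refine le_trans ?_ h1
        refine integral_mono_ae
          ((hcont δ₀ hδ₀).integrable_of_hasCompactSupport
            (hasCompactSupport_cutoff_mul hδ₀ F)).integrableOn
          ((hcont δ h2.1).integrable_of_hasCompactSupport
            (hasCompactSupport_cutoff_mul h2.1 F)).integrableOn ?_
        filter_upwards [hne] with x hx
        have h3 := normSq_mem_Ioo hx
        exact mul_le_mul_of_nonneg_right (cutoff_anti h2.1 h2.2 h3.1.le h3.2.le) (hF0 x hx)
      exact (ge_of_tendsto (hlim.add_const e) h1).trans (by linarith)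
    intro x hx
    obtain ⟨δ, hδ1, hδ⟩ :=
      ((eventually_cutoff_eq_one (normSq_mem_Ioo hx)).and self_mem_nhdsWithin).exists
    by_contra hFx
    have hδ : 0 < δ := hδ
    have hpos := (hcont δ hδ).integral_pos_of_hasCompactSupport_nonneg_nonzero (μ := volume)
      (hasCompactSupport_cutoff_mul hδ F) (fun y => hζF δ y hδ) (x := x) (by simpa [hδ1] using hFx)
    have h0 := hzero δ hδ
    rw [setIntegral_eq_integral_of_forall_compl_eq_zero] at h0
    · exact absurd hpos (not_lt.2 h0)
    · intro y hy
      rw [cutoff_eq_zero hδ, zero_mul]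
      intro h
      exact hy (show normSq y < 1 by linarith [h.2])

theorem contDiffOn_one_of_hasDerivAt {f f' : ℝ → ℝ} {U : Set ℝ} (hU : IsOpen U)
    (hf : ∀ s ∈ U, HasDerivAt f (f' s) s) (hf' : ContinuousOn f' U) : ContDiffOn ℝ 1 f U := by
  have h1 : ContDiffOn ℝ (0 + 1) f U := by
    rw [contDiffOn_succ_iff_deriv_of_isOpen hU]
    refine ⟨fun s hs => (hf s hs).differentiableAt.differentiableWithinAt, by simp, ?_⟩
    exact contDiffOn_zero.2 (hf'.congr fun s hs => (hf s hs).deriv)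
  simpa using h1

theorem IsRadialProfile.contDiffOn_deriv {m : ℕ} {κ G G1 G2 : ℝ → ℝ} {K : ℝ}
    (hG : IsRadialProfile m κ G G1 G2 K) : ContDiffOn ℝ 1 G1 (Ioo 0 1) :=
  contDiffOn_one_of_hasDerivAt isOpen_Ioo hG.hasDerivAt_deriv hG.continuousOn

theorem IsRadialProfile.contDiffOn {m : ℕ} {κ G G1 G2 : ℝ → ℝ} {K : ℝ}
    (hG : IsRadialProfile m κ G G1 G2 K) : ContDiffOn ℝ 1 G (Ioo 0 1) :=
  contDiffOn_one_of_hasDerivAt isOpen_Ioo hG.hasDerivAt hG.contDiffOn_deriv.continuousOn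

theorem ContDiffOn.comp_normSq {m : ℕ} {f : ℝ → ℝ} (hf : ContDiffOn ℝ 1 f (Ioo 0 1)) :
    ContDiffOn ℝ 1 (fun x : Fin m → ℝ => f (normSq x)) (euclBall m \ {0}) :=
  hf.comp contDiff_normSq.contDiffOn fun _ hx => normSq_mem_Ioo hx

/-- The radial map `x ↦ (G(|x|²) x, 0)`. -/
def radialMap {m : ℕ} (n : ℕ) (G : ℝ → ℝ) (x : Fin m → ℝ) : Fin n → ℝ :=
  G (normSq x) • padZero m n x

/-- The vector field `½|w|² ∇ log(G/|x|) + ∇u · w` for `u = radialMap n G`, whose divergence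
bounds the energy excess of `u + w` over `u` from below. -/
def calibration {m n : ℕ} (G G1 : ℝ → ℝ) (w : (Fin m → ℝ) → Fin n → ℝ) (i : Fin m)
    (x : Fin m → ℝ) : ℝ :=
  ∑ j, w x j * (G (normSq x) * padZero m n (Pi.single i 1) j
      + 2 * G1 (normSq x) * (x i * padZero m n x j))
    + 1 / 2 * normSq (w x) * ((2 * G1 (normSq x) / G (normSq x) - 1 / normSq x) * x i)

theorem contDiffOn_calibration {m n : ℕ} {κ G G1 G2 : ℝ → ℝ} {K : ℝ}
    (hG : IsRadialProfile m κ G G1 G2 K) {w : (Fin m → ℝ) → Fin n → ℝ}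
    (hw : ContDiffOn ℝ 1 w (euclBall m \ {0})) (i : Fin m) :
    ContDiffOn ℝ 1 (calibration G G1 w i) (euclBall m \ {0}) := by
  have hg := hG.contDiffOn.comp_normSq (m := m)
  have hg1 := hG.contDiffOn_deriv.comp_normSq (m := m)
  have hs : ContDiffOn ℝ 1 (fun x : Fin m → ℝ => normSq x) (euclBall m \ {0}) :=
    contDiff_normSq.contDiffOn
  have hwj : ∀ j, ContDiffOn ℝ 1 (fun x => w x j) (euclBall m \ {0}) := contDiffOn_pi.1 hw
  have hw2 : ContDiffOn ℝ 1 (fun x => normSq (w x)) (euclBall m \ {0}) :=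
    contDiff_normSq.comp_contDiffOn hw
  have hx : ContDiffOn ℝ 1 (fun x : Fin m → ℝ => x i) (euclBall m \ {0}) :=
    (contDiff_apply ℝ ℝ i).contDiffOn
  have hy : ∀ j, ContDiffOn ℝ 1 (fun x => padZero m n x j) (euclBall m \ {0}) := fun j =>
    (contDiff_pi.1 (padZero m n).contDiff j).contDiffOn
  unfold calibration
  refine (ContDiffOn.sum fun j _ => (hwj j).mul ((hg.mul contDiffOn_const).add
    ((contDiffOn_const.mul hg1).mul (hx.mul (hy j))))).add ((contDiffOn_const.mul hw2).mul
    (((contDiffOn_const.mul hg1).div hg ?_).sub (contDiffOn_const.div hs ?_) |>.mul hx))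
  · exact fun x hx => (zero_lt_one.trans_le (hG.one_le _ (normSq_mem_Ioo hx))).ne'
  · exact fun x hx => (normSq_mem_Ioo hx).1.ne'

theorem hasLineDerivAt_normSq {m : ℕ} (x : Fin m → ℝ) (i : Fin m) :
    HasLineDerivAt ℝ normSq (2 * x i) x (Pi.single i 1) := by
  obtain ⟨L, hL, h⟩ := hasFDerivAt_normSq_apply x i
  exact h ▸ hL.hasLineDerivAt _

theorem HasDerivAt.hasLineDerivAt_comp_normSq {m : ℕ} {f : ℝ → ℝ} {f' : ℝ} {x : Fin m → ℝ}
    (hf : HasDerivAt f f' (normSq x)) (i : Fin m) :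
    HasLineDerivAt ℝ (fun x => f (normSq x)) (f' * (2 * x i)) x (Pi.single i 1) :=
  HasDerivAt.comp_of_eq (h₂ := f) 0 hf (hasLineDerivAt_normSq x i) (by simp)

theorem hasLineDerivAt_padZero {m n : ℕ} (x : Fin m → ℝ) (i : Fin m) (j : Fin n) :
    HasLineDerivAt ℝ (fun x => padZero m n x j) (padZero m n (Pi.single i 1) j) x
      (Pi.single i 1) :=
  (hasFDerivAt_pi'.1 (padZero m n).hasFDerivAt j).hasLineDerivAt (Pi.single i 1)

theorem hasLineDerivAt_coord {m : ℕ} (x : Fin m → ℝ) (i : Fin m) :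
    HasLineDerivAt ℝ (fun x => x i) 1 x (Pi.single i 1) := by
  have := (hasFDerivAt_apply (𝕜 := ℝ) (F' := fun _ => ℝ) i x).hasLineDerivAt (Pi.single i 1)
  simpa using this

theorem hasLineDerivAt_comp_apply {m n : ℕ} {w : (Fin m → ℝ) → Fin n → ℝ} {x : Fin m → ℝ}
    (hw : DifferentiableAt ℝ w x) (i : Fin m) (j : Fin n) :
    HasLineDerivAt ℝ (fun x => w x j) (fderiv ℝ w x (Pi.single i 1) j) x (Pi.single i 1) :=
  (hasFDerivAt_pi'.1 hw.hasFDerivAt j).hasLineDerivAt (Pi.single i 1)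

theorem fderiv_calibration {m n : ℕ} {κ G G1 G2 : ℝ → ℝ} {K : ℝ}
    (hG : IsRadialProfile m κ G G1 G2 K) {w : (Fin m → ℝ) → Fin n → ℝ}
    (hw : ContDiffOn ℝ 1 w (euclBall m \ {0})) {x : Fin m → ℝ} (hx : x ∈ euclBall m \ {0})
    (i : Fin m) :
    fderiv ℝ (calibration G G1 w i) x (Pi.single i 1) =
      ∑ j, (fderiv ℝ w x (Pi.single i 1) j * (G (normSq x) * padZero m n (Pi.single i 1) j
          + 2 * G1 (normSq x) * (x i * padZero m n x j))
        + w x j * (2 * G1 (normSq x) * x i * padZero m n (Pi.single i 1) j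
          + 4 * G2 (normSq x) * x i ^ 2 * padZero m n x j
          + 2 * G1 (normSq x) * (padZero m n x j + x i * padZero m n (Pi.single i 1) j)))
      + (∑ j, w x j * fderiv ℝ w x (Pi.single i 1) j)
        * (2 * G1 (normSq x) / G (normSq x) - 1 / normSq x) * x i
      + 1 / 2 * normSq (w x) * (2 * (2 * (G2 (normSq x) * G (normSq x) - G1 (normSq x) ^ 2)
          / G (normSq x) ^ 2 + 1 / normSq x ^ 2) * x i ^ 2
        + (2 * G1 (normSq x) / G (normSq x) - 1 / normSq x)) := by
  have hO := (isOpen_euclBall_diff_zero m).mem_nhds hx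
  have hs := normSq_mem_Ioo hx
  have hs0 := hs.1.ne'
  have hg0 : G (normSq x) ≠ 0 := (zero_lt_one.trans_le (hG.one_le _ hs)).ne'
  have hd : DifferentiableAt ℝ (calibration G G1 w i) x :=
    ((contDiffOn_calibration hG hw i).contDiffAt hO).differentiableAt one_ne_zero
  rw [← hd.lineDeriv_eq_fderiv]
  apply HasLineDerivAt.lineDeriv
  have dw := hasLineDerivAt_comp_apply ((hw.contDiffAt hO).differentiableAt one_ne_zero) i
  have dg := (hG.hasDerivAt _ hs).hasLineDerivAt_comp_normSq i
  have dg1 := (hG.hasDerivAt_deriv _ hs).hasLineDerivAt_comp_normSq i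
  have ds := hasLineDerivAt_normSq x i
  have dx := hasLineDerivAt_coord x i
  have dy := hasLineDerivAt_padZero (n := n) x i
  unfold HasLineDerivAt at dw dg dg1 ds dx dy ⊢
  unfold calibration
  simp only [normSq] at *
  have := (HasDerivAt.fun_sum (u := Finset.univ) fun j _ => (dw j).fun_mul
      ((dg.mul_const (padZero m n (Pi.single i 1) j)).fun_add
      ((dg1.const_mul 2).fun_mul (dx.fun_mul (dy j))))).fun_add
    (((HasDerivAt.fun_sum (u := Finset.univ) fun j _ => (dw j).fun_pow 2).const_mul (1 / 2)).fun_mul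
      ((((dg1.const_mul 2).fun_div dg (by simpa using hg0)).fun_sub
        ((hasDerivAt_const (0:ℝ) (1:ℝ)).fun_div ds (by simpa using hs0))).fun_mul dx))
  convert this using 1
  simp only [zero_smul, add_zero]
  rw [add_assoc]
  congr 1
  · refine Finset.sum_congr rfl fun j _ => ?_
    ring
  · have e : ∑ j, ((2:ℕ):ℝ) * w x j ^ (2 - 1) * fderiv ℝ w x (Pi.single i 1) j
        = 2 * ∑ j, w x j * fderiv ℝ w x (Pi.single i 1) j := by
      rw [Finset.mul_sum]
      exact Finset.sum_congr rfl fun j _ => by push_cast; ring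
    rw [e]
    field_simp
    ring

theorem fderiv_radialMap {m n : ℕ} {κ G G1 G2 : ℝ → ℝ} {K : ℝ}
    (hG : IsRadialProfile m κ G G1 G2 K) {x : Fin m → ℝ} (hx : x ∈ euclBall m \ {0})
    (v : Fin m → ℝ) :
    fderiv ℝ (radialMap n G) x v = G (normSq x) • padZero m n v
      + (G1 (normSq x) * (2 * ∑ i, x i * v i)) • padZero m n x := by
  obtain ⟨L, hL, hLv⟩ : ∃ L : (Fin m → ℝ) →L[ℝ] ℝ, HasFDerivAt normSq L x ∧
      L v = 2 * ∑ i, x i * v i := by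
    refine ⟨_, HasFDerivAt.fun_sum fun j _ => (hasFDerivAt_apply j x).pow 2, ?_⟩
    simp [Finset.mul_sum, mul_assoc]
  have h1 := ((hG.hasDerivAt _ (normSq_mem_Ioo hx)).comp_hasFDerivAt x hL).smul
    (padZero m n).hasFDerivAt
  have h2 : HasFDerivAt (radialMap n G) _ x := h1
  rw [h2.fderiv]
  ext j
  simp [hLv, mul_assoc]

theorem abs_apply_le_sqrt_normSq {n : ℕ} (a : Fin n → ℝ) (j : Fin n) : |a j| ≤ √(normSq a) :=
  Real.abs_le_sqrt (Finset.single_le_sum (f := fun i => a i ^ 2) (fun _ _ => sq_nonneg _)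
    (Finset.mem_univ j))

theorem abs_sum_mul_le {n : ℕ} (a b : Fin n → ℝ) :
    |∑ j, a j * b j| ≤ √(normSq a) * √(normSq b) := by
  rw [← Real.sqrt_mul (normSq_nonneg a)]
  exact Real.abs_le_sqrt (Finset.sum_mul_sq_le_sq_mul_sq _ _ _)

theorem abs_padZero_le {m n : ℕ} (hmn : m ≤ n) (x : Fin m → ℝ) (j : Fin n) :
    |padZero m n x j| ≤ √(normSq x) :=
  normSq_padZero hmn x ▸ abs_apply_le_sqrt_normSq _ j

theorem normSq_single {m : ℕ} (i : Fin m) : normSq (Pi.single i (1:ℝ)) = 1 := by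
  simp [normSq, Pi.single_apply]

theorem normSq_smul {n : ℕ} (c : ℝ) (a : Fin n → ℝ) : normSq (c • a) = c ^ 2 * normSq a := by
  simp [normSq, mul_pow, Finset.mul_sum]

theorem normSq_radialMap {m n : ℕ} (hmn : m ≤ n) (G : ℝ → ℝ) (x : Fin m → ℝ) :
    normSq (radialMap n G x) = normSq x * G (normSq x) ^ 2 := by
  rw [radialMap, normSq_smul, normSq_padZero hmn, mul_comm]

theorem tendsto_normSq_zero (m : ℕ) :
    Filter.Tendsto (normSq : (Fin m → ℝ) → ℝ) (nhdsWithin 0 {0}ᶜ) (nhdsWithin 0 (Ioi 0)) := by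
  refine tendsto_nhdsWithin_iff.2 ⟨?_, eventually_mem_nhdsWithin.mono fun x hx => normSq_pos hx⟩
  have := (continuous_normSq (n := m)).tendsto 0
  rw [normSq_eq_zero.2 rfl] at this
  exact this.mono_left nhdsWithin_le_nhds

theorem hasFDerivAt_radialMap_zero {m n : ℕ} {G : ℝ → ℝ} {G0 : ℝ}
    (hG0 : Filter.Tendsto G (nhdsWithin 0 (Ioi 0)) (nhds G0)) :
    HasFDerivAt (radialMap n G) (G0 • padZero m n) 0 := by
  have h1 : Filter.Tendsto (fun x : Fin m → ℝ => G (normSq x) - G0) (nhdsWithin 0 {0}ᶜ)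
      (nhds 0) := by
    simpa using (hG0.comp (tendsto_normSq_zero m)).sub_const G0
  have h2 : (fun x : Fin m → ℝ => (G (normSq x) - G0) • padZero m n x)
      =o[nhdsWithin 0 {0}ᶜ] fun x => x := by
    have := ((Asymptotics.isLittleO_one_iff ℝ).2 h1).smul_isBigO
      ((padZero m n).isBigO_id (nhdsWithin 0 {0}ᶜ))
    simpa using this
  have h3 : (fun x : Fin m → ℝ => (G (normSq x) - G0) • padZero m n x) =o[nhds 0] fun x => x := by
    rw [← nhdsNE_sup_pure, Asymptotics.isLittleO_sup]
    exact ⟨h2, by rw [Asymptotics.isLittleO_pure]; simp⟩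
  rw [hasFDerivAt_iff_isLittleO_nhds_zero]
  refine h3.congr_left fun x => ?_
  simp [radialMap, sub_smul]

theorem contDiffOn_radialMap {m n : ℕ} (hmn : m ≤ n) {κ G G1 G2 : ℝ → ℝ} {K : ℝ}
    (hG : IsRadialProfile m κ G G1 G2 K) : ContDiffOn ℝ 1 (radialMap n G) (euclBall m) := by
  have hO := isOpen_euclBall m
  obtain ⟨G0, hG0⟩ := hG.exists_tendsto_zero
  have hzero := hasFDerivAt_radialMap_zero (m := m) (n := n) hG0
  have hoff : ContDiffOn ℝ 1 (radialMap n G) (euclBall m \ {0}) :=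
    hG.contDiffOn.comp_normSq.smul (padZero m n).contDiff.contDiffOn
  have hO' := isOpen_euclBall_diff_zero m
  have h1 : ContDiffOn ℝ (0 + 1) (radialMap n G) (euclBall m) := by
    rw [contDiffOn_succ_iff_fderiv_of_isOpen hO]
    refine ⟨fun x hx => ?_, by simp, contDiffOn_zero.2 ?_⟩
    · rcases eq_or_ne x 0 with rfl | hx0
      · exact hzero.differentiableAt.differentiableWithinAt
      · exact ((hoff.contDiffAt (hO'.mem_nhds ⟨hx, hx0⟩)).differentiableAt
          one_ne_zero).differentiableWithinAt
    · rw [continuousOn_clm_apply]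
      intro v x hx
      apply ContinuousAt.continuousWithinAt
      rcases eq_or_ne x 0 with rfl | hx0
      · rw [continuousAt_iff_punctured_nhds, hzero.fderiv]
        have hev : ∀ᶠ x in nhdsWithin (0 : Fin m → ℝ) {0}ᶜ, x ∈ euclBall m \ {0} := by
          filter_upwards [mem_nhdsWithin_of_mem_nhds (hO.mem_nhds hx), self_mem_nhdsWithin]
            with x h1 h2 using ⟨h1, h2⟩
        refine Filter.Tendsto.congr' (hev.mono fun x hx => (fderiv_radialMap hG hx v).symm) ?_
        rw [← add_zero ((G0 • padZero m n) v)]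
        refine Filter.Tendsto.add ?_ ?_
        · exact (hG0.comp (tendsto_normSq_zero m)).smul_const _
        · rw [tendsto_pi_nhds]
          intro j
          have hlim : Filter.Tendsto (fun x : Fin m → ℝ => 2 * K * |∑ i, x i * v i|)
              (nhdsWithin 0 {0}ᶜ) (nhds 0) := by
            have : Continuous (fun x : Fin m → ℝ => 2 * K * |∑ i, x i * v i|) := by fun_prop
            have := this.tendsto 0
            simp only [Pi.zero_apply, zero_mul, Finset.sum_const_zero, abs_zero, mul_zero] at this
            exact this.mono_left nhdsWithin_le_nhds
          refine squeeze_zero_norm' (hev.mono fun x hx => ?_) hlim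
          have hb := hG.deriv_bound _ (normSq_mem_Ioo hx)
          simp only [Pi.smul_apply, smul_eq_mul, Real.norm_eq_abs, abs_mul, abs_two]
          calc |G1 (normSq x)| * (2 * |∑ i, x i * v i|) * |padZero m n x j|
              ≤ |G1 (normSq x)| * (2 * |∑ i, x i * v i|) * √(normSq x) := by
                gcongr; exact abs_padZero_le hmn x j
            _ = 2 * (√(normSq x) * |G1 (normSq x)|) * |∑ i, x i * v i| := by ring
            _ ≤ _ := by gcongr
      · have hc := hoff.continuousOn_fderiv_of_isOpen hO' le_rfl
        exact (hc.continuousAt (hO'.mem_nhds ⟨hx, hx0⟩)).clm_apply continuousAt_const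
  simpa using h1

theorem gradSq_eq {m n : ℕ} (u : (Fin m → ℝ) → Fin n → ℝ) (x : Fin m → ℝ) :
    gradSq u x = ∑ i, ∑ j, fderiv ℝ u x (Pi.single i (1:ℝ)) j ^ 2 := by
  simp [gradSq, gradDot, sq]

theorem continuousOn_gradSq {m n : ℕ} {u : (Fin m → ℝ) → Fin n → ℝ} {U : Set (Fin m → ℝ)}
    (hU : IsOpen U) (hu : ContDiffOn ℝ 1 u U) : ContinuousOn (gradSq u) U := by
  have hc := hu.continuousOn_fderiv_of_isOpen hU le_rfl
  have : ∀ i j, ContinuousOn (fun x => fderiv ℝ u x (Pi.single i (1:ℝ)) j) U := fun i j =>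
    continuousOn_pi.1 (hc.clm_apply continuousOn_const) j
  simp only [funext (gradSq_eq u)]
  fun_prop

theorem fderiv_radialMap_single {m n : ℕ} {κ G G1 G2 : ℝ → ℝ} {K : ℝ}
    (hG : IsRadialProfile m κ G G1 G2 K) {x : Fin m → ℝ} (hx : x ∈ euclBall m \ {0})
    (i : Fin m) (j : Fin n) :
    fderiv ℝ (radialMap n G) x (Pi.single i 1) j = G (normSq x) * padZero m n (Pi.single i 1) j
      + 2 * G1 (normSq x) * (x i * padZero m n x j) := by
  rw [fderiv_radialMap hG hx]
  simp [Pi.single_apply]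
  ring

theorem gradSq_radialMap_le {m n : ℕ} (hmn : m ≤ n) {κ G G1 G2 : ℝ → ℝ} {K : ℝ}
    (hG : IsRadialProfile m κ G G1 G2 K) {x : Fin m → ℝ} (hx : x ∈ euclBall m \ {0}) :
    gradSq (radialMap n G) x ≤ ∑ _ : Fin m, ∑ _ : Fin n, (3 * K) ^ 2 := by
  rw [gradSq_eq]
  refine Finset.sum_le_sum fun i _ => Finset.sum_le_sum fun j _ => ?_
  rw [fderiv_radialMap_single hG hx, ← sq_abs]
  have hs := normSq_mem_Ioo hx
  have h1 := hG.one_le _ hs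
  have h2 := hG.le_bound _ hs
  have h3 := hG.deriv_bound _ hs
  have h4 : |padZero m n (Pi.single i 1) j| ≤ 1 := by
    simpa [normSq_single] using abs_padZero_le hmn (Pi.single i 1) j
  have h5 := abs_padZero_le hmn x j
  have h6 : |x i| ≤ 1 := (abs_apply_le_sqrt_normSq x i).trans (sqrt_mem_Ioo hs).2.le
  gcongr
  refine (abs_add_le _ _).trans ?_
  rw [abs_mul, abs_mul, abs_mul, abs_mul, abs_two, abs_of_nonneg (by linarith : 0 ≤ G (normSq x))]
  have e1 : G (normSq x) * |padZero m n (Pi.single i 1) j| ≤ K * 1 := by gcongr; linarith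
  have e2 : 2 * |G1 (normSq x)| * (|x i| * |padZero m n x j|) ≤ 2 * K := by
    calc 2 * |G1 (normSq x)| * (|x i| * |padZero m n x j|)
        ≤ 2 * |G1 (normSq x)| * (1 * √(normSq x)) := by gcongr
      _ = 2 * (√(normSq x) * |G1 (normSq x)|) := by ring
      _ ≤ 2 * K := by gcongr
  linarith

theorem integrableOn_of_continuousOn_closure {m : ℕ} {f : (Fin m → ℝ) → ℝ}
    (hf : ContinuousOn f (closure (euclBall m))) : IntegrableOn f (euclBall m) :=
  (hf.integrableOn_compact (isCompact_closure_euclBall m)).mono_set subset_closure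

theorem normSq_eq_one_of_mem_frontier {m : ℕ} {x : Fin m → ℝ} (hx : x ∈ frontier (euclBall m)) :
    normSq x = 1 :=
  frontier_lt_subset_eq continuous_normSq continuous_const hx

theorem admissible_radialMap {m n : ℕ} (hm : m ≠ 0) (hmn : m ≤ n) {κ G G1 G2 : ℝ → ℝ} {K : ℝ}
    (hG : IsRadialProfile m κ G G1 G2 K) (hGc : ContinuousOn G (Ioc 0 1)) (hG1 : G 1 = 1) :
    Admissible (euclBall m) (padZero m n) (radialMap n G) := by
  have hC := contDiffOn_radialMap hmn hG
  have hcl : ContinuousOn (radialMap n G) (closure (euclBall m)) := by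
    intro x hx
    rcases eq_or_ne x 0 with rfl | hx0
    · refine (hC.continuousOn.continuousAt ((isOpen_euclBall m).mem_nhds ?_)).continuousWithinAt
      simp [euclBall, normSq]
    · have hx1 : normSq x ∈ Ioc (0:ℝ) 1 := ⟨normSq_pos hx0, normSq_le_of_mem_closure hx⟩
      have hmem : closure (euclBall m) ∩ {0}ᶜ ∈ nhdsWithin x (closure (euclBall m)) :=
        Filter.inter_mem self_mem_nhdsWithin
          (mem_nhdsWithin_of_mem_nhds (isOpen_compl_singleton.mem_nhds hx0))
      refine ContinuousWithinAt.mono_of_mem_nhdsWithin (t := closure (euclBall m) ∩ {0}ᶜ) ?_ hmem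
      exact ((hGc _ hx1).comp continuous_normSq.continuousWithinAt fun z hz =>
        ⟨normSq_pos hz.2, normSq_le_of_mem_closure hz.1⟩).smul
        (padZero m n).continuous.continuousWithinAt
  refine ⟨hC, hcl, ?_,
    integrableOn_of_continuousOn_closure (continuous_normSq.comp_continuousOn hcl), fun x hx => ?_⟩
  · have : IsFiniteMeasure (volume.restrict (euclBall m)) :=
      isFiniteMeasure_restrict.2 (volume_euclBall_ne_top m)
    refine Integrable.of_bound ((continuousOn_gradSq (isOpen_euclBall m) hC).aestronglyMeasurable
      (isOpen_euclBall m).measurableSet) (∑ _ : Fin m, ∑ _ : Fin n, (3 * K) ^ 2) ?_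
    filter_upwards [ae_mem_euclBall_diff_zero hm] with x hx
    rw [Real.norm_of_nonneg]
    · exact gradSq_radialMap_le hmn hG hx
    · rw [gradSq_eq]; positivity
  · rw [radialMap, normSq_eq_one_of_mem_frontier hx, hG1, one_smul]

theorem abs_flux_calibration_le {m n : ℕ} (hmn : m ≤ n) {κ G G1 G2 : ℝ → ℝ} {K M : ℝ}
    (hG : IsRadialProfile m κ G G1 G2 K) {w : (Fin m → ℝ) → Fin n → ℝ} {x : Fin m → ℝ}
    (hx : x ∈ euclBall m \ {0}) (hM : √(normSq (w x)) ≤ M) :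
    |∑ i, x i * calibration G G1 w i x| ≤ (3 * K + M * (2 * K + 1) / 2) * √(normSq (w x)) := by
  have hs := normSq_mem_Ioo hx
  have hr := sqrt_mem_Ioo hs
  have h1 := hG.one_le _ hs
  have h2 := hG.le_bound _ hs
  have h3 := hG.deriv_bound _ hs
  have hsum : ∑ i, x i * calibration G G1 w i x =
      (G (normSq x) + 2 * (normSq x * G1 (normSq x))) * ∑ j, w x j * padZero m n x j
      + 1 / 2 * normSq (w x) * (2 * (normSq x * G1 (normSq x)) / G (normSq x) - 1) := by
    have e1 : ∑ i, x i * ∑ j, w x j * (G (normSq x) * padZero m n (Pi.single i 1) j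
        + 2 * G1 (normSq x) * (x i * padZero m n x j)) =
        (G (normSq x) + 2 * (normSq x * G1 (normSq x))) * ∑ j, w x j * padZero m n x j := by
      simp_rw [Finset.mul_sum]
      rw [Finset.sum_comm]
      refine Finset.sum_congr rfl fun j _ => ?_
      rw [← sum_mul_padZero_single x j]
      have : ∀ i, x i * (w x j * (G (normSq x) * padZero m n (Pi.single i 1) j
          + 2 * G1 (normSq x) * (x i * ∑ i, x i * padZero m n (Pi.single i 1) j)))
          = (w x j * G (normSq x)) * (x i * padZero m n (Pi.single i 1) j)
          + (w x j * (2 * G1 (normSq x)) * ∑ i, x i * padZero m n (Pi.single i 1) j) * x i ^ 2 :=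
        fun i => by ring
      simp_rw [this]
      rw [Finset.sum_add_distrib, ← Finset.mul_sum, ← Finset.mul_sum,
        show ∑ i, x i ^ 2 = normSq x from rfl]
      ring
    have e2 : ∑ i, x i * (1 / 2 * normSq (w x) * ((2 * G1 (normSq x) / G (normSq x)
        - 1 / normSq x) * x i)) =
        1 / 2 * normSq (w x) * (2 * (normSq x * G1 (normSq x)) / G (normSq x) - 1) := by
      have : ∀ i, x i * (1 / 2 * normSq (w x) * ((2 * G1 (normSq x) / G (normSq x)
          - 1 / normSq x) * x i)) = 1 / 2 * normSq (w x) * (2 * G1 (normSq x) / G (normSq x)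
          - 1 / normSq x) * x i ^ 2 := fun i => by ring
      simp_rw [this]
      rw [← Finset.mul_sum, show ∑ i, x i ^ 2 = normSq x from rfl]
      have := hs.1.ne'
      have : G (normSq x) ≠ 0 := by linarith
      field_simp
    simp only [calibration, mul_add, Finset.sum_add_distrib] at e1 ⊢
    rw [← e2, ← e1]
  have hsG : |normSq x * G1 (normSq x)| ≤ K := by
    rw [abs_mul, abs_of_pos hs.1]
    calc normSq x * |G1 (normSq x)| = √(normSq x) * (√(normSq x) * |G1 (normSq x)|) := by
          rw [← mul_assoc, Real.mul_self_sqrt hs.1.le]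
      _ ≤ 1 * K := by gcongr; exact hr.2.le
      _ = K := one_mul K
  have hsGdiv : |normSq x * G1 (normSq x) / G (normSq x)| ≤ K := by
    rw [abs_div, abs_of_pos (by linarith : 0 < G (normSq x))]
    exact (div_le_self (abs_nonneg _) h1).trans hsG
  have hwy : |∑ j, w x j * padZero m n x j| ≤ √(normSq (w x)) := by
    refine (abs_sum_mul_le _ _).trans ?_
    rw [normSq_padZero hmn]
    exact mul_le_of_le_one_right (Real.sqrt_nonneg _) hr.2.le
  have hw2 : normSq (w x) ≤ M * √(normSq (w x)) := by
    rw [← Real.mul_self_sqrt (normSq_nonneg (w x)), Real.sqrt_mul_self (Real.sqrt_nonneg _)]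
    gcongr
  have hw0 := normSq_nonneg (w x)
  rw [hsum]
  refine (abs_add_le _ _).trans ?_
  rw [abs_mul, abs_mul, abs_of_nonneg (by positivity : 0 ≤ 1 / 2 * normSq (w x))]
  have a1 : |G (normSq x) + 2 * (normSq x * G1 (normSq x))| ≤ 3 * K := by
    rw [abs_le] at hsG ⊢; constructor <;> linarith [hsG.1, hsG.2]
  have a2 : |2 * (normSq x * G1 (normSq x)) / G (normSq x) - 1| ≤ 2 * K + 1 := by
    rw [mul_div_assoc]; rw [abs_le] at hsGdiv ⊢; constructor <;> linarith [hsGdiv.1, hsGdiv.2]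
  have hK : 0 ≤ K := by linarith
  have hM0 : 0 ≤ M := (Real.sqrt_nonneg _).trans hM
  calc _ ≤ 3 * K * √(normSq (w x)) + 1 / 2 * (M * √(normSq (w x))) * (2 * K + 1) := by gcongr
    _ = _ := by ring

theorem eqOn_zero_of_normSq_mul_eq_zero {m n : ℕ} {κ G G1 G2 : ℝ → ℝ} {K : ℝ}
    (hG : IsRadialProfile m κ G G1 G2 K) {w : (Fin m → ℝ) → Fin n → ℝ}
    (hw : ContinuousOn w (euclBall m))
    (h : ∀ x ∈ euclBall m \ {0},
      4 * normSq (w x) * (G1 (normSq x) / G (normSq x) + 1 / (2 * normSq x)) = 0) :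
    EqOn w 0 (euclBall m \ {0}) := by
  intro x hx
  by_contra hne
  have hs := normSq_mem_Ioo hx
  have hcont : ContinuousAt (fun t : ℝ => w (t • x)) 1 := by
    refine ContinuousAt.comp (g := w) ?_ (by fun_prop)
    rw [one_smul]
    exact hw.continuousAt ((isOpen_euclBall m).mem_nhds hx.1)
  have hev := hcont.eventually_ne (y := 0) (by rwa [one_smul])
  obtain ⟨δ, hδ, hball⟩ := Metric.eventually_nhds_iff.1 hev
  set a := max (1 - δ) (1 / 2) with ha
  have ha1 : a < 1 := max_lt (by linarith) (by norm_num)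
  have ha0 : 0 < a := lt_max_of_lt_right (by norm_num)
  have hb : a < (a + 1) / 2 := by linarith
  have hb1 : (a + 1) / 2 < 1 := by linarith
  obtain ⟨s, hs', hpos⟩ := hG.exists_logDeriv_pos (a ^ 2 * normSq x) (((a + 1) / 2) ^ 2 * normSq x)
    (by have := hs.1; positivity) (by have := hs.1; gcongr)
    (by nlinarith [hs.1, hs.2, pow_lt_one₀ (by linarith : 0 ≤ (a + 1) / 2) hb1 two_ne_zero])
  have hsp : 0 < s := lt_trans (by have := hs.1; positivity) hs'.1
  set t := √(s / normSq x) with ht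
  have ht2 : t ^ 2 = s / normSq x := Real.sq_sqrt (div_nonneg hsp.le hs.1.le)
  have hta : a < t := Real.lt_sqrt_of_sq_lt (by rw [lt_div_iff₀ hs.1]; exact hs'.1)
  have htb : t < (a + 1) / 2 := by
    rw [ht, Real.sqrt_lt' (by linarith), div_lt_iff₀ hs.1]; exact hs'.2
  have hnt : normSq (t • x) = s := by
    rw [normSq_smul, ht2, div_mul_cancel₀ _ hs.1.ne']
  have hwt : w (t • x) ≠ 0 := by
    refine hball ?_
    rw [Real.dist_eq, abs_lt]
    constructor <;> linarith [le_max_left (1 - δ) (1 / 2 : ℝ)]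
  have hs1 : s < 1 := by
    nlinarith [hs.1, hs.2, hs'.2, pow_lt_one₀ (by linarith : 0 ≤ (a + 1) / 2) hb1 two_ne_zero]
  have hmem : t • x ∈ euclBall m \ {0} :=
    ⟨by rw [euclBall, mem_ofPred_eq, hnt]; exact hs1,
      smul_ne_zero (by linarith) hx.2⟩
  have := h _ hmem
  rw [hnt] at this
  have hp := normSq_pos hwt
  exact (by positivity : 4 * normSq (w (t • x)) * (G1 s / G s + 1 / (2 * s)) ≠ 0) this

theorem radialMap_energy_le {m n : ℕ} (hm : 7 ≤ m) (hmn : m ≤ n) {κ G G1 G2 W : ℝ → ℝ} {K ε : ℝ}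
    (hε : 0 < ε) (hG : IsRadialProfile m κ G G1 G2 K) (hGc : ContinuousOn G (Ioc 0 1))
    (hG1 : G 1 = 1) (hWc : ContinuousOn W (Iic 1))
    (hWκ : ∀ s ∈ Ioo (0:ℝ) 1, ∀ b ≤ 1,
      W (1 - s * G s ^ 2) + ε ^ 2 * κ s * (b - (1 - s * G s ^ 2)) ≤ W b)
    {v : (Fin m → ℝ) → Fin n → ℝ} (hv : Admissible (euclBall m) (padZero m n) v) :
    GLenergy W ε (euclBall m) (radialMap n G) ≤ GLenergy W ε (euclBall m) v ∧
      (GLenergy W ε (euclBall m) v ≤ GLenergy W ε (euclBall m) (radialMap n G) →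
        EqOn v (radialMap n G) (closure (euclBall m))) := by
  have hm0 : m ≠ 0 := by omega
  have hu := admissible_radialMap hm0 hmn hG hGc hG1
  set u := radialMap (m := m) n G with hu_def
  set w := fun x => v x - u x with hw_def
  have h_int : ∀ z : (Fin m → ℝ) → Fin n → ℝ, Admissible (euclBall m) (padZero m n) z →
      IntegrableOn (fun x => gradSq z x / 2 + W (1 - normSq (z x)) / (2 * ε ^ 2))
        (euclBall m) := fun z hz =>
    (hz.2.2.1.div_const 2).add (integrableOn_of_continuousOn_closure
      ((hWc.comp (continuousOn_const.sub (continuous_normSq.comp_continuousOn hz.2.1))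
        fun x _ => sub_le_self 1 (normSq_nonneg (z x))).div_const _))
  have hwc : ContinuousOn w (closure (euclBall m)) := hv.2.1.sub hu.2.1
  have hwC : ContDiffOn ℝ 1 w (euclBall m \ {0}) := (hv.1.sub hu.1).mono sdiff_subset
  have hωc : ContinuousOn (fun x => √(normSq (w x))) (closure (euclBall m)) :=
    (continuous_normSq.comp_continuousOn hwc).sqrt
  obtain ⟨M, hM⟩ := (isCompact_closure_euclBall m).exists_bound_of_continuousOn hωc
  replace hM : ∀ x ∈ closure (euclBall m), √(normSq (w x)) ≤ M := fun x hx =>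
    (le_abs_self _).trans (hM x hx)
  have hK : 0 ≤ K := by
    have h : (1 / 2 : ℝ) ∈ Ioo (0:ℝ) 1 := by norm_num
    linarith [hG.one_le _ h, hG.le_bound _ h]
  have hM0 : 0 ≤ M := (Real.sqrt_nonneg _).trans
    (hM 0 (subset_closure (by simp [euclBall, normSq])))
  have key := integral_nonneg_of_divergence_le (m := m) (by omega)
    (X := calibration G G1 w)
    (D := fun x => (gradSq v x / 2 + W (1 - normSq (v x)) / (2 * ε ^ 2))
      - (gradSq u x / 2 + W (1 - normSq (u x)) / (2 * ε ^ 2)))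
    (F := fun x => 4 * normSq (w x) * (G1 (normSq x) / G (normSq x) + 1 / (2 * normSq x)))
    (ω := fun x => (3 * K + M * (2 * K + 1) / 2) * √(normSq (w x)))
    (contDiffOn_calibration hG hwC) ((h_int v hv).sub (h_int u hu))
    ?_ ?_ (continuousOn_const.mul hωc) (fun x => by positivity) ?_ ?_ ?_
  · obtain ⟨hnonneg, hzero⟩ := key
    rw [integral_sub (h_int v hv) (h_int u hu), sub_nonneg] at hnonneg
    rw [integral_sub (h_int v hv) (h_int u hu), sub_nonpos] at hzero
    refine ⟨hnonneg, fun hle => ?_⟩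
    have hz := eqOn_zero_of_normSq_mul_eq_zero hG (hwc.mono subset_closure) (hzero hle)
    have : Nonempty (Fin m) := ⟨⟨0, by omega⟩⟩
    refine EqOn.of_subset_closure (s := euclBall m \ {0}) (fun x hx => ?_) hv.2.1 hu.2.1
      (sdiff_subset.trans subset_closure) ?_
    · exact sub_eq_zero.1 (hz hx)
    · exact closure_minimal ((dense_compl_singleton 0).open_subset_closure_inter
        (isOpen_euclBall m)) isClosed_closure
  · have hs : ContinuousOn (fun x : Fin m → ℝ => normSq x) (euclBall m \ {0}) :=
      continuous_normSq.continuousOn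
    refine (continuousOn_const.mul (continuous_normSq.comp_continuousOn hwC.continuousOn)).mul
      ((hG.contDiffOn_deriv.comp_normSq.continuousOn.div hG.contDiffOn.comp_normSq.continuousOn
        ?_).add (continuousOn_const.div (continuousOn_const.mul hs) ?_))
    · exact fun x hx => (zero_lt_one.trans_le (hG.one_le _ (normSq_mem_Ioo hx))).ne'
    · exact fun x hx => mul_ne_zero two_ne_zero (normSq_mem_Ioo hx).1.ne'
  · exact fun x hx => mul_nonneg (mul_nonneg zero_le_four (normSq_nonneg _))
      (hG.logDeriv_nonneg _ (normSq_mem_Ioo hx))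
  · intro x hx
    have : w x = 0 := by rw [hw_def]; simp only; rw [hv.2.2.2.2 hx, hu.2.2.2.2 hx, sub_self]
    simp [this, normSq]
  · intro x hx
    have hs := normSq_mem_Ioo hx
    have hO := (isOpen_euclBall m).mem_nhds hx.1
    have hdv : DifferentiableAt ℝ v x := (hv.1.contDiffAt hO).differentiableAt one_ne_zero
    have hdu : DifferentiableAt ℝ u x := (hu.1.contDiffAt hO).differentiableAt one_ne_zero
    have hdw : fderiv ℝ w x = fderiv ℝ v x - fderiv ℝ u x := fderiv_fun_sub hdv hdu
    have hvx : v x = u x + w x := by simp [hw_def]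
    have hnv : normSq (v x) = normSq x * G (normSq x) ^ 2
        + (2 * G (normSq x) * ∑ j, w x j * padZero m n x j + normSq (w x)) := by
      rw [← normSq_radialMap hmn G x, ← hu_def, hvx, Finset.mul_sum]
      rw [show normSq (u x + w x) = ∑ j, (u x j + w x j) ^ 2 from rfl,
        show normSq (u x) = ∑ j, u x j ^ 2 from rfl, show normSq (w x) = ∑ j, w x j ^ 2 from rfl,
        ← Finset.sum_add_distrib, ← Finset.sum_add_distrib]
      refine Finset.sum_congr rfl fun j _ => ?_
      rw [show u x j = G (normSq x) * padZero m n x j from rfl]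
      ring
    have hW : -(κ (normSq x) / 2) * (2 * G (normSq x) * ∑ j, w x j * padZero m n x j
        + normSq (w x))
        ≤ W (1 - normSq (v x)) / (2 * ε ^ 2) - W (1 - normSq (u x)) / (2 * ε ^ 2) := by
      have h1 := hWκ _ hs (1 - normSq (v x)) (sub_le_self 1 (normSq_nonneg (v x)))
      rw [hu_def, normSq_radialMap hmn, ← sub_div, le_div_iff₀ (by positivity)]
      have h2 : 1 - normSq (v x) - (1 - normSq x * G (normSq x) ^ 2) =
        -(2 * G (normSq x) * ∑ j, w x j * padZero m n x j + normSq (w x)) := by rw [hnv]; ring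
      rw [h2] at h1
      linarith
    have hdiv := divergence_le hm (x := x) (y := padZero m n x) (w := w x) (s := normSq x)
      (a := fun i j => fderiv ℝ w x (Pi.single i 1) j)
      (b := fun i j => padZero m n (Pi.single i 1) j)
      (p := fun i j => G (normSq x) * padZero m n (Pi.single i 1) j
        + 2 * G1 (normSq x) * (x i * padZero m n x j))
      (sum_mul_padZero_single x) rfl hs.1 (zero_lt_one.trans_le (hG.one_le _ hs)) (hG.ode _ hs) hW
    simp_rw [fderiv_calibration hG hwC hx]
    refine hdiv.trans (le_of_eq ?_)
    simp_rw [gradSq_eq, ← fderiv_radialMap_single hG hx, ← hu_def, hdw]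
    simp only [sub_apply, Pi.sub_apply, add_sub_cancel]
    ring
  · exact fun x hx => abs_flux_calibration_le hmn hG hx (hM x (subset_closure hx.1))

/-- Theorem 1.6: for `n > m ≥ 7` and the equator boundary data
`u_bd(x) = (x, 0)`, the radial map `u_ε(x) = (h_ε(|x|) x/|x|, 0)` is, for every `ε > 0`,
the unique minimiser of `E_ε` over `𝒜` on the unit ball. -/
theorem statement_9 {m n : ℕ} (hm : 7 ≤ m) (hmn : m < n)
    (W : ℝ → ℝ) (hW : ContDiffOn ℝ 1 W (Iic (1:ℝ))) (hW0 : W 0 = 0)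
    (hWpos : ∀ t ∈ Iic (1:ℝ), t ≠ 0 → 0 < W t)
    (hWconv : StrictConvexOn ℝ (Iic (1:ℝ)) W)
    (Ω : Set (Fin m → ℝ)) (hΩ : Ω = {x : Fin m → ℝ | normSq x < 1})
    (ubd : (Fin m → ℝ) → Fin n → ℝ)
    (hubd : ∀ (x : Fin m → ℝ) (j : Fin n),
      ubd x j = if hj : (j : ℕ) < m then x ⟨(j : ℕ), hj⟩ else 0)
    (ε : ℝ) (hε : 0 < ε)
    (h : ℝ → ℝ) (hcont : ContinuousOn h (Icc 0 1)) (hC2 : ContDiffOn ℝ 2 h (Ioo 0 1))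
    (hode : ∀ r ∈ Ioo (0:ℝ) 1,
      -deriv (deriv h) r - ((m : ℝ) - 1) / r * deriv h r + ((m : ℝ) - 1) / r ^ 2 * h r
        = 1 / ε ^ 2 * h r * Wd W (1 - h r ^ 2))
    (h0 : h 0 = 0) (h1 : h 1 = 1)
    (hmono : StrictMonoOn h (Icc 0 1)) (hpos : ∀ r ∈ Ioo (0:ℝ) 1, 0 < h r)
    (uε : (Fin m → ℝ) → Fin n → ℝ)
    (huε : ∀ (x : Fin m → ℝ) (j : Fin n),
      uε x j = if hj : (j : ℕ) < m then
        h (Real.sqrt (normSq x)) * x ⟨(j : ℕ), hj⟩ / Real.sqrt (normSq x) else 0) :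
    IsMinimiser W ε Ω ubd uε ∧
    ∀ v, IsMinimiser W ε Ω ubd v → EqOn v uε (closure Ω) := by
  have hmn' : m ≤ n := hmn.le
  obtain rfl : Ω = euclBall m := hΩ
  obtain rfl : ubd = padZero m n := funext fun x => funext fun j => hubd x j
  obtain rfl : uε = radialMap n (fun s => h √s / √s) := by
    funext x j
    rw [huε, radialMap, Pi.smul_apply, padZero_apply, smul_eq_mul]
    split_ifs
    · ring
    · rw [mul_zero]
  obtain ⟨⟨K, hK, hWd⟩, htan⟩ := Wd_properties hW hW0 hWpos hWconv.convexOn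
  have hh : ∀ r ∈ Ioo (0:ℝ) 1, 1 - h r ^ 2 ∈ Ioo (0:ℝ) 1 := fun r hr => by
    have hr1 : h r < 1 :=
      h1 ▸ hmono (Ioo_subset_Icc_self hr) (right_mem_Icc.2 zero_le_one) hr.2
    have hr0 := hpos r hr
    constructor <;> nlinarith
  have hdh : ContDiffOn ℝ 1 (deriv h) (Ioo 0 1) :=
    ((contDiffOn_succ_iff_deriv_of_isOpen (n := 1) isOpen_Ioo).1 hC2).2.2
  have hprof := isRadialProfile_of_ode (m := m) (by omega) (h := h) (h1 := deriv h)
    (h2 := deriv (deriv h)) (κ := fun r => 1 / ε ^ 2 * Wd W (1 - h r ^ 2)) (K := 1 / ε ^ 2 * K)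
    (by positivity) hcont
    (fun r hr => ((hC2.contDiffAt (isOpen_Ioo.mem_nhds hr)).differentiableAt
      two_ne_zero).hasDerivAt)
    (fun r hr => ((hdh.contDiffAt (isOpen_Ioo.mem_nhds hr)).differentiableAt
      one_ne_zero).hasDerivAt)
    (hdh.continuousOn_deriv_of_isOpen isOpen_Ioo le_rfl) hpos h1 hmono
    (fun r hr => ⟨mul_nonneg (by positivity) (hWd _ (hh r hr)).1,
      mul_le_mul_of_nonneg_left (hWd _ (hh r hr)).2 (by positivity)⟩)
    (fun r hr => by rw [hode r hr]; ring)
  have hGc : ContinuousOn (fun s => h √s / √s) (Ioc 0 1) := by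
    refine (hcont.comp Real.continuous_sqrt.continuousOn fun s hs => ?_).div
      Real.continuous_sqrt.continuousOn fun s hs => (Real.sqrt_pos.2 hs.1).ne'
    exact ⟨Real.sqrt_nonneg s, Real.sqrt_le_one.2 hs.2⟩
  have hWκ : ∀ s ∈ Ioo (0:ℝ) 1, ∀ b ≤ 1, W (1 - s * (h √s / √s) ^ 2)
      + ε ^ 2 * (1 / ε ^ 2 * Wd W (1 - h √s ^ 2)) * (b - (1 - s * (h √s / √s) ^ 2)) ≤ W b := by
    intro s hs b hb
    have e : s * (h √s / √s) ^ 2 = h √s ^ 2 := by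
      rw [div_pow, Real.sq_sqrt hs.1.le, mul_div_cancel₀ _ hs.1.ne']
    rw [e, ← mul_assoc, mul_one_div_cancel (by positivity), one_mul]
    exact htan _ (hh _ (sqrt_mem_Ioo hs)) b hb
  have hcomp := fun v hv => radialMap_energy_le (v := v) hm hmn' hε hprof hGc (by simp [h1])
    hW.continuousOn hWκ hv
  have hadm := admissible_radialMap (by omega) hmn' hprof hGc (by simp [h1])
  exact ⟨⟨hadm, fun v hv => (hcomp v hv).1⟩, fun v hv => (hcomp v hv.1).2 (hv.2 _ hadm)⟩
end
end

section
/- Let W ∈ C¹((−∞,1],ℝ) satisfy W(0)=0, W(t)>0 for all t ∈ (−∞,1]\{0}, and W strictly convex. For each k ∈ ℤ\{0}, let ε_k > 0 be the critical value such that the radial ODE system −f'' − (1/r) f' + (k²/r²) f = (1/ε²) f W'(1 − f² − g²), −g'' − (1/r) g' = (1/ε²) g W'(1 − f² − g²) on (0,1) with f(0)=0, f(1)=1, g'(0)=0, g(1)=0 admits a solution with g > 0 on (0,1) if and only if ε ∈ (0, ε_k). Then ε_k = ε_{−k} for every k ≥ 1, and the sequence (ε_k)_{k≥1} is strictly increasing.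 -/
open MeasureTheory Set Bornology

noncomputable section

/-- The radial ODE system \eqref{syst:ode}-\eqref{syst:bc} for the profiles `(f, g)`. -/
def SolvesSystem (W : ℝ → ℝ) (ε : ℝ) (k : ℤ) (f g : ℝ → ℝ) : Prop :=
  ContinuousOn f (Icc 0 1) ∧ ContinuousOn g (Icc 0 1) ∧
  ContDiffOn ℝ 2 f (Ioo 0 1) ∧ ContDiffOn ℝ 2 g (Ioo 0 1) ∧
  (∀ r ∈ Ioo (0:ℝ) 1,
    -deriv (deriv f) r - 1 / r * deriv f r + (k : ℝ) ^ 2 / r ^ 2 * f r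
      = 1 / ε ^ 2 * f r * Wd W (1 - f r ^ 2 - g r ^ 2)) ∧
  (∀ r ∈ Ioo (0:ℝ) 1,
    -deriv (deriv g) r - 1 / r * deriv g r
      = 1 / ε ^ 2 * g r * Wd W (1 - f r ^ 2 - g r ^ 2)) ∧
  f 0 = 0 ∧ f 1 = 1 ∧ derivWithin g (Icc 0 1) 0 = 0 ∧ g 1 = 0

namespace RadialProfile

open Filter Topology

/-- `p = r y'` and `H = (r y')'` on `(0, 1)`, so that `H = r Δy` for the radial Laplacian in the
unit disc. -/
def IsRadial (y p H : ℝ → ℝ) : Prop :=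
  ∀ r ∈ Ioo (0:ℝ) 1, HasDerivAt y (p r / r) r ∧ HasDerivAt p (H r) r

section Basic

variable {y p H z q K : ℝ → ℝ}

lemma IsRadial.add (hy : IsRadial y p H) (hz : IsRadial z q K) :
    IsRadial (fun r => y r + z r) (fun r => p r + q r) (fun r => H r + K r) := fun r hr =>
  ⟨((hy r hr).1.add (hz r hr).1).congr_deriv (add_div _ _ _).symm, (hy r hr).2.add (hz r hr).2⟩

lemma IsRadial.const_mul (c : ℝ) (hy : IsRadial y p H) :
    IsRadial (fun r => c * y r) (fun r => c * p r) (fun r => c * H r) := fun r hr =>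
  ⟨by simpa [mul_div_assoc] using (hy r hr).1.const_mul c, (hy r hr).2.const_mul c⟩

lemma IsRadial.neg (hy : IsRadial y p H) :
    IsRadial (fun r => -y r) (fun r => -p r) (fun r => -H r) := fun r hr =>
  ⟨(hy r hr).1.neg.congr_deriv (neg_div _ _).symm, (hy r hr).2.neg⟩

lemma IsRadial.sub (hy : IsRadial y p H) (hz : IsRadial z q K) :
    IsRadial (fun r => y r - z r) (fun r => p r - q r) (fun r => H r - K r) := by
  simpa [sub_eq_add_neg] using hy.add hz.neg

lemma IsRadial.congr_right (hy : IsRadial y p H) (h : ∀ r ∈ Ioo (0:ℝ) 1, H r = K r) :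
    IsRadial y p K := fun r hr => ⟨(hy r hr).1, h r hr ▸ (hy r hr).2⟩

lemma IsRadial.sq (hy : IsRadial y p H) :
    IsRadial (fun r => y r ^ 2) (fun r => 2 * (y r * p r))
      (fun r => 2 * (p r ^ 2 / r + y r * H r)) := by
  intro r hr
  have h := hy r hr
  have hr0 : r ≠ 0 := hr.1.ne'
  constructor
  · refine (h.1.pow 2).congr_deriv ?_
    field_simp
    push_cast
    ring
  · refine ((h.1.mul h.2).const_mul 2).congr_deriv ?_
    field_simp

lemma isRadial_log : IsRadial Real.log (fun _ => 1) (fun _ => 0) := fun r hr =>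
  ⟨by simpa using Real.hasDerivAt_log hr.1.ne', hasDerivAt_const r 1⟩

lemma isRadial_quadratic (A B : ℝ) :
    IsRadial (fun r => A * r - B * r ^ 2) (fun r => A * r - 2 * B * r ^ 2)
      (fun r => A - 4 * B * r) := by
  intro r hr
  have hr0 : r ≠ 0 := hr.1.ne'
  constructor
  · refine (((hasDerivAt_id r).const_mul A).sub
      ((hasDerivAt_pow 2 r).const_mul B)).congr_deriv ?_
    field_simp
    push_cast
    ring
  · refine (((hasDerivAt_id r).const_mul A).sub
      ((hasDerivAt_pow 2 r).const_mul (2 * B))).congr_deriv ?_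
    push_cast
    ring

lemma IsRadial.comp_mul (hy : IsRadial y p H) {s : ℝ} (hs : 0 < s) (hs1 : s ≤ 1) :
    IsRadial (fun r => y (s * r)) (fun r => p (s * r)) (fun r => s * H (s * r)) := by
  intro r hr
  have hr0 : r ≠ 0 := hr.1.ne'
  have hsr : s * r ∈ Ioo (0:ℝ) 1 := ⟨mul_pos hs hr.1, by nlinarith [hr.1, hr.2]⟩
  have hl : HasDerivAt (fun x : ℝ => s * x) s r := by
    simpa using (hasDerivAt_id r).const_mul s
  constructor
  · refine ((hy _ hsr).1.comp r hl).congr_deriv ?_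
    field_simp
  · exact ((hy _ hsr).2.comp r hl).congr_deriv (mul_comm _ _)

lemma IsRadial.right_nonpos_of_isLocalMax (hy : IsRadial y p H) {r : ℝ} (hr : r ∈ Ioo (0:ℝ) 1)
    (hm : IsLocalMax y r) : H r ≤ 0 := by
  by_contra! hH
  have hp : p r = 0 := by
    have := hm.hasDerivAt_eq_zero (hy r hr).1
    rcases div_eq_zero_iff.1 this with h | h
    · exact h
    · exact absurd h hr.1.ne'
  have h1 : ∀ᶠ x in 𝓝[>] r, 0 < p x := by
    have := (hasDerivAt_iff_tendsto_slope.1 (hy r hr).2).eventually (lt_mem_nhds hH)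
    have := this.filter_mono (nhdsWithin_mono r (fun x (hx : r < x) => hx.ne'))
    filter_upwards [this, self_mem_nhdsWithin] with x hx (hrx : r < x)
    rw [slope_def_field, hp, sub_zero] at hx
    exact (div_pos_iff_of_pos_right (sub_pos.2 hrx)).1 hx
  have h2 : ∀ᶠ x in 𝓝[>] r, x < 1 := (gt_mem_nhds hr.2).filter_mono nhdsWithin_le_nhds
  have h3 : ∀ᶠ x in 𝓝[>] r, y x ≤ y r := hm.filter_mono nhdsWithin_le_nhds
  obtain ⟨b, hb, hb'⟩ := mem_nhdsGT_iff_exists_Ioc_subset.1 (h1.and (h2.and h3))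
  have hmem : ∀ x ∈ Icc r b, x ∈ Ioo (0:ℝ) 1 := fun x hx =>
    ⟨hr.1.trans_le hx.1, hx.2.trans_lt (hb' ⟨hb, le_rfl⟩).2.1⟩
  have hmono : StrictMonoOn y (Icc r b) := by
    refine strictMonoOn_of_deriv_pos (convex_Icc r b)
      (fun x hx => (hy x (hmem x hx)).1.continuousAt.continuousWithinAt) fun x hx => ?_
    rw [interior_Icc] at hx
    have hx01 := hmem x (Ioo_subset_Icc_self hx)
    rw [(hy x hx01).1.deriv]
    exact div_pos (hb' ⟨hx.1, hx.2.le⟩).1 hx01.1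
  exact absurd (hb' ⟨hb, le_rfl⟩).2.2 (not_le.2 (hmono ⟨le_rfl, hb.le⟩ ⟨hb.le, le_rfl⟩ hb))

/-- Weak maximum principle on a subinterval of `[0, 1]`. -/
lemma IsRadial.exists_right_nonpos (hy : IsRadial y p H) {a b c : ℝ} (ha : 0 ≤ a) (hb : b ≤ 1)
    (hc : ContinuousOn y (Icc a b)) (hya : y a ≤ c) (hyb : y b ≤ c)
    {x : ℝ} (hx : x ∈ Icc a b) (hcx : c < y x) :
    ∃ m ∈ Ioo a b, c < y m ∧ H m ≤ 0 := by
  obtain ⟨m, hm, hmax⟩ := isCompact_Icc.exists_isMaxOn ⟨x, hx⟩ hc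
  have hcm : c < y m := hcx.trans_le (hmax hx)
  have hmI : m ∈ Ioo a b := by
    refine ⟨lt_of_le_of_ne hm.1 ?_, lt_of_le_of_ne hm.2 ?_⟩
    · rintro rfl; exact absurd hya (not_le.2 hcm)
    · rintro rfl; exact absurd hyb (not_le.2 hcm)
  exact ⟨m, hmI, hcm, hy.right_nonpos_of_isLocalMax ⟨ha.trans_lt hmI.1, hmI.2.trans_le hb⟩
    (hmax.isLocalMax (Icc_mem_nhds hmI.1 hmI.2))⟩

/-- Comparison of a subsolution `y` with a positive supersolution `z`. -/
lemma IsRadial.le_of_wronskian_pos (hy : IsRadial y p H) (hz : IsRadial z q K)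
    (hyc : ContinuousOn y (Icc 0 1)) (hzc : ContinuousOn z (Icc 0 1))
    (hzpos : ∀ r ∈ Ico (0:ℝ) 1, 0 < z r) (h0 : y 0 < z 0) (h1 : y 1 < z 1)
    (hW : ∀ r ∈ Ioo (0:ℝ) 1, z r < y r → 0 < H r * z r - K r * y r) :
    ∀ r ∈ Icc (0:ℝ) 1, y r ≤ z r := by
  intro r hr
  by_contra! hlt
  have hr1 : r < 1 := lt_of_le_of_ne hr.2 (by rintro rfl; exact absurd h1 (not_lt.2 hlt.le))
  obtain ⟨b, hrb, hb1, hyb⟩ : ∃ b, r < b ∧ b < 1 ∧ y b < z b := by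
    have hl : ∀ᶠ x in 𝓝[<] (1:ℝ), y x < z x := by
      have hle : 𝓝[<] (1:ℝ) ≤ 𝓝[Icc 0 1] 1 := by
        rw [← nhdsWithin_Ioo_eq_nhdsLT (zero_lt_one' ℝ)]
        exact nhdsWithin_mono _ Ioo_subset_Icc_self
      exact (((hyc 1 (by simp)).mono_left hle).eventually_lt ((hzc 1 (by simp)).mono_left hle) h1)
    obtain ⟨b, hb⟩ := (hl.and (Ioo_mem_nhdsLT hr1)).exists
    exact ⟨b, hb.2.1, hb.2.2, hb.1⟩
  have hsub : Icc 0 b ⊆ Icc (0:ℝ) 1 := Icc_subset_Icc_right hb1.le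
  have hzb : ∀ x ∈ Icc 0 b, 0 < z x := fun x hx => hzpos x ⟨hx.1, hx.2.trans_lt hb1⟩
  obtain ⟨m, hm, hmax⟩ := isCompact_Icc.exists_isMaxOn (f := fun x => y x / z x)
    ⟨r, hr.1, hrb.le⟩ ((hyc.mono hsub).div (hzc.mono hsub) fun x hx => (hzb x hx).ne')
  have hzm := hzb m hm
  have hm1 : z m < y m := by
    have h : y r / z r ≤ y m / z m := hmax (show r ∈ Icc 0 b from ⟨hr.1, hrb.le⟩)
    have h' : 1 < y r / z r := (one_lt_div (hzb r ⟨hr.1, hrb.le⟩)).2 hlt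
    exact (one_lt_div hzm).1 (h'.trans_le h)
  have hm0 : 0 < m := lt_of_le_of_ne hm.1 (by rintro rfl; exact absurd h0 (not_lt.2 hm1.le))
  have hmb : m < b := lt_of_le_of_ne hm.2 (by rintro rfl; exact absurd hyb (not_lt.2 hm1.le))
  have hmI : m ∈ Ioo (0:ℝ) 1 := ⟨hm0, hmb.trans hb1⟩
  have hloc : IsLocalMax (fun x => y x - y m / z m * z x) m := by
    filter_upwards [Icc_mem_nhds hm0 hmb] with x hx
    have h : y x / z x ≤ y m / z m := hmax hx
    rw [div_le_iff₀ (hzb x hx)] at h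
    rw [div_mul_cancel₀ _ hzm.ne']
    linarith
  have hle := (hy.sub (hz.const_mul (y m / z m))).right_nonpos_of_isLocalMax hmI hloc
  have hpos := hW m hmI hm1
  have : H m * z m - K m * y m = (H m - y m / z m * K m) * z m := by
    field_simp
  nlinarith

lemma IsRadial.momentum_le (hy : IsRadial y p H) {C B : ℝ} (hC : 0 ≤ C)
    (hH : ∀ r ∈ Ioo (0:ℝ) 1, H r ≤ C) (hB : ∀ r ∈ Ioo (0:ℝ) 1, |y r| ≤ B) :
    ∀ r ∈ Ioo (0:ℝ) 1, p r ≤ C * r := by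
  intro r₀ hr₀
  by_contra! hlt
  set η := p r₀ - C * r₀ with hη
  have hη0 : 0 < η := by linarith
  have hmem : ∀ x ∈ Ioc 0 r₀, x ∈ Ioo (0:ℝ) 1 := fun x hx => ⟨hx.1, hx.2.trans_lt hr₀.2⟩
  have hB0 : 0 ≤ B := (abs_nonneg _).trans (hB r₀ hr₀)
  have hanti : AntitoneOn (fun x => p x - C * x) (Ioc 0 r₀) := by
    have hd : ∀ x ∈ Ioc 0 r₀, HasDerivAt (fun x => p x - C * x) (H x - C) x := fun x hx =>
      ((hy x (hmem x hx)).2.sub ((hasDerivAt_id x).const_mul C)).congr_deriv (by simp)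
    refine antitoneOn_of_deriv_nonpos (convex_Ioc 0 r₀)
      (fun x hx => (hd x hx).continuousAt.continuousWithinAt)
      (fun x hx => (hd x (interior_subset hx)).differentiableAt.differentiableWithinAt)
      fun x hx => ?_
    rw [(hd x (interior_subset hx)).deriv]
    linarith [hH x (hmem x (interior_subset hx))]
  have hq : ∀ x ∈ Ioc 0 r₀, η ≤ p x := fun x hx => by
    have := hanti hx ⟨hr₀.1, le_rfl⟩ hx.2
    simp only at this
    linarith [mul_nonneg hC hx.1.le]
  have hmono : MonotoneOn (fun x => y x - η * Real.log x) (Ioc 0 r₀) := by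
    have hd : ∀ x ∈ Ioc 0 r₀, HasDerivAt (fun x => y x - η * Real.log x) ((p x - η) / x) x :=
      fun x hx => ((hy x (hmem x hx)).1.sub
        ((Real.hasDerivAt_log hx.1.ne').const_mul η)).congr_deriv (by ring)
    refine monotoneOn_of_deriv_nonneg (convex_Ioc 0 r₀)
      (fun x hx => (hd x hx).continuousAt.continuousWithinAt)
      (fun x hx => (hd x (interior_subset hx)).differentiableAt.differentiableWithinAt)
      fun x hx => ?_
    have hx' := interior_subset hx
    rw [(hd x hx').deriv]
    exact div_nonneg (sub_nonneg.2 (hq x hx')) hx'.1.le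
  set s := r₀ * Real.exp (-((2 * B + 1) / η)) with hs
  have hs0 : 0 < s := mul_pos hr₀.1 (Real.exp_pos _)
  have hsr : s ≤ r₀ := mul_le_of_le_one_right hr₀.1.le
    (Real.exp_le_one_iff.2 (neg_nonpos.2 (by positivity)))
  have hlog : η * Real.log s = η * Real.log r₀ - (2 * B + 1) := by
    rw [hs, Real.log_mul hr₀.1.ne' (Real.exp_pos _).ne', Real.log_exp]
    field_simp
    ring
  have h := hmono ⟨hs0, hsr⟩ ⟨hr₀.1, le_rfl⟩ hsr
  simp only [hlog] at h
  have h1 := (abs_le.1 (hB s (hmem s ⟨hs0, hsr⟩))).1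
  have h2 := (abs_le.1 (hB r₀ hr₀)).2
  linarith

lemma IsRadial.abs_momentum_le (hy : IsRadial y p H) {C B : ℝ} (hC : 0 ≤ C)
    (hH : ∀ r ∈ Ioo (0:ℝ) 1, |H r| ≤ C) (hB : ∀ r ∈ Ioo (0:ℝ) 1, |y r| ≤ B) :
    ∀ r ∈ Ioo (0:ℝ) 1, |p r| ≤ C * r := fun r hr =>
  abs_le'.2 ⟨hy.momentum_le hC (fun x hx => (abs_le'.1 (hH x hx)).1) hB r hr,
    hy.neg.momentum_le hC (fun x hx => (abs_le'.1 (hH x hx)).2)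
      (fun x hx => by simpa using hB x hx) r hr⟩

lemma IsRadial.dist_le (hy : IsRadial y p H) (hyc : ContinuousOn y (Icc 0 1)) {C : ℝ}
    (hp : ∀ r ∈ Ioo (0:ℝ) 1, |p r| ≤ C * r) :
    ∀ a ∈ Icc (0:ℝ) 1, ∀ b ∈ Icc (0:ℝ) 1, |y a - y b| ≤ C * |a - b| := by
  have key : ∀ a ∈ Icc (0:ℝ) 1, ∀ b ∈ Icc (0:ℝ) 1, a < b → |y a - y b| ≤ C * |a - b| := by
    intro a ha b hb hab
    obtain ⟨c, hc, hc'⟩ := exists_hasDerivAt_eq_slope y (fun r => p r / r) hab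
      (hyc.mono (Icc_subset_Icc ha.1 hb.2))
      (fun x hx => (hy x ⟨ha.1.trans_lt hx.1, hx.2.trans_le hb.2⟩).1)
    have hc01 : c ∈ Ioo (0:ℝ) 1 := ⟨ha.1.trans_lt hc.1, hc.2.trans_le hb.2⟩
    rw [eq_div_iff (sub_pos.2 hab).ne'] at hc'
    rw [abs_sub_comm, abs_sub_comm a b, ← hc', abs_mul]
    refine mul_le_mul_of_nonneg_right ?_ (abs_nonneg _)
    rw [abs_div, abs_of_pos hc01.1, div_le_iff₀ hc01.1]
    exact hp c hc01
  intro a ha b hb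
  rcases lt_trichotomy a b with h | rfl | h
  · exact key a ha b hb h
  · simp
  · rw [abs_sub_comm, abs_sub_comm a b]
    exact key b hb a ha h

lemma IsRadial.antitoneOn (hy : IsRadial y p H) (hyc : ContinuousOn y (Icc 0 1))
    (hp : ∀ r ∈ Ioo (0:ℝ) 1, p r ≤ 0) : AntitoneOn y (Icc 0 1) := by
  refine antitoneOn_of_deriv_nonpos (convex_Icc 0 1) hyc ?_ ?_ <;> rw [interior_Icc]
  · exact fun x hx => (hy x hx).1.differentiableAt.differentiableWithinAt
  · exact fun x hx => (hy x hx).1.deriv ▸ div_nonpos_of_nonpos_of_nonneg (hp x hx) hx.1.le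

lemma isRadial_of_contDiffOn (hy : ContDiffOn ℝ 2 y (Ioo 0 1)) :
    IsRadial y (fun r => r * deriv y r) (fun r => r * deriv (deriv y) r + deriv y r) := by
  intro r hr
  have hd : ContDiffOn ℝ 1 (deriv y) (Ioo 0 1) :=
    ((contDiffOn_succ_iff_deriv_of_isOpen (n := 1) isOpen_Ioo).1 hy).2.2
  have hnhds := isOpen_Ioo.mem_nhds hr
  constructor
  · refine (((hy.differentiableOn (by norm_num)) r hr).differentiableAt hnhds).hasDerivAt.congr_deriv
      ?_
    field_simp [hr.1.ne']
  · refine ((hasDerivAt_id r).mul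
      (((hd.differentiableOn (by norm_num)) r hr).differentiableAt hnhds).hasDerivAt).congr_deriv ?_
    simp only [id]
    ring

lemma IsRadial.deriv_eq (hy : IsRadial y p H) {r : ℝ} (hr : r ∈ Ioo (0:ℝ) 1) :
    deriv y r = p r / r := (hy r hr).1.deriv

lemma IsRadial.hasDerivAt_deriv (hy : IsRadial y p H) {r : ℝ} (hr : r ∈ Ioo (0:ℝ) 1) :
    HasDerivAt (deriv y) ((H r * r - p r) / r ^ 2) r := by
  have h : HasDerivAt (fun x => p x / x) ((H r * r - p r) / r ^ 2) r :=
    ((hy r hr).2.div (hasDerivAt_id r) hr.1.ne').congr_deriv (by simp)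
  refine h.congr_of_eventuallyEq ?_
  filter_upwards [isOpen_Ioo.mem_nhds hr] with x hx using hy.deriv_eq hx

lemma IsRadial.contDiffOn (hy : IsRadial y p H) (hH : ContinuousOn H (Ioo 0 1)) :
    ContDiffOn ℝ 2 y (Ioo 0 1) := by
  refine (contDiffOn_succ_iff_deriv_of_isOpen (n := 1) isOpen_Ioo).2
    ⟨fun x hx => (hy x hx).1.differentiableAt.differentiableWithinAt, by simp, ?_⟩
  refine (contDiffOn_succ_iff_deriv_of_isOpen (n := 0) isOpen_Ioo).2
    ⟨fun x hx => (hy.hasDerivAt_deriv hx).differentiableAt.differentiableWithinAt, by simp, ?_⟩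
  rw [contDiffOn_zero]
  have hp : ContinuousOn p (Ioo 0 1) := fun x hx => (hy x hx).2.continuousAt.continuousWithinAt
  exact (((hH.mul continuousOn_id).sub hp).div (continuousOn_id.pow 2)
    fun x hx => pow_ne_zero 2 hx.1.ne').congr fun x hx => (hy.hasDerivAt_deriv hx).deriv

end Basic

section Compactness

lemma intervalIntegrable_of_bounded {h : ℝ → ℝ} {C r : ℝ} (hc : ContinuousOn h (Ioo 0 1))
    (hb : ∀ x ∈ Ioo (0:ℝ) 1, |h x| ≤ C) (hr : r ∈ Ioo (0:ℝ) 1) :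
    IntervalIntegrable h volume 0 r := by
  have hsub : Ioc 0 r ⊆ Ioo (0:ℝ) 1 := fun x hx => ⟨hx.1, hx.2.trans_lt hr.2⟩
  rw [intervalIntegrable_iff_integrableOn_Ioc_of_le hr.1.le]
  refine IntegrableOn.of_bound (C := C) (by simp)
    ((hc.mono hsub).aestronglyMeasurable measurableSet_Ioc) ?_
  filter_upwards [ae_restrict_mem measurableSet_Ioc] with x hx using hb x (hsub hx)

lemma IsRadial.momentum_eq_integral {y p H : ℝ → ℝ} {C : ℝ} (hy : IsRadial y p H) (hp0 : p 0 = 0)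
    (hp : ∀ r ∈ Ioo (0:ℝ) 1, |p r| ≤ C * r) (hHc : ContinuousOn H (Ioo 0 1))
    (hHb : ∀ r ∈ Ioo (0:ℝ) 1, |H r| ≤ C) {r : ℝ} (hr : r ∈ Ioo (0:ℝ) 1) :
    ∫ s in 0..r, H s = p r := by
  have hcont : ContinuousOn p (Icc 0 r) := by
    intro x hx
    rcases hx.1.eq_or_lt with rfl | hx0
    · rw [ContinuousWithinAt, hp0]
      have hlim : Tendsto (fun x : ℝ => C * x) (𝓝[Icc 0 r] 0) (𝓝 0) := by
        have : Continuous fun x : ℝ => C * x := by fun_prop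
        simpa using (this.tendsto 0).mono_left nhdsWithin_le_nhds
      refine squeeze_zero_norm' ?_ hlim
      filter_upwards [self_mem_nhdsWithin] with x hx
      rcases hx.1.eq_or_lt with rfl | hx0
      · simp [hp0]
      · exact hp x ⟨hx0, hx.2.trans_lt hr.2⟩
    · exact (hy x ⟨hx0, hx.2.trans_lt hr.2⟩).2.continuousAt.continuousWithinAt
  rw [intervalIntegral.integral_eq_sub_of_hasDerivAt_of_le hr.1.le hcont
    (fun x hx => (hy x ⟨hx.1, hx.2.trans hr.2⟩).2) (intervalIntegrable_of_bounded hHc hHb hr), hp0,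
    sub_zero]

/-- Pointwise limits of radial functions with uniformly bounded right-hand sides. -/
lemma isRadial_of_tendsto {y p H : ℕ → ℝ → ℝ} {z K : ℝ → ℝ} {C : ℝ}
    (hy : ∀ n, IsRadial (y n) (p n) (H n)) (hp0 : ∀ n, p n 0 = 0)
    (hp : ∀ n, ∀ r ∈ Ioo (0:ℝ) 1, |p n r| ≤ C * r) (hHc : ∀ n, ContinuousOn (H n) (Ioo 0 1))
    (hHb : ∀ n, ∀ r ∈ Ioo (0:ℝ) 1, |H n r| ≤ C) (hKc : ContinuousOn K (Ioo 0 1))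
    (hyz : ∀ r ∈ Ioo (0:ℝ) 1, Tendsto (fun n => y n r) atTop (𝓝 (z r)))
    (hHK : ∀ r ∈ Ioo (0:ℝ) 1, Tendsto (fun n => H n r) atTop (𝓝 (K r))) :
    IsRadial z (fun r => ∫ s in 0..r, K s) K := by
  have hKb : ∀ r ∈ Ioo (0:ℝ) 1, |K r| ≤ C := fun r hr =>
    le_of_tendsto (hHK r hr).abs (Eventually.of_forall fun n => hHb n r hr)
  have hP : ∀ r ∈ Ioo (0:ℝ) 1, HasDerivAt (fun r => ∫ s in 0..r, K s) (K r) r := fun r hr =>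
    intervalIntegral.integral_hasDerivAt_right (intervalIntegrable_of_bounded hKc hKb hr)
      (hKc.stronglyMeasurableAtFilter isOpen_Ioo r hr) (hKc.continuousAt (isOpen_Ioo.mem_nhds hr))
  have hpP : ∀ r ∈ Ioo (0:ℝ) 1, Tendsto (fun n => p n r) atTop (𝓝 (∫ s in 0..r, K s)) := by
    intro r hr
    simp_rw [← fun n => (hy n).momentum_eq_integral (hp0 n) (hp n) (hHc n) (hHb n) hr]
    have hsub : uIoc 0 r ⊆ Ioo (0:ℝ) 1 := by
      rw [uIoc_of_le hr.1.le]; exact fun x hx => ⟨hx.1, hx.2.trans_lt hr.2⟩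
    refine intervalIntegral.tendsto_integral_filter_of_dominated_convergence (fun _ => C)
      (Eventually.of_forall fun n => ((hHc n).mono hsub).aestronglyMeasurable measurableSet_uIoc)
      (Eventually.of_forall fun n => Eventually.of_forall fun x hx => hHb n x (hsub hx))
      intervalIntegrable_const (Eventually.of_forall fun x hx => hHK x (hsub hx))
  have hPc : ContinuousOn (fun t => (∫ s in 0..t, K s) / t) (Ioo 0 1) := fun x hx =>
    ((hP x hx).continuousAt.div continuousAt_id hx.1.ne').continuousWithinAt
  have hzint : ∀ a ∈ Ioo (0:ℝ) 1, ∀ b ∈ Ioo (0:ℝ) 1,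
      ∫ t in a..b, (∫ s in 0..t, K s) / t = z b - z a := by
    intro a ha b hb
    have hsub : uIcc a b ⊆ Ioo (0:ℝ) 1 := (ordConnected_Ioo).uIcc_subset ha hb
    have hpc : ∀ n, ContinuousOn (fun t => p n t / t) (uIcc a b) := fun n x hx =>
      ((hy n x (hsub hx)).2.continuousAt.div continuousAt_id (hsub hx).1.ne').continuousWithinAt
    have hn : ∀ n, ∫ t in a..b, p n t / t = y n b - y n a := fun n =>
      intervalIntegral.integral_eq_sub_of_hasDerivAt (fun x hx => (hy n x (hsub hx)).1)
        (hpc n).intervalIntegrable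
    have h1 : Tendsto (fun n => ∫ t in a..b, p n t / t) atTop
        (𝓝 (∫ t in a..b, (∫ s in 0..t, K s) / t)) := by
      refine intervalIntegral.tendsto_integral_filter_of_dominated_convergence (fun _ => C)
        (Eventually.of_forall fun n =>
          ((hpc n).mono uIoc_subset_uIcc).aestronglyMeasurable measurableSet_uIoc)
        (Eventually.of_forall fun n => Eventually.of_forall fun x hx => ?_)
        intervalIntegrable_const (Eventually.of_forall fun x hx =>
          (hpP x (hsub (uIoc_subset_uIcc hx))).div_const x)
      have hx' := hsub (uIoc_subset_uIcc hx)
      rw [Real.norm_eq_abs, abs_div, abs_of_pos hx'.1, div_le_iff₀ hx'.1]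
      exact hp n x hx'
    simp_rw [hn] at h1
    exact tendsto_nhds_unique h1 ((hyz b hb).sub (hyz a ha))
  intro r hr
  refine ⟨?_, hP r hr⟩
  have ha : r / 2 ∈ Ioo (0:ℝ) 1 := ⟨half_pos hr.1, by linarith [hr.1, hr.2]⟩
  have hd : HasDerivAt (fun u => ∫ t in (r / 2)..u, (∫ s in 0..t, K s) / t)
      ((∫ s in 0..r, K s) / r) r :=
    intervalIntegral.integral_hasDerivAt_right
      ((hPc.mono ((ordConnected_Ioo).uIcc_subset ha hr)).intervalIntegrable)
      (hPc.stronglyMeasurableAtFilter isOpen_Ioo r hr) (hPc.continuousAt (isOpen_Ioo.mem_nhds hr))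
  refine (hd.const_add (z (r / 2))).congr_of_eventuallyEq ?_
  filter_upwards [isOpen_Ioo.mem_nhds hr] with x hx
  rw [hzint _ ha x hx]
  ring

lemma exists_subseq_tendsto_of_lipschitz {F : ℕ → ℝ → ℝ} {B C : ℝ} (hC : 0 ≤ C)
    (hB : ∀ n, ∀ r ∈ Icc (0:ℝ) 1, |F n r| ≤ B)
    (hL : ∀ n, ∀ a ∈ Icc (0:ℝ) 1, ∀ b ∈ Icc (0:ℝ) 1, |F n a - F n b| ≤ C * |a - b|) :
    ∃ (G : ℝ → ℝ) (σ : ℕ → ℕ), ContinuousOn G (Icc 0 1) ∧ StrictMono σ ∧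
      ∀ r ∈ Icc (0:ℝ) 1, Tendsto (fun n => F (σ n) r) atTop (𝓝 (G r)) := by
  have hlip : ∀ n, LipschitzWith C.toNNReal (fun x : Icc (0:ℝ) 1 => F n x) := fun n =>
    LipschitzWith.of_dist_le_mul fun a b => by
      rw [Real.coe_toNNReal C hC]
      exact hL n a a.2 b b.2
  let Φ : ℕ → BoundedContinuousFunction (Icc (0:ℝ) 1) ℝ := fun n =>
    BoundedContinuousFunction.mkOfCompact ⟨_, (hlip n).continuous⟩
  have hcomp : IsCompact (closure (range Φ)) := by
    refine BoundedContinuousFunction.arzela_ascoli (Icc (-B) B) isCompact_Icc _ ?_ ?_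
    · rintro _ x ⟨n, rfl⟩
      exact abs_le.1 (hB n x x.2)
    · have : UniformEquicontinuous
          ((fun f x => f.1 x) : range Φ → Icc (0:ℝ) 1 → ℝ) := by
        refine LipschitzWith.uniformEquicontinuous _ C.toNNReal ?_
        rintro ⟨_, n, rfl⟩
        exact hlip n
      exact this.equicontinuous
  obtain ⟨G, -, σ, hσ, hG⟩ := hcomp.tendsto_subseq (x := Φ) fun n => subset_closure ⟨n, rfl⟩
  refine ⟨fun r => if h : r ∈ Icc (0:ℝ) 1 then G ⟨r, h⟩ else 0, σ, ?_, hσ, fun r hr => ?_⟩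
  · rw [continuousOn_iff_continuous_domRestrict]
    convert G.continuous using 1
    ext x
    simp [x.2.1, x.2.2]
  simp only [dif_pos hr]
  exact (BoundedContinuousFunction.tendsto_iff_tendstoUniformly.1 hG).tendsto_at ⟨r, hr⟩

end Compactness

section Modes

/-- `-y'' - y'/r + κ² y/r² = V y` on `(0, 1)`, with `p = r y'`. -/
def IsMode (κ : ℝ) (V y p : ℝ → ℝ) : Prop :=
  IsRadial y p (fun r => κ ^ 2 * y r / r - r * V r * y r)

/-- The zeroth order coefficient `W'(1 - f² - g²) / ε²`, with `w = W'`. -/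
def potential (w : ℝ → ℝ) (ε : ℝ) (f g : ℝ → ℝ) (r : ℝ) : ℝ :=
  w (1 - f r ^ 2 - g r ^ 2) / ε ^ 2

/-- The properties of `w = W'` used below. -/
structure IsSlope (w : ℝ → ℝ) : Prop where
  continuousOn : ContinuousOn w (Iic 1)
  strictMonoOn : StrictMonoOn w (Iic 1)
  zero : w 0 = 0

variable {κ : ℝ} {V y p : ℝ → ℝ}

lemma IsMode.const_mul (c : ℝ) (h : IsMode κ V y p) :
    IsMode κ V (fun r => c * y r) (fun r => c * p r) :=
  (IsRadial.const_mul c h).congr_right fun r _ => by ring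

lemma IsMode.neg (h : IsMode κ V y p) : IsMode κ V (fun r => -y r) (fun r => -p r) :=
  (IsRadial.neg h).congr_right fun r _ => by ring

lemma IsMode.le_mul (h : IsMode κ V y p) (hκ : 1 ≤ κ ^ 2) {M : ℝ}
    (hV0 : ∀ r ∈ Ioo (0:ℝ) 1, 0 ≤ V r) (hVM : ∀ r ∈ Ioo (0:ℝ) 1, V r ≤ M) (hM : 0 ≤ M)
    (hyc : ContinuousOn y (Icc 0 1)) (hy1 : ∀ r ∈ Ioo (0:ℝ) 1, y r ≤ 1)
    (h0 : y 0 = 0) (h1 : y 1 ≤ 1) : ∀ r ∈ Icc (0:ℝ) 1, y r ≤ (M / 3 + 1) * r := by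
  have key : ∀ r ∈ Icc (0:ℝ) 1, y r ≤ (M / 3 + 1) * r - M / 3 * r ^ 2 := by
    intro r hr
    by_contra! hlt
    obtain ⟨m, hm, hpos, hH⟩ := (IsRadial.sub h
      (isRadial_quadratic (M / 3 + 1) (M / 3))).exists_right_nonpos (c := 0) le_rfl le_rfl
      (hyc.sub (by fun_prop)) (by simp [h0]) (by linarith) hr (by linarith)
    have hm0 := hm.1
    have hquot : (M / 3 + 1) - M / 3 * m < y m / m := by
      rw [lt_div_iff₀ hm0]; nlinarith
    have hVy : V m * y m ≤ M := by
      nlinarith [hV0 m hm, hVM m hm, hy1 m hm]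
    have hVy' : m * V m * y m ≤ m * M := by
      rw [mul_assoc]; exact mul_le_mul_of_nonneg_left hVy hm0.le
    have hκy : κ ^ 2 * ((M / 3 + 1) - M / 3 * m) ≤ κ ^ 2 * y m / m := by
      rw [mul_div_assoc]; exact mul_le_mul_of_nonneg_left hquot.le (sq_nonneg κ)
    have hκy' : ((M / 3 + 1) - M / 3 * m) < κ ^ 2 * y m / m + (1 - κ ^ 2) *
        ((M / 3 + 1) - M / 3 * m) := by
      have := mul_lt_mul_of_pos_left hquot (by linarith : 0 < κ ^ 2)
      rw [← mul_div_assoc] at this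
      linarith
    have hge : 0 ≤ (κ ^ 2 - 1) * ((M / 3 + 1) - M / 3 * m) :=
      mul_nonneg (by linarith) (by nlinarith [hm.2])
    linarith
  intro r hr
  have := key r hr
  nlinarith [sq_nonneg r]

lemma IsMode.abs_le_mul (h : IsMode κ V y p) (hκ : 1 ≤ κ ^ 2) {M : ℝ}
    (hV0 : ∀ r ∈ Ioo (0:ℝ) 1, 0 ≤ V r) (hVM : ∀ r ∈ Ioo (0:ℝ) 1, V r ≤ M) (hM : 0 ≤ M)
    (hyc : ContinuousOn y (Icc 0 1)) (hy1 : ∀ r ∈ Icc (0:ℝ) 1, |y r| ≤ 1)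
    (h0 : y 0 = 0) : ∀ r ∈ Icc (0:ℝ) 1, |y r| ≤ (M / 3 + 1) * r := fun r hr =>
  abs_le'.2 ⟨h.le_mul hκ hV0 hVM hM hyc
      (fun x hx => (abs_le'.1 (hy1 x (Ioo_subset_Icc_self hx))).1) h0
      (abs_le'.1 (hy1 1 (by simp))).1 r hr,
    h.neg.le_mul hκ hV0 hVM hM hyc.neg
      (fun x hx => (abs_le'.1 (hy1 x (Ioo_subset_Icc_self hx))).2) (by simp [h0])
      (abs_le'.1 (hy1 1 (by simp))).2 r hr⟩

lemma IsMode.abs_right_le (h : IsMode κ V y p) (hκ : 1 ≤ κ ^ 2) {M : ℝ}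
    (hV0 : ∀ r ∈ Ioo (0:ℝ) 1, 0 ≤ V r) (hVM : ∀ r ∈ Ioo (0:ℝ) 1, V r ≤ M) (hM : 0 ≤ M)
    (hyc : ContinuousOn y (Icc 0 1)) (hy1 : ∀ r ∈ Icc (0:ℝ) 1, |y r| ≤ 1) (h0 : y 0 = 0) :
    ∀ r ∈ Ioo (0:ℝ) 1, |κ ^ 2 * y r / r - r * V r * y r| ≤ κ ^ 2 * (M / 3 + 1) + M := by
  intro r hr
  have hy := h.abs_le_mul hκ hV0 hVM hM hyc hy1 h0 r (Ioo_subset_Icc_self hr)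
  refine (abs_sub _ _).trans (add_le_add ?_ ?_)
  · rw [mul_div_assoc, abs_mul, abs_of_nonneg (sq_nonneg κ), abs_div, abs_of_pos hr.1]
    exact mul_le_mul_of_nonneg_left ((div_le_iff₀ hr.1).2 hy) (sq_nonneg κ)
  · rw [abs_mul, abs_mul, abs_of_pos hr.1, abs_of_nonneg (hV0 r hr)]
    have h1 := hy1 r (Ioo_subset_Icc_self hr)
    have h2 : r * V r ≤ M := by nlinarith [hV0 r hr, hVM r hr, hr.1, hr.2]
    have h3 : 0 ≤ r * V r := mul_nonneg hr.1.le (hV0 r hr)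
    nlinarith [abs_nonneg (y r)]

lemma IsMode.abs_right_le_of_zero {M : ℝ}
    (hV0 : ∀ r ∈ Ioo (0:ℝ) 1, 0 ≤ V r) (hVM : ∀ r ∈ Ioo (0:ℝ) 1, V r ≤ M)
    (hy1 : ∀ r ∈ Icc (0:ℝ) 1, |y r| ≤ 1) :
    ∀ r ∈ Ioo (0:ℝ) 1, |(0:ℝ) ^ 2 * y r / r - r * V r * y r| ≤ M * r := by
  intro r hr
  have h1 := hy1 r (Ioo_subset_Icc_self hr)
  have h3 : 0 ≤ r * V r := mul_nonneg hr.1.le (hV0 r hr)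
  have h2 : r * V r ≤ M * r := by nlinarith [hVM r hr, hr.1]
  rw [show (0:ℝ) ^ 2 * y r / r - r * V r * y r = -(r * V r * y r) by simp, abs_neg, abs_mul,
    abs_of_nonneg h3]
  nlinarith [abs_nonneg (y r)]

lemma IsMode.momentum_nonpos (h : IsMode 0 V y p) (hV0 : ∀ r ∈ Ioo (0:ℝ) 1, 0 ≤ V r)
    (hy0 : ∀ r ∈ Ioo (0:ℝ) 1, 0 ≤ y r) {B : ℝ} (hB : ∀ r ∈ Ioo (0:ℝ) 1, |y r| ≤ B) :
    ∀ r ∈ Ioo (0:ℝ) 1, p r ≤ 0 := by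
  intro r hr
  have := IsRadial.momentum_le h (C := 0) le_rfl (fun x hx => by
    have := mul_nonneg (mul_nonneg hx.1.le (hV0 x hx)) (hy0 x hx)
    simpa using this) hB r hr
  simpa using this

lemma IsMode.neg_momentum_le (h : IsMode 0 V y p) {M : ℝ} (hM : 0 ≤ M)
    (hV0 : ∀ r ∈ Ioo (0:ℝ) 1, 0 ≤ V r) (hVM : ∀ r ∈ Ioo (0:ℝ) 1, V r ≤ M)
    (hy1 : ∀ r ∈ Icc (0:ℝ) 1, |y r| ≤ 1) :
    ∀ r ∈ Ioo (0:ℝ) 1, -p r ≤ M / 2 * r ^ 2 := by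
  intro r hr
  have hrad := (IsRadial.neg h).add (isRadial_quadratic 0 (M / 4))
  have := hrad.momentum_le (C := 0) (B := 1 + M / 4) le_rfl (fun x hx => by
    have := (abs_le.1 (IsMode.abs_right_le_of_zero hV0 hVM hy1 x hx)).1
    linarith) (fun x hx => by
    have h1 := abs_le.1 (hy1 x (Ioo_subset_Icc_self hx))
    have h2 : 0 ≤ M / 4 * x ^ 2 := by positivity
    have h3 : M / 4 * x ^ 2 ≤ M / 4 :=
      mul_le_of_le_one_right (by positivity) (pow_le_one₀ hx.1.le hx.2.le)
    rw [abs_le]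
    constructor <;> linarith) r hr
  linarith

/-- A nonnegative nontrivial solution of the linearised equation is positive. -/
lemma IsMode.pos_of_nonneg (h : IsMode 0 V y p) (hV0 : ∀ r ∈ Ioo (0:ℝ) 1, 0 ≤ V r)
    (hyc : ContinuousOn y (Icc 0 1)) (hy0 : ∀ r ∈ Icc (0:ℝ) 1, 0 ≤ y r)
    (hp : ∀ r ∈ Ioo (0:ℝ) 1, p r ≤ 0) (h0 : 0 < y 0) : ∀ r ∈ Ico (0:ℝ) 1, 0 < y r := by
  intro r hr
  by_contra! hle
  have hanti := IsRadial.antitoneOn h hyc hp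
  have hr0 : 0 < r := lt_of_le_of_ne hr.1 (by rintro rfl; linarith)
  set m := (r + 1) / 2 with hm
  have hrm : r < m := by linarith [hr.2]
  have hm1 : m < 1 := by linarith [hr.2]
  have hmI : m ∈ Ioo (0:ℝ) 1 := ⟨hr0.trans hrm, hm1⟩
  have hpm : p m = 0 := by
    have hconst : y =ᶠ[𝓝 m] fun _ => 0 := by
      filter_upwards [Ioo_mem_nhds hrm hm1] with x hx
      have hx01 : x ∈ Icc (0:ℝ) 1 := ⟨(hr0.trans hx.1).le, hx.2.le⟩
      exact le_antisymm ((hanti ⟨hr.1, hr.2.le⟩ hx01 hx.1.le).trans hle) (hy0 x hx01)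
    have hd := (h m hmI).1.unique ((hasDerivAt_const m (0:ℝ)).congr_of_eventuallyEq hconst)
    rcases div_eq_zero_iff.1 hd with h' | h'
    · exact h'
    · exact absurd h' hmI.1.ne'
  have hpanti : AntitoneOn p (Ioc 0 m) := by
    have hmem : ∀ x ∈ Ioc 0 m, x ∈ Ioo (0:ℝ) 1 := fun x hx => ⟨hx.1, hx.2.trans_lt hm1⟩
    refine antitoneOn_of_deriv_nonpos (convex_Ioc 0 m)
      (fun x hx => (h x (hmem x hx)).2.continuousAt.continuousWithinAt)
      (fun x hx => (h x (hmem x (interior_subset hx))).2.differentiableAt.differentiableWithinAt)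
      fun x hx => ?_
    have hx' := hmem x (interior_subset hx)
    rw [(h x hx').2.deriv]
    have := mul_nonneg (mul_nonneg hx'.1.le (hV0 x hx')) (hy0 x (Ioo_subset_Icc_self hx'))
    simpa using this
  have hpz : ∀ x ∈ Ioo 0 r, p x = 0 := fun x hx => by
    refine le_antisymm (hp x ⟨hx.1, hx.2.trans hr.2⟩) ?_
    rw [← hpm]
    exact hpanti ⟨hx.1, (hx.2.trans hrm).le⟩ ⟨hmI.1, le_rfl⟩ (hx.2.trans hrm).le
  obtain ⟨c, hc, hc'⟩ := exists_hasDerivAt_eq_slope y (fun r => p r / r) hr0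
    (hyc.mono (Icc_subset_Icc_right hr.2.le)) (fun x hx => (h x ⟨hx.1, hx.2.trans hr.2⟩).1)
  rw [hpz c hc, zero_div, eq_comm, div_eq_zero_iff] at hc'
  rcases hc' with h' | h' <;> linarith

variable {w f g P Q : ℝ → ℝ} {ε : ℝ}

lemma potential_continuousOn (hw : IsSlope w) (hf : ContinuousOn f (Icc 0 1))
    (hg : ContinuousOn g (Icc 0 1)) : ContinuousOn (potential w ε f g) (Icc 0 1) := by
  refine ContinuousOn.div_const (hw.continuousOn.comp (by fun_prop) fun r _ => ?_) _
  simp only [mem_Iic]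
  nlinarith [sq_nonneg (f r), sq_nonneg (g r)]

/-- Maximum principle: `f² + g² ≤ 1`. -/
lemma sq_add_sq_le_one (hw : IsSlope w) (hε : 0 < ε)
    (hf : IsMode κ (potential w ε f g) f P) (hg : IsMode 0 (potential w ε f g) g Q)
    (hfc : ContinuousOn f (Icc 0 1)) (hgc : ContinuousOn g (Icc 0 1))
    (hf1 : f 1 = 1) (hg1 : g 1 = 0) : ∀ r ∈ Icc (0:ℝ) 1, f r ^ 2 + g r ^ 2 ≤ 1 := by
  have huc : ContinuousOn (fun r => f r ^ 2 + g r ^ 2) (Icc 0 1) := by fun_prop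
  have hu1 : f 1 ^ 2 + g 1 ^ 2 = 1 := by simp [hf1, hg1]
  have key : ∀ r ∈ Ioo (0:ℝ) 1, f r ^ 2 + g r ^ 2 ≤ 1 := by
    intro r hr
    by_contra! hlt
    obtain ⟨B, hB⟩ := isCompact_Icc.bddAbove_image huc
    have hB' : ∀ x ∈ Icc (0:ℝ) 1, f x ^ 2 + g x ^ 2 ≤ B := fun x hx => hB (mem_image_of_mem _ hx)
    have hlogr : Real.log r < 0 := Real.log_neg hr.1 hr.2
    obtain ⟨δ, hδ, hδr⟩ : ∃ δ > 0, 1 < f r ^ 2 + g r ^ 2 + δ * Real.log r := by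
      refine ⟨(f r ^ 2 + g r ^ 2 - 1) / (2 * -Real.log r),
        div_pos (by linarith) (by linarith), ?_⟩
      have : (f r ^ 2 + g r ^ 2 - 1) / (2 * -Real.log r) * Real.log r =
          -(f r ^ 2 + g r ^ 2 - 1) / 2 := by
        field_simp [hlogr.ne]
      rw [this]; linarith
    have hB1 : 1 < B := hlt.trans_le (hB' r (Ioo_subset_Icc_self hr))
    set s := r * Real.exp (-(B / δ)) with hs
    have hs0 : 0 < s := mul_pos hr.1 (Real.exp_pos _)
    have hsr : s ≤ r := mul_le_of_le_one_right hr.1.le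
      (Real.exp_le_one_iff.2 (neg_nonpos.2 (by positivity)))
    have hlog : δ * Real.log s = δ * Real.log r - B := by
      rw [hs, Real.log_mul hr.1.ne' (Real.exp_pos _).ne', Real.log_exp]
      field_simp
      ring
    have hs1 : s ≤ 1 := hsr.trans hr.2.le
    have hrad := ((IsRadial.sq hf).add (IsRadial.sq hg)).add (isRadial_log.const_mul δ)
    obtain ⟨m, hm, hpos, hH⟩ := hrad.exists_right_nonpos (a := s) (b := 1) (c := 1) hs0.le le_rfl
      ((huc.mono (Icc_subset_Icc_left hs0.le)).add
        (continuousOn_const.mul (Real.continuousOn_log.mono fun x hx =>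
          (hs0.trans_le hx.1).ne'))) (by
        have := hB' s ⟨hs0.le, hs1⟩
        have := mul_neg_of_pos_of_neg hδ hlogr
        simp only [hlog]
        linarith) (by simp [hf1, hg1]) ⟨hsr, hr.2.le⟩ hδr
    have hm0 : 0 < m := hs0.trans hm.1
    have hum : 1 < f m ^ 2 + g m ^ 2 := by
      have := mul_neg_of_pos_of_neg hδ (Real.log_neg hm0 hm.2)
      linarith
    have hV : potential w ε f g m < 0 := by
      refine div_neg_of_neg_of_pos ?_ (by positivity)
      rw [← hw.zero]
      exact hw.strictMonoOn (show 1 - f m ^ 2 - g m ^ 2 ∈ Iic (1:ℝ) by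
        simp only [mem_Iic]; linarith) (by simp) (by linarith)
    have h1 : 0 ≤ P m ^ 2 / m := by positivity
    have h2 : 0 ≤ Q m ^ 2 / m := by positivity
    have h3 : 0 ≤ f m * (κ ^ 2 * f m / m) := by
      rw [show f m * (κ ^ 2 * f m / m) = (κ * f m) ^ 2 / m by ring]
      positivity
    have h4 : 0 < m * -potential w ε f g m * (f m ^ 2 + g m ^ 2) := by
      have : 0 < -potential w ε f g m := by linarith
      positivity
    have h5 : (0:ℝ) ^ 2 * g m / m = 0 := by simp
    rw [h5] at hH
    linarith
  intro r hr
  rcases hr.1.eq_or_lt with rfl | hr0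
  · have hcl : (0:ℝ) ∈ closure (Ioo (0:ℝ) 1) := by
      rw [closure_Ioo zero_ne_one]; simp
    refine ContinuousWithinAt.closure_le hcl
      ((huc 0 (by simp)).mono Ioo_subset_Icc_self) continuousWithinAt_const key
  · rcases hr.2.eq_or_lt with rfl | hr1
    · exact hu1.le
    · exact key r ⟨hr0, hr1⟩

lemma potential_bounds (hw : IsSlope w) {ε₀ : ℝ} (hε₀ : 0 < ε₀) (hε : ε₀ ≤ ε) {r : ℝ}
    (hu : f r ^ 2 + g r ^ 2 ≤ 1) :
    0 ≤ potential w ε f g r ∧ potential w ε f g r ≤ w 1 / ε₀ ^ 2 := by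
  have hmem : 1 - f r ^ 2 - g r ^ 2 ∈ Iic (1:ℝ) := by
    simp only [mem_Iic]; nlinarith [sq_nonneg (f r), sq_nonneg (g r)]
  have h0 : 0 ≤ w (1 - f r ^ 2 - g r ^ 2) := by
    rw [← hw.zero]
    exact hw.strictMonoOn.monotoneOn (by simp) hmem (by linarith)
  refine ⟨div_nonneg h0 (sq_nonneg ε), div_le_div₀ ?_ ?_ (by positivity) (by gcongr)⟩
  · exact h0.trans (hw.strictMonoOn.monotoneOn hmem (by simp) hmem)
  · exact hw.strictMonoOn.monotoneOn hmem (by simp) hmem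

end Modes

section Comparison

/-- A profile `f` with `g = 0` at which the linearised operator in the `g` direction has the
positive kernel element `φ`; here `P = r f'` and `Q = r φ'`. -/
structure IsCritical (w : ℝ → ℝ) (ε κ : ℝ) (f P φ Q : ℝ → ℝ) : Prop where
  f_continuousOn : ContinuousOn f (Icc 0 1)
  φ_continuousOn : ContinuousOn φ (Icc 0 1)
  f_isMode : IsMode κ (potential w ε f fun _ => 0) f P
  φ_isMode : IsMode 0 (potential w ε f fun _ => 0) φ Q
  f_zero : f 0 = 0
  f_one : f 1 = 1
  f_le_one : ∀ r ∈ Icc (0:ℝ) 1, f r ≤ 1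
  φ_one : φ 1 = 0
  φ_pos : ∀ r ∈ Ico (0:ℝ) 1, 0 < φ r
  Q_nonpos : ∀ r ∈ Ioo (0:ℝ) 1, Q r ≤ 0
  Q_bounded : ∃ C, ∀ r ∈ Ioo (0:ℝ) 1, |Q r| ≤ C * r

variable {w f P φ Q F R Φ S : ℝ → ℝ} {ε δ κ ℓ : ℝ}

lemma IsCritical.φ_nonneg (h : IsCritical w ε κ f P φ Q) {r : ℝ} (hr : r ∈ Icc (0:ℝ) 1) :
    0 ≤ φ r := by
  rcases hr.2.eq_or_lt with rfl | hr1
  · exact h.φ_one.ge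
  · exact (h.φ_pos r ⟨hr.1, hr1⟩).le

lemma IsCritical.f_nonneg (h : IsCritical w ε κ f P φ Q) (hκ : 0 < κ) :
    ∀ r ∈ Icc (0:ℝ) 1, 0 ≤ f r := by
  intro r hr
  have hle : ∀ δ > 0, -f r ≤ δ * φ r := fun δ hδ => by
    refine (IsRadial.neg h.f_isMode).le_of_wronskian_pos (h.φ_isMode.const_mul δ)
      h.f_continuousOn.neg (continuousOn_const.mul h.φ_continuousOn)
      (fun x hx => mul_pos hδ (h.φ_pos x hx)) ?_ ?_ (fun x hx hlt => ?_) r hr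
    · simpa [h.f_zero] using mul_pos hδ (h.φ_pos 0 (by simp))
    · simp [h.f_one, h.φ_one]
    · have hx0 := hx.1
      have hv : 0 < δ * φ x := mul_pos hδ (h.φ_pos x ⟨hx.1.le, hx.2⟩)
      have hu : 0 < -f x := hv.trans hlt
      have : 0 < κ ^ 2 * (-f x) * (δ * φ x) / x := by positivity
      refine this.trans_eq ?_
      ring
  by_contra! hlt
  have h1 := hle (-f r / (2 * (φ r + 1)))
    (div_pos (by linarith) (by linarith [h.φ_nonneg hr]))
  have h2 : -f r / (2 * (φ r + 1)) * φ r < -f r := by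
    have hφ := h.φ_nonneg hr
    rw [div_mul_eq_mul_div, div_lt_iff₀ (by linarith)]
    nlinarith
  linarith

lemma potential_anti (hw : IsSlope w) {r : ℝ} (h0 : 0 ≤ F r) (hle : F r ≤ f r) :
    potential w ε f (fun _ => 0) r ≤ potential w ε F (fun _ => 0) r := by
  refine div_le_div_of_nonneg_right (hw.strictMonoOn.monotoneOn ?_ ?_ ?_) (sq_nonneg ε)
  · simp only [mem_Iic]; nlinarith [sq_nonneg (f r)]
  · simp only [mem_Iic]; nlinarith [sq_nonneg (F r)]
  · nlinarith

lemma potential_strict_anti (hw : IsSlope w) (hε : 0 < ε) {r : ℝ} (h0 : 0 ≤ F r)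
    (hlt : F r < f r) :
    potential w ε f (fun _ => 0) r < potential w ε F (fun _ => 0) r := by
  refine div_lt_div_of_pos_right (hw.strictMonoOn ?_ ?_ ?_) (by positivity)
  · simp only [mem_Iic]; nlinarith [sq_nonneg (f r)]
  · simp only [mem_Iic]; nlinarith [sq_nonneg (F r)]
  · nlinarith

lemma IsMode.rescale {s : ℝ} (hs : 0 < s) (hs1 : s ≤ 1) {y p g : ℝ → ℝ}
    (h : IsMode κ (potential w (s * ε) f g) y p) :
    IsMode κ (potential w ε (fun r => f (s * r)) fun r => g (s * r)) (fun r => y (s * r))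
      (fun r => p (s * r)) := by
  refine (IsRadial.comp_mul h hs hs1).congr_right fun r hr => ?_
  have := hr.1.ne'
  simp only [potential, mul_pow]
  by_cases hε : ε = 0
  · simp only [hε]
    field_simp
  · field_simp

/-- A profile with larger winding number, rescaled so as to have the same `ε`, is smaller. -/
lemma IsCritical.le_of_mode_lt (hw : IsSlope w) (hκ : 0 < κ) (hκℓ : κ < ℓ)
    (h : IsCritical w ε κ f P φ Q) (hF : IsMode ℓ (potential w ε F fun _ => 0) F R)
    (hFc : ContinuousOn F (Icc 0 1)) (hF0 : F 0 = 0) (hF1 : F 1 ≤ 1) :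
    ∀ r ∈ Icc (0:ℝ) 1, F r ≤ f r := by
  intro r hr
  have hfnn := h.f_nonneg hκ
  have hle : ∀ δ > 0, F r ≤ (1 + δ) * f r + δ * φ r := fun δ hδ => by
    have hv : ∀ x ∈ Ico (0:ℝ) 1, 0 < (1 + δ) * f x + δ * φ x := fun x hx =>
      add_pos_of_nonneg_of_pos (mul_nonneg (by linarith) (hfnn x ⟨hx.1, hx.2.le⟩))
        (mul_pos hδ (h.φ_pos x hx))
    refine IsRadial.le_of_wronskian_pos hF
      (IsRadial.add (h.f_isMode.const_mul (1 + δ)) (h.φ_isMode.const_mul δ)) hFc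
      ((continuousOn_const.mul h.f_continuousOn).add (continuousOn_const.mul h.φ_continuousOn))
      hv ?_ ?_ (fun x hx hlt => ?_) r hr
    · rw [hF0]; exact hv 0 (by simp)
    · rw [h.f_one, h.φ_one]; linarith
    · have hx0 := hx.1
      have hx' := Ioo_subset_Icc_self hx
      have hvx := hv x ⟨hx.1.le, hx.2⟩
      have hφx := mul_pos hδ (h.φ_pos x ⟨hx.1.le, hx.2⟩)
      have hfx := hfnn x hx'
      have hux : 0 < F x := hvx.trans hlt
      have hVle := potential_anti (ε := ε) hw hfx (show f x ≤ F x by nlinarith)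
      set v := (1 + δ) * f x + δ * φ x with hvdef
      set V₁ := potential w ε F (fun _ => 0) x
      set V₂ := potential w ε f (fun _ => 0) x
      have h1 : 0 ≤ x * F x * v * (V₂ - V₁) :=
        mul_nonneg (by positivity) (by linarith)
      have h2 : 0 < (ℓ ^ 2 - κ ^ 2) * (F x * v) / x := by
        have : 0 < ℓ ^ 2 - κ ^ 2 := by nlinarith
        positivity
      have h3 : 0 ≤ κ ^ 2 * F x * (δ * φ x) / x := by positivity
      have h4 : (ℓ ^ 2 * F x / x - x * V₁ * F x) * v -
          (κ ^ 2 * ((1 + δ) * f x) / x - x * V₂ * ((1 + δ) * f x) +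
            (0 ^ 2 * (δ * φ x) / x - x * V₂ * (δ * φ x))) * F x =
          (ℓ ^ 2 - κ ^ 2) * (F x * v) / x + κ ^ 2 * F x * (δ * φ x) / x +
            x * F x * v * (V₂ - V₁) := by
        rw [hvdef]; ring
      rw [h4]
      linarith
  by_contra! hlt
  have hf := hfnn r hr
  have hφ := h.φ_nonneg hr
  have hs : 0 < 2 * (f r + φ r + 1) := by linarith
  have h1 := hle ((F r - f r) / (2 * (f r + φ r + 1))) (div_pos (by linarith) hs)
  have h2 : (F r - f r) / (2 * (f r + φ r + 1)) * (f r + φ r) < F r - f r := by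
    rw [div_mul_eq_mul_div, div_lt_iff₀ hs]
    nlinarith
  linarith

lemma exists_lt_of_mode_lt (hκ : 0 < κ) (hκℓ : κ < ℓ)
    (h : IsCritical w ε κ f P φ Q) (hF : IsMode ℓ (potential w ε F fun _ => 0) F R)
    (hle : ∀ r ∈ Icc (0:ℝ) 1, F r ≤ f r) : ∃ r ∈ Ioo (0:ℝ) 1, F r < f r := by
  by_contra! hge
  have heq : ∀ r ∈ Ioo (0:ℝ) 1, F r = f r := fun r hr =>
    le_antisymm (hle r (Ioo_subset_Icc_self hr)) (hge r hr)
  have hRP : ∀ r ∈ Ioo (0:ℝ) 1, R r = P r := fun r hr => by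
    have he : F =ᶠ[𝓝 r] f := by
      filter_upwards [isOpen_Ioo.mem_nhds hr] with x hx using heq x hx
    have := (hF r hr).1.unique ((h.f_isMode r hr).1.congr_of_eventuallyEq he)
    exact (div_left_inj' hr.1.ne').1 this
  have hfz : ∀ r ∈ Ioo (0:ℝ) 1, f r = 0 := fun r hr => by
    have he : R =ᶠ[𝓝 r] P := by
      filter_upwards [isOpen_Ioo.mem_nhds hr] with x hx using hRP x hx
    have hH := (hF r hr).2.unique ((h.f_isMode r hr).2.congr_of_eventuallyEq he)
    simp only [potential, heq r hr, mul_div_assoc] at hH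
    have h1 : (ℓ ^ 2 - κ ^ 2) * (f r / r) = 0 := by linarith
    have h2 : ℓ ^ 2 - κ ^ 2 ≠ 0 := by nlinarith
    rcases mul_eq_zero.1 h1 with h' | h'
    · exact absurd h' h2
    · rcases div_eq_zero_iff.1 h' with h'' | h''
      · exact h''
      · exact absurd h'' hr.1.ne'
  have hcl : (1:ℝ) ∈ closure (Ioo (0:ℝ) 1) := by
    rw [closure_Ioo zero_ne_one]; simp
  have : f 1 ≤ 0 := ContinuousWithinAt.closure_le hcl
    ((h.f_continuousOn 1 (by simp)).mono Ioo_subset_Icc_self) continuousWithinAt_const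
    fun x hx => (hfz x hx).le
  linarith [h.f_one]

/-- Sturm comparison: a positive solution vanishing at `1` excludes a positive solution for a
larger potential. -/
lemma not_potential_le {U V u p v q : ℝ → ℝ} {C D : ℝ} (hu : IsMode 0 U u p)
    (hv : IsMode 0 V v q) (huc : ContinuousOn u (Icc 0 1))
    (hu0 : ∀ r ∈ Ioo (0:ℝ) 1, 0 < u r) (hv0 : ∀ r ∈ Ioo (0:ℝ) 1, 0 < v r) (hu1 : u 1 = 0)
    {B : ℝ} (huB : ∀ r ∈ Ioo (0:ℝ) 1, u r ≤ B) (hvB : ∀ r ∈ Ioo (0:ℝ) 1, v r ≤ B)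
    (hp : ∀ r ∈ Ioo (0:ℝ) 1, p r ≤ 0) (hpC : ∀ r ∈ Ioo (0:ℝ) 1, |p r| ≤ C * r)
    (hqD : ∀ r ∈ Ioo (0:ℝ) 1, |q r| ≤ D * r) (hUV : ∀ r ∈ Ioo (0:ℝ) 1, U r ≤ V r)
    {s : ℝ} (hs : s ∈ Ioo (0:ℝ) 1) : V s ≤ U s := by
  by_contra! hlt
  have hB : 0 < B := (hu0 s hs).trans_le (huB s hs)
  have hd : ∀ r ∈ Ioo (0:ℝ) 1, HasDerivAt (fun r => p r * v r - q r * u r)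
      (r * u r * v r * (V r - U r)) r := fun r hr =>
    (((hu r hr).2.mul (hv r hr).1).sub ((hv r hr).2.mul (hu r hr).1)).congr_deriv (by ring)
  have hmono : MonotoneOn (fun r => p r * v r - q r * u r) (Ioo 0 1) := by
    refine monotoneOn_of_deriv_nonneg (convex_Ioo 0 1)
      (fun x hx => (hd x hx).continuousAt.continuousWithinAt) ?_ ?_ <;> rw [interior_Ioo]
    · exact fun x hx => (hd x hx).differentiableAt.differentiableWithinAt
    · intro x hx
      rw [(hd x hx).deriv]
      have := hx.1; have := hu0 x hx; have := hv0 x hx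
      exact mul_nonneg (by positivity) (sub_nonneg.2 (hUV x hx))
  have hC : 0 ≤ C := by
    have := (abs_nonneg _).trans (hpC s hs)
    exact nonneg_of_mul_nonneg_left this hs.1
  have hD : 0 ≤ D := by
    have := (abs_nonneg _).trans (hqD s hs)
    exact nonneg_of_mul_nonneg_left this hs.1
  have hnn : ∀ r ∈ Ioo (0:ℝ) 1, 0 ≤ p r * v r - q r * u r := by
    intro r hr
    by_contra! hneg
    set c := -(p r * v r - q r * u r) with hc
    have hc0 : 0 < c := by linarith
    set x := min r (c / (2 * ((C + D) * B + 1))) with hx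
    have hden : 0 < 2 * ((C + D) * B + 1) := by positivity
    have hxr : x ≤ r := min_le_left _ _
    have hx0 : 0 < x := lt_min hr.1 (by positivity)
    have hxI : x ∈ Ioo (0:ℝ) 1 := ⟨hx0, hxr.trans_lt hr.2⟩
    have h1 := hmono hxI hr hxr
    simp only at h1
    have h2 : x * (2 * ((C + D) * B + 1)) ≤ c := (le_div_iff₀ hden).1 (min_le_right _ _)
    have h3 : -(C * x * B) ≤ p x * v x := by
      have h := (abs_le.1 (hpC x hxI)).1
      have hv' := hv0 x hxI
      have : -p x * v x ≤ C * x * B := mul_le_mul (by linarith) (hvB x hxI) hv'.le (by positivity)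
      linarith
    have h4 : q x * u x ≤ D * x * B :=
      mul_le_mul (abs_le.1 (hqD x hxI)).2 (huB x hxI) (hu0 x hxI).le (by positivity)
    nlinarith
  obtain ⟨t, ht, htpos⟩ : ∃ t ∈ Ioo (0:ℝ) 1, 0 < p t * v t - q t * u t := by
    by_contra! hle
    have he : (fun r => p r * v r - q r * u r) =ᶠ[𝓝 s] fun _ => 0 := by
      filter_upwards [isOpen_Ioo.mem_nhds hs] with x hx using le_antisymm (hle x hx) (hnn x hx)
    have h0 := (hd s hs).unique ((hasDerivAt_const s (0:ℝ)).congr_of_eventuallyEq he)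
    have : 0 < s * u s * v s * (V s - U s) := by
      have := hs.1; have := hu0 s hs; have := hv0 s hs
      exact mul_pos (by positivity) (sub_pos.2 hlt)
    linarith
  have hlow : ∀ r ∈ Ioo t 1, p t * v t - q t * u t ≤ D * u r := fun r hr => by
    have hrI : r ∈ Ioo (0:ℝ) 1 := ⟨ht.1.trans hr.1, hr.2⟩
    have h1 := hmono ht hrI hr.1.le
    simp only at h1
    have h2 : p r * v r ≤ 0 := mul_nonpos_of_nonpos_of_nonneg (hp r hrI) (hv0 r hrI).le
    have h3 : -q r ≤ D := by
      have := (abs_le.1 (hqD r hrI)).1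
      nlinarith [hrI.1, hrI.2]
    nlinarith [hu0 r hrI]
  have hcl : (1:ℝ) ∈ closure (Ioo t 1) := by
    rw [closure_Ioo ht.2.ne]; exact ⟨ht.2.le, le_rfl⟩
  have hsub : Ioo t 1 ⊆ Icc (0:ℝ) 1 := fun x hx => ⟨(ht.1.trans hx.1).le, hx.2.le⟩
  have : p t * v t - q t * u t ≤ D * u 1 := ContinuousWithinAt.closure_le hcl
    continuousWithinAt_const ((continuousWithinAt_const (b := D)).mul ((huc 1 (by simp)).mono hsub)) hlow
  rw [hu1, mul_zero] at this
  linarith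

lemma IsCritical.lt_of_mode_lt (hw : IsSlope w) (hκ : 0 < κ) (hκℓ : κ < ℓ) (hδ : 0 < δ)
    (hε : 0 < ε) (h : IsCritical w ε κ f P φ Q) (h' : IsCritical w δ ℓ F R Φ S) : ε < δ := by
  by_contra! hδε
  set s := δ / ε with hs_def
  have hs : 0 < s := div_pos hδ hε
  have hs1 : s ≤ 1 := (div_le_one hε).2 hδε
  have hsε : s * ε = δ := div_mul_cancel₀ _ hε.ne'
  rw [← hsε] at h'
  have hmem : ∀ r ∈ Icc (0:ℝ) 1, s * r ∈ Icc (0:ℝ) 1 := fun r hr =>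
    ⟨mul_nonneg hs.le hr.1, mul_le_one₀ hs1 hr.1 hr.2⟩
  have hmem' : ∀ r ∈ Ioo (0:ℝ) 1, s * r ∈ Ioo (0:ℝ) 1 := fun r hr =>
    ⟨mul_pos hs hr.1, (mul_le_of_le_one_left hr.1.le hs1).trans_lt hr.2⟩
  have hFm := h'.f_isMode.rescale hs hs1
  have hΦm := h'.φ_isMode.rescale hs hs1
  have hsc : ContinuousOn (fun r => s * r) (Icc (0:ℝ) 1) := by fun_prop
  have hFnn := h'.f_nonneg (hκ.trans hκℓ)
  have hFc : ContinuousOn (fun r => F (s * r)) (Icc 0 1) := h'.f_continuousOn.comp hsc hmem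
  have hF1 : F s ≤ 1 := h'.f_le_one s ⟨hs.le, hs1⟩
  have hle := h.le_of_mode_lt hw hκ hκℓ hFm hFc (by simp [h'.f_zero]) (by simpa using hF1)
  obtain ⟨r, hr, hlt⟩ := exists_lt_of_mode_lt hκ hκℓ h hFm hle
  obtain ⟨C, hC⟩ := h.Q_bounded
  obtain ⟨D, hD⟩ := h'.Q_bounded
  obtain ⟨B₁, hB₁⟩ := isCompact_Icc.bddAbove_image h.φ_continuousOn
  obtain ⟨B₂, hB₂⟩ := isCompact_Icc.bddAbove_image h'.φ_continuousOn
  refine absurd (potential_strict_anti (F := fun x => F (s * x)) (f := f) (r := r) hw hε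
    (hFnn _ (hmem r (Ioo_subset_Icc_self hr))) hlt)
    (not_lt.2 (not_potential_le h.φ_isMode hΦm h.φ_continuousOn
      (fun x hx => h.φ_pos x ⟨hx.1.le, hx.2⟩)
      (fun x hx => h'.φ_pos _ ⟨(hmem' x hx).1.le, (hmem' x hx).2⟩) h.φ_one (B := max B₁ B₂)
      (fun x hx => (hB₁ (mem_image_of_mem _ (Ioo_subset_Icc_self hx))).trans (le_max_left _ _))
      (fun x hx => (hB₂ (mem_image_of_mem _ (hmem x (Ioo_subset_Icc_self hx)))).trans
        (le_max_right _ _)) h.Q_nonpos hC (D := D * s) (fun x hx => ?_) (fun x hx => ?_) hr))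
  · rw [mul_assoc]; exact hD _ (hmem' x hx)
  · exact potential_anti (F := fun x => F (s * x)) hw (hFnn _ (hmem x (Ioo_subset_Icc_self hx)))
      (hle x (Ioo_subset_Icc_self hx))

end Comparison

section Limit

lemma isSlope_Wd {W : ℝ → ℝ} (hW : ContDiffOn ℝ 1 W (Iic (1:ℝ))) (hW0 : W 0 = 0)
    (hWpos : ∀ t ∈ Iic (1:ℝ), t ≠ 0 → 0 < W t) (hWconv : StrictConvexOn ℝ (Iic (1:ℝ)) W) :
    IsSlope (Wd W) where
  continuousOn := hW.continuousOn_derivWithin (uniqueDiffOn_Iic 1) le_rfl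
  strictMonoOn := hWconv.strictMonoOn_derivWithin (hW.differentiableOn one_ne_zero)
  zero := by
    have hnhds : Iic (1:ℝ) ∈ 𝓝 (0:ℝ) := Iic_mem_nhds one_pos
    rw [Wd, derivWithin_of_mem_nhds hnhds]
    refine IsLocalMin.deriv_eq_zero ?_
    filter_upwards [hnhds] with t ht
    rw [hW0]
    rcases eq_or_ne t 0 with rfl | h
    · exact hW0.ge
    · exact (hWpos t ht h).le

variable {W f P g Q : ℝ → ℝ} {ε : ℝ} {k : ℤ}

lemma isMode_of_solvesSystem (h : SolvesSystem W ε k f g) :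
    IsMode k (potential (Wd W) ε f g) f (fun r => r * deriv f r) ∧
      IsMode 0 (potential (Wd W) ε f g) g (fun r => r * deriv g r) := by
  obtain ⟨-, -, hf, hg, hfe, hge, -⟩ := h
  refine ⟨(isRadial_of_contDiffOn hf).congr_right fun r hr => ?_,
    (isRadial_of_contDiffOn hg).congr_right fun r hr => ?_⟩
  · have hr0 := hr.1.ne'
    have he := congrArg (r * ·) (hfe r hr)
    have h1 : r * (1 / r * deriv f r) = deriv f r := by field_simp
    have h2 : r * ((k:ℝ) ^ 2 / r ^ 2 * f r) = (k:ℝ) ^ 2 * f r / r := by field_simp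
    simp only [mul_sub, mul_add, h1, h2] at he
    simp only [potential]
    linear_combination -he
  · have hr0 := hr.1.ne'
    have he := congrArg (r * ·) (hge r hr)
    have h1 : r * (1 / r * deriv g r) = deriv g r := by field_simp
    simp only [mul_sub, h1] at he
    simp only [potential]
    linear_combination -he

lemma derivWithin_zero_of_momentum_le {y p H : ℝ → ℝ} {C : ℝ} (hy : IsRadial y p H)
    (hyc : ContinuousOn y (Icc 0 1)) (hp : ∀ r ∈ Ioo (0:ℝ) 1, |p r| ≤ C * r ^ 2) :
    derivWithin y (Icc 0 1) 0 = 0 := by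
  have hlim : Tendsto (fun r => deriv y r) (𝓝[>] 0) (𝓝 0) := by
    have hCr : Tendsto (fun r : ℝ => C * r) (𝓝[>] 0) (𝓝 0) := by
      have : Tendsto (fun r : ℝ => C * r) (𝓝 0) (𝓝 (C * 0)) :=
        (continuous_const.mul continuous_id).tendsto 0
      rw [mul_zero] at this
      exact this.mono_left nhdsWithin_le_nhds
    refine squeeze_zero_norm' ?_ hCr
    filter_upwards [Ioo_mem_nhdsGT one_pos] with r hr
    rw [hy.deriv_eq hr, norm_div, Real.norm_eq_abs, Real.norm_eq_abs, abs_of_pos hr.1,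
      div_le_iff₀ hr.1]
    linarith [hp r hr]
  have hd : HasDerivWithinAt y 0 (Ici 0) 0 := by
    refine hasDerivWithinAt_Ici_of_tendsto_deriv (s := Ioo 0 1)
      (fun r hr => (hy r hr).1.differentiableAt.differentiableWithinAt)
      ((hyc 0 (by simp)).mono Ioo_subset_Icc_self) (Ioo_mem_nhdsGT one_pos) hlim
  exact (hd.mono Icc_subset_Ici_self).derivWithin (uniqueDiffOn_Icc one_pos 0 (by simp))

lemma continuousOn_right {κ : ℝ} {V y : ℝ → ℝ} (hV : ContinuousOn V (Icc 0 1))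
    (hy : ContinuousOn y (Icc 0 1)) :
    ContinuousOn (fun r => κ ^ 2 * y r / r - r * V r * y r) (Ioo 0 1) := by
  have hV' := hV.mono Ioo_subset_Icc_self
  have hy' := hy.mono Ioo_subset_Icc_self
  exact ((continuousOn_const.mul hy').div continuousOn_id fun r hr => hr.1.ne').sub
    ((continuousOn_id.mul hV').mul hy')

lemma solvesSystem_of_isMode {C : ℝ} (hw : IsSlope (Wd W))
    (hf : IsMode k (potential (Wd W) ε f g) f P) (hg : IsMode 0 (potential (Wd W) ε f g) g Q)
    (hfc : ContinuousOn f (Icc 0 1)) (hgc : ContinuousOn g (Icc 0 1))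
    (hQ : ∀ r ∈ Ioo (0:ℝ) 1, |Q r| ≤ C * r ^ 2)
    (hf0 : f 0 = 0) (hf1 : f 1 = 1) (hg1 : g 1 = 0) : SolvesSystem W ε k f g := by
  have hV := potential_continuousOn (ε := ε) hw hfc hgc
  refine ⟨hfc, hgc, IsRadial.contDiffOn hf (continuousOn_right hV hfc),
    IsRadial.contDiffOn hg (continuousOn_right hV hgc), fun r hr => ?_,
    fun r hr => ?_, hf0, hf1, derivWithin_zero_of_momentum_le hg hgc hQ, hg1⟩
  · have hr0 := hr.1.ne'
    rw [(IsRadial.hasDerivAt_deriv hf hr).deriv, IsRadial.deriv_eq hf hr]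
    simp only [potential]
    field_simp
    ring
  · have hr0 := hr.1.ne'
    rw [(IsRadial.hasDerivAt_deriv hg hr).deriv, IsRadial.deriv_eq hg hr]
    simp only [potential]
    field_simp
    ring

/-- A solution of the radial system with positive second component, in terms of `P = r f'` and
`Q = r g'`. -/
structure IsProfile (w : ℝ → ℝ) (ε κ : ℝ) (f P g Q : ℝ → ℝ) : Prop where
  f_continuousOn : ContinuousOn f (Icc 0 1)
  g_continuousOn : ContinuousOn g (Icc 0 1)
  f_isMode : IsMode κ (potential w ε f g) f P
  g_isMode : IsMode 0 (potential w ε f g) g Q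
  f_zero : f 0 = 0
  f_one : f 1 = 1
  g_one : g 1 = 0
  g_pos : ∀ r ∈ Ioo (0:ℝ) 1, 0 < g r
  P_zero : P 0 = 0
  Q_zero : Q 0 = 0

variable {w : ℝ → ℝ} {κ ε₀ : ℝ}

lemma IsProfile.sq_add_sq_le_one (h : IsProfile w ε κ f P g Q) (hw : IsSlope w) (hε : 0 < ε) :
    ∀ r ∈ Icc (0:ℝ) 1, f r ^ 2 + g r ^ 2 ≤ 1 :=
  RadialProfile.sq_add_sq_le_one hw hε h.f_isMode h.g_isMode h.f_continuousOn h.g_continuousOn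
    h.f_one h.g_one

lemma IsProfile.potential_bounds (h : IsProfile w ε κ f P g Q) (hw : IsSlope w) (hε₀ : 0 < ε₀)
    (hε : ε₀ ≤ ε) : ∀ r ∈ Icc (0:ℝ) 1,
      0 ≤ potential w ε f g r ∧ potential w ε f g r ≤ w 1 / ε₀ ^ 2 := fun r hr =>
  RadialProfile.potential_bounds hw hε₀ hε (h.sq_add_sq_le_one hw (hε₀.trans_le hε) r hr)

lemma IsProfile.abs_f_le_one (h : IsProfile w ε κ f P g Q) (hw : IsSlope w) (hε : 0 < ε) :
    ∀ r ∈ Icc (0:ℝ) 1, |f r| ≤ 1 := fun r hr =>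
  abs_le_one_iff_mul_self_le_one.2 (by
    nlinarith [h.sq_add_sq_le_one hw hε r hr, sq_nonneg (g r)])

lemma IsProfile.abs_g_le_one (h : IsProfile w ε κ f P g Q) (hw : IsSlope w) (hε : 0 < ε) :
    ∀ r ∈ Icc (0:ℝ) 1, |g r| ≤ 1 := fun r hr =>
  abs_le_one_iff_mul_self_le_one.2 (by
    nlinarith [h.sq_add_sq_le_one hw hε r hr, sq_nonneg (f r)])

lemma IsProfile.g_antitoneOn (h : IsProfile w ε κ f P g Q) (hw : IsSlope w) (hε : 0 < ε) :
    AntitoneOn g (Icc 0 1) :=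
  IsRadial.antitoneOn h.g_isMode h.g_continuousOn
    (h.g_isMode.momentum_nonpos
      (fun r hr => (h.potential_bounds hw hε le_rfl r (Ioo_subset_Icc_self hr)).1)
      (fun r hr => (h.g_pos r hr).le)
      fun r hr => h.abs_g_le_one hw hε r (Ioo_subset_Icc_self hr))

lemma IsProfile.g_zero_pos (h : IsProfile w ε κ f P g Q) (hw : IsSlope w) (hε : 0 < ε) :
    0 < g 0 :=
  (h.g_pos (1 / 2) (by norm_num)).trans_le
    (h.g_antitoneOn hw hε (by simp) (by norm_num) (by norm_num))

lemma IsProfile.normalized_mem_Icc (h : IsProfile w ε κ f P g Q) (hw : IsSlope w) (hε : 0 < ε) :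
    ∀ r ∈ Icc (0:ℝ) 1, (g 0)⁻¹ * g r ∈ Icc (0:ℝ) 1 := fun r hr => by
  have h0 := h.g_zero_pos hw hε
  have hle := h.g_antitoneOn hw hε (left_mem_Icc.2 zero_le_one) hr hr.1
  have hge := h.g_antitoneOn hw hε hr (right_mem_Icc.2 zero_le_one) hr.2
  rw [h.g_one] at hge
  exact ⟨by positivity, by rwa [inv_mul_le_iff₀ h0, mul_one]⟩

/-- Limits of solutions: after normalising `g` by its maximum `g 0`, a subsequence converges. -/
lemma exists_limit_of_isProfile {e : ℕ → ℝ} {f P g Q : ℕ → ℝ → ℝ} (hw : IsSlope w)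
    (hκ : 1 ≤ κ ^ 2) (hε₀ : 0 < ε₀) (he : ∀ n, ε₀ ≤ e n) (hlim : Tendsto e atTop (𝓝 ε))
    (h : ∀ n, IsProfile w (e n) κ (f n) (P n) (g n) (Q n)) :
    ∃ (F R φ S : ℝ → ℝ) (c : ℝ), 0 ≤ c ∧ ContinuousOn F (Icc 0 1) ∧ ContinuousOn φ (Icc 0 1) ∧
      IsMode κ (potential w ε F fun r => c * φ r) F R ∧
      IsMode 0 (potential w ε F fun r => c * φ r) φ S ∧
      F 0 = 0 ∧ F 1 = 1 ∧ φ 0 = 1 ∧ φ 1 = 0 ∧ (∀ r ∈ Icc (0:ℝ) 1, φ r ∈ Icc (0:ℝ) 1) ∧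
      ∀ r ∈ Icc (0:ℝ) 1, F r ^ 2 + (c * φ r) ^ 2 ≤ 1 := by
  set M := w 1 / ε₀ ^ 2 with hM_def
  have hpos : ∀ n, 0 < e n := fun n => hε₀.trans_le (he n)
  have hVb := fun n => (h n).potential_bounds hw hε₀ (he n)
  have hV0 : ∀ n, ∀ r ∈ Ioo (0:ℝ) 1, 0 ≤ potential w (e n) (f n) (g n) r := fun n r hr =>
    (hVb n r (Ioo_subset_Icc_self hr)).1
  have hVM : ∀ n, ∀ r ∈ Ioo (0:ℝ) 1, potential w (e n) (f n) (g n) r ≤ M := fun n r hr =>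
    (hVb n r (Ioo_subset_Icc_self hr)).2
  have hM : 0 ≤ M := (hV0 0 (1 / 2) (by norm_num)).trans (hVM 0 _ (by norm_num))
  set C := κ ^ 2 * (M / 3 + 1) + M with hC_def
  have hMC : M ≤ C := by
    have : 0 ≤ κ ^ 2 * (M / 3 + 1) := by positivity
    linarith
  have hC : 0 ≤ C := hM.trans hMC
  have hf1 := fun n => (h n).abs_f_le_one hw (hpos n)
  have hfH := fun n => (h n).f_isMode.abs_right_le hκ (hV0 n) (hVM n) hM (h n).f_continuousOn
    (hf1 n) (h n).f_zero
  have hP := fun n => IsRadial.abs_momentum_le (h n).f_isMode hC (hfH n)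
    fun r hr => hf1 n r (Ioo_subset_Icc_self hr)
  have hφI := fun n => (h n).normalized_mem_Icc hw (hpos n)
  have hφm := fun n => (h n).g_isMode.const_mul (g n 0)⁻¹
  have hφ1 : ∀ n, ∀ r ∈ Icc (0:ℝ) 1, |(g n 0)⁻¹ * g n r| ≤ 1 := fun n r hr =>
    abs_le.2 ⟨by linarith [(hφI n r hr).1], (hφI n r hr).2⟩
  have hφc : ∀ n, ContinuousOn (fun r => (g n 0)⁻¹ * g n r) (Icc 0 1) := fun n =>
    continuousOn_const.mul (h n).g_continuousOn
  have hφH : ∀ n, ∀ r ∈ Ioo (0:ℝ) 1, |(0:ℝ) ^ 2 * ((g n 0)⁻¹ * g n r) / r -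
      r * potential w (e n) (f n) (g n) r * ((g n 0)⁻¹ * g n r)| ≤ C := fun n r hr =>
    (IsMode.abs_right_le_of_zero (hV0 n) (hVM n) (hφ1 n) r hr).trans
      ((mul_le_of_le_one_right hM hr.2.le).trans hMC)
  have hQ := fun n => IsRadial.abs_momentum_le (hφm n) hC (hφH n)
    fun r hr => hφ1 n r (Ioo_subset_Icc_self hr)
  obtain ⟨F, σ, hFc, hσ, hF⟩ := exists_subseq_tendsto_of_lipschitz hC hf1
    fun n => IsRadial.dist_le (h n).f_isMode (h n).f_continuousOn (hP n)
  obtain ⟨φ, τ, hφcont, hτ, hφ⟩ := exists_subseq_tendsto_of_lipschitz hC (fun n => hφ1 (σ n))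
    fun n => IsRadial.dist_le (hφm (σ n)) (hφc (σ n)) (hQ (σ n))
  have hgI : ∀ n, g (σ (τ n)) 0 ∈ Icc (0:ℝ) 1 := fun n =>
    ⟨((h _).g_zero_pos hw (hpos _)).le,
      (le_abs_self _).trans ((h _).abs_g_le_one hw (hpos _) 0 (by simp))⟩
  obtain ⟨c, hc, ρ, hρ, hcl⟩ := isCompact_Icc.tendsto_subseq hgI
  set m : ℕ → ℕ := fun n => σ (τ (ρ n)) with hm_def
  have hm : Tendsto m atTop atTop := (hσ.comp (hτ.comp hρ)).tendsto_atTop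
  have hFm : ∀ r ∈ Icc (0:ℝ) 1, Tendsto (fun n => f (m n) r) atTop (𝓝 (F r)) := fun r hr =>
    (hF r hr).comp (hτ.comp hρ).tendsto_atTop
  have hφl : ∀ r ∈ Icc (0:ℝ) 1,
      Tendsto (fun n => (g (m n) 0)⁻¹ * g (m n) r) atTop (𝓝 (φ r)) := fun r hr =>
    (hφ r hr).comp hρ.tendsto_atTop
  have hcm : Tendsto (fun n => g (m n) 0) atTop (𝓝 c) := hcl
  have hgm : ∀ r ∈ Icc (0:ℝ) 1, Tendsto (fun n => g (m n) r) atTop (𝓝 (c * φ r)) :=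
    fun r hr => (hcm.mul (hφl r hr)).congr fun n =>
      mul_inv_cancel_left₀ ((h _).g_zero_pos hw (hpos _)).ne' _
  have hε : 0 < ε := hε₀.trans_le (ge_of_tendsto' hlim he)
  have hVm : ∀ r ∈ Icc (0:ℝ) 1, Tendsto (fun n => potential w (e (m n)) (f (m n)) (g (m n)) r)
      atTop (𝓝 (potential w ε F (fun r => c * φ r) r)) := fun r hr => by
    have harg : ∀ a b : ℝ, 1 - a ^ 2 - b ^ 2 ∈ Iic (1:ℝ) := fun a b => by
      simp only [mem_Iic]
      nlinarith [sq_nonneg a, sq_nonneg b]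
    refine Tendsto.div ?_ ((hlim.comp hm).pow 2) (by positivity)
    refine (hw.continuousOn _ (harg (F r) (c * φ r))).tendsto.comp
      (tendsto_nhdsWithin_iff.2 ⟨?_, Eventually.of_forall fun n => harg _ _⟩)
    exact ((hFm r hr).pow 2).const_sub 1 |>.sub ((hgm r hr).pow 2)
  have hVc : ∀ n, ContinuousOn (potential w (e n) (f n) (g n)) (Icc 0 1) := fun n =>
    potential_continuousOn hw (h n).f_continuousOn (h n).g_continuousOn
  have hVc' : ContinuousOn (potential w ε F fun r => c * φ r) (Icc 0 1) :=
    potential_continuousOn hw hFc (continuousOn_const.mul hφcont)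
  have hlimH : ∀ (μ : ℝ) (y : ℕ → ℝ → ℝ) (z : ℝ → ℝ),
      (∀ r ∈ Icc (0:ℝ) 1, Tendsto (fun n => y n r) atTop (𝓝 (z r))) → ∀ r ∈ Ioo (0:ℝ) 1,
      Tendsto (fun n => μ ^ 2 * y n r / r -
        r * potential w (e (m n)) (f (m n)) (g (m n)) r * y n r) atTop
        (𝓝 (μ ^ 2 * z r / r - r * potential w ε F (fun r => c * φ r) r * z r)) :=
    fun μ y z hy r hr => by
      have hr' := Ioo_subset_Icc_self hr
      exact (((hy r hr').const_mul _).div_const _).sub (((hVm r hr').const_mul r).mul (hy r hr'))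
  refine ⟨F, _, φ, _, c, hc.1, hFc, hφcont,
    isRadial_of_tendsto (fun n => (h (m n)).f_isMode) (fun n => (h (m n)).P_zero)
      (fun n => hP (m n)) (fun n => continuousOn_right (hVc _) (h (m n)).f_continuousOn)
      (fun n => hfH (m n)) (continuousOn_right hVc' hFc)
      (fun r hr => hFm r (Ioo_subset_Icc_self hr)) (hlimH κ _ F hFm),
    isRadial_of_tendsto (fun n => hφm (m n)) (fun n => by simp [(h (m n)).Q_zero])
      (fun n => hQ (m n)) (fun n => continuousOn_right (hVc _) (hφc (m n)))
      (fun n => hφH (m n)) (continuousOn_right hVc' hφcont)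
      (fun r hr => hφl r (Ioo_subset_Icc_self hr)) (hlimH 0 _ φ hφl), ?_, ?_, ?_, ?_, ?_, ?_⟩
  · exact tendsto_nhds_unique (hFm 0 (by simp)) (by simp [(h _).f_zero])
  · exact tendsto_nhds_unique (hFm 1 (by simp)) (by simp [(h _).f_one])
  · exact tendsto_nhds_unique (hφl 0 (by simp))
      (tendsto_const_nhds.congr fun n => (inv_mul_cancel₀ ((h _).g_zero_pos hw (hpos _)).ne').symm)
  · exact tendsto_nhds_unique (hφl 1 (by simp)) (by simp [(h _).g_one])
  · exact fun r hr => isClosed_Icc.mem_of_tendsto (hφl r hr)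
      (Eventually.of_forall fun n => hφI (m n) r hr)
  · exact fun r hr => le_of_tendsto' (((hFm r hr).pow 2).add ((hgm r hr).pow 2))
      fun n => (h (m n)).sq_add_sq_le_one hw (hpos _) r hr


lemma isProfile_of_solvesSystem (h : SolvesSystem W ε k f g) (hg : ∀ r ∈ Ioo (0:ℝ) 1, 0 < g r) :
    IsProfile (Wd W) ε k f (fun r => r * deriv f r) g (fun r => r * deriv g r) := by
  obtain ⟨hfm, hgm⟩ := isMode_of_solvesSystem h
  obtain ⟨hfc, hgc, -, -, -, -, hf0, hf1, -, hg1⟩ := h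
  exact ⟨hfc, hgc, hfm, hgm, hf0, hf1, hg1, hg, by simp, by simp⟩

/-- At the critical value, the limit of the solutions below it has vanishing second component. -/
lemma exists_isCritical (hw : IsSlope (Wd W)) (hk : 1 ≤ k) (hε : 0 < ε)
    (hsol : ∀ δ : ℝ, 0 < δ →
      ((∃ f g : ℝ → ℝ, SolvesSystem W δ k f g ∧ ∀ r ∈ Ioo (0:ℝ) 1, 0 < g r) ↔ δ < ε)) :
    ∃ f P φ Q, IsCritical (Wd W) ε k f P φ Q := by
  have hκ : 1 ≤ (k:ℝ) ^ 2 := one_le_pow₀ (by exact_mod_cast hk)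
  obtain ⟨e, -, he, hlim⟩ := exists_seq_strictMono_tendsto' (half_lt_self hε)
  have hex : ∀ n, ∃ f P g Q, IsProfile (Wd W) (e n) k f P g Q := fun n => by
    obtain ⟨f, g, h, hg⟩ := (hsol (e n) ((half_pos hε).trans (he n).1)).2 (he n).2
    exact ⟨f, _, g, _, isProfile_of_solvesSystem h hg⟩
  choose f P g Q h using hex
  obtain ⟨F, R, φ, S, c, hc, hFc, hφc, hF, hφ, hF0, hF1, hφ0, hφ1, hφI, hsq⟩ :=
    exists_limit_of_isProfile hw hκ (half_pos hε) (fun n => (he n).1.le) hlim h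
  have hVb : ∀ r ∈ Ioo (0:ℝ) 1, _ := fun r hr =>
    potential_bounds (f := F) (g := fun r => c * φ r) hw hε le_rfl
      (hsq r (Ioo_subset_Icc_self hr))
  have hM := (hVb (1 / 2) (by norm_num)).1.trans (hVb (1 / 2) (by norm_num)).2
  have hV0 := fun r hr => (hVb r hr).1
  have habs : ∀ r ∈ Icc (0:ℝ) 1, |φ r| ≤ 1 := fun r hr =>
    abs_le.2 ⟨by linarith [(hφI r hr).1], (hφI r hr).2⟩
  have hS := hφ.momentum_nonpos hV0 (fun r hr => (hφI r (Ioo_subset_Icc_self hr)).1)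
    fun r hr => habs r (Ioo_subset_Icc_self hr)
  have hS' := hφ.neg_momentum_le hM hV0 (fun r hr => (hVb r hr).2) habs
  have hφpos := hφ.pos_of_nonneg hV0 hφc (fun r hr => (hφI r hr).1) hS (by simp [hφ0])
  have hc0 : c = 0 := by
    by_contra hne
    have hcpos : 0 < c := lt_of_le_of_ne hc (Ne.symm hne)
    refine lt_irrefl ε ((hsol ε hε).1 ⟨F, fun r => c * φ r, ?_, fun r hr =>
      mul_pos hcpos (hφpos r ⟨hr.1.le, hr.2⟩)⟩)
    refine solvesSystem_of_isMode (C := c * (Wd W 1 / ε ^ 2 / 2)) hw hF (hφ.const_mul c) hFc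
      (continuousOn_const.mul hφc) (fun r hr => ?_) hF0 hF1 (by simp [hφ1])
    rw [abs_mul, abs_of_pos hcpos, abs_of_nonpos (hS r hr), mul_assoc]
    exact mul_le_mul_of_nonneg_left (hS' r hr) hc
  subst hc0
  simp only [zero_mul] at hF hφ hsq
  refine ⟨F, R, φ, S, hFc, hφc, hF, hφ, hF0, hF1, fun r hr => ?_, hφ1, hφpos, hS,
    Wd W 1 / ε ^ 2 / 2, fun r hr => ?_⟩
  · nlinarith [hsq r hr]
  · rw [abs_of_nonpos (hS r hr)]
    refine (hS' r hr).trans (mul_le_mul_of_nonneg_left ?_ (by linarith))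
    nlinarith [hr.1, hr.2]

end Limit

end RadialProfile

/-- Proposition 4.2, monotonicity: the critical values `ε_k` of the radial
system satisfy `ε_k = ε_{-k}` and are strictly increasing in `k ≥ 1`. -/
theorem statement_12
    (W : ℝ → ℝ) (hW : ContDiffOn ℝ 1 W (Iic (1:ℝ))) (hW0 : W 0 = 0)
    (hWpos : ∀ t ∈ Iic (1:ℝ), t ≠ 0 → 0 < W t)
    (hWconv : StrictConvexOn ℝ (Iic (1:ℝ)) W)
    (εc : ℤ → ℝ)
    (hεc : ∀ k : ℤ, k ≠ 0 → 0 < εc k ∧ ∀ ε : ℝ, 0 < ε →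
      ((∃ f g : ℝ → ℝ, SolvesSystem W ε k f g ∧ ∀ r ∈ Ioo (0:ℝ) 1, 0 < g r) ↔ ε < εc k)) :
    (∀ k : ℤ, 1 ≤ k → εc k = εc (-k)) ∧
    (∀ k l : ℤ, 1 ≤ k → k < l → εc k < εc l) := by
  refine ⟨fun k hk => ?_, fun k l hk hkl => ?_⟩
  · obtain ⟨hpos, hiff⟩ := hεc k (by lia)
    obtain ⟨hpos', hiff'⟩ := hεc (-k) (by lia)
    have h : ∀ ε : ℝ, 0 < ε → (ε < εc k ↔ ε < εc (-k)) := fun ε hε => by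
      rw [← hiff ε hε, ← hiff' ε hε]
      simp only [SolvesSystem, Int.cast_neg, neg_sq]
    exact le_antisymm (not_lt.1 fun hlt => lt_irrefl _ ((h _ hpos').1 hlt))
      (not_lt.1 fun hlt => lt_irrefl _ ((h _ hpos).2 hlt))
  · have hw := RadialProfile.isSlope_Wd hW hW0 hWpos hWconv
    obtain ⟨hpos, hiff⟩ := hεc k (by lia)
    obtain ⟨hpos', hiff'⟩ := hεc l (by lia)
    obtain ⟨f, P, φ, Q, h⟩ := RadialProfile.exists_isCritical hw hk hpos hiff
    obtain ⟨F, R, Φ, S, h'⟩ := RadialProfile.exists_isCritical hw (hk.trans hkl.le) hpos' hiff'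
    exact h.lt_of_mode_lt hw (by exact_mod_cast hk) (by exact_mod_cast hkl) hpos' hpos h'
end
end
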